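/- For any integers k ≥ 3 and 1 ≤ ℓ < k/2 there exists ξ > 0 such that the following holds for sufficiently large n: if H is a k-uniform hypergraph on n vertices with n divisible by k−ℓ, H is (ℓ,ξ)-extremal, and δ_{k−2}(H) > δ_{k−2}(X_{k,ℓ}(n)), then H contains a Hamiltonian ℓ-cycle. -/

import Mathlib

open Finset

/-- `E` is the edge set of a `k`-uniform hypergraph on vertex set `Fin n`:
every edge is a `k`-element set of vertices. -/
def Uniform (n k : ℕ) (E : Finset (Finset (Fin n))) : Prop :=
  ∀ e ∈ E, e.card = k

/-- The degree `d(S)` of a vertex set `S`: the number of edges containing `S`. -/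
def deg {n : ℕ} (E : Finset (Finset (Fin n))) (S : Finset (Fin n)) : ℕ :=
  (E.filter fun e => S ⊆ e).card

/-- The minimum `s`-degree `δ_s(H)`: the minimum of `d(S)` over all `s`-element
vertex sets `S`. -/
noncomputable def minDeg (n : ℕ) (E : Finset (Finset (Fin n))) (s : ℕ) : ℕ :=
  sInf {d | ∃ S : Finset (Fin n), S.card = s ∧ deg E S = d}

/-- `d(L, X^(i) Y^(j))`: the number of edges of the form `L ∪ I ∪ J` with
`I ∈ X^(i)`, `J ∈ Y^(j)` (take `Y = ∅`, `j = 0` when `Y^(j)` is omitted). -/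
def degIn {n : ℕ} (E : Finset (Finset (Fin n))) (L X Y : Finset (Fin n)) (i j : ℕ) : ℕ :=
  (E.filter fun e =>
    L ⊆ e ∧ e \ L ⊆ X ∪ Y ∧ ((e \ L) ∩ X).card = i ∧ ((e \ L) ∩ Y).card = j).card

/-- The `i`-th edge of an ℓ-cycle given by the cyclic ordering `f` of the `n`
vertices: `k` cyclically consecutive vertices starting at position `i * (k - ℓ)`. -/
def cycEdge (n k ℓ : ℕ) (f : ℕ → Fin n) (i : ℕ) : Finset (Fin n) :=
  (Finset.range k).image fun j => f ((i * (k - ℓ) + j) % n)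

/-- `H = (Fin n, E)` contains a Hamiltonian ℓ-cycle: there is a cyclic ordering of
all `n` vertices such that each of the `n / (k - ℓ)` windows of `k` consecutive
vertices (consecutive windows overlapping in `ℓ` vertices) is an edge, and two
consecutive edges share exactly `ℓ` vertices. -/
def HasHamCycle (n k ℓ : ℕ) (E : Finset (Finset (Fin n))) : Prop :=
  ∃ f : ℕ → Fin n, Set.InjOn f (Set.Iio n) ∧
    (∀ i < n / (k - ℓ), cycEdge n k ℓ f i ∈ E) ∧
    (∀ i < n / (k - ℓ),
      (cycEdge n k ℓ f i ∩ cycEdge n k ℓ f ((i + 1) % (n / (k - ℓ)))).card = ℓ)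

/-- The `i`-th edge of an ℓ-path given by the linear ordering `f`. -/
def pathEdge (n k ℓ : ℕ) (f : ℕ → Fin n) (i : ℕ) : Finset (Fin n) :=
  (Finset.range k).image fun j => f (i * (k - ℓ) + j)

/-- `f` is (the linear ordering of the vertices of) an ℓ-path with `t` edges all of
which belong to `E`: the path has `t * (k - ℓ) + ℓ` vertices, every edge consists of
`k` consecutive vertices and two consecutive edges intersect in exactly `ℓ` vertices. -/
def IsPath (n k ℓ t : ℕ) (E : Finset (Finset (Fin n))) (f : ℕ → Fin n) : Prop :=
  Set.InjOn f (Set.Iio (t * (k - ℓ) + ℓ)) ∧ ∀ i < t, pathEdge n k ℓ f i ∈ E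

/-- The vertex set of the ℓ-path described by `f` with `t` edges. -/
def pathVerts (n k ℓ t : ℕ) (f : ℕ → Fin n) : Finset (Fin n) :=
  (Finset.range (t * (k - ℓ) + ℓ)).image f

/-- The first end (first `ℓ` vertices) of the ℓ-path described by `f`. -/
def pathEnd0 (n ℓ : ℕ) (f : ℕ → Fin n) : Finset (Fin n) :=
  (Finset.range ℓ).image f

/-- The last end (last `ℓ` vertices) of the ℓ-path described by `f` with `t` edges. -/
def pathEnd1 (n k ℓ t : ℕ) (f : ℕ → Fin n) : Finset (Fin n) :=
  (Finset.Ico (t * (k - ℓ)) (t * (k - ℓ) + ℓ)).image f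

/-- The extremal hypergraph `X_{k,ℓ}(n)` on `Fin n`.  If `n` is an odd multiple of
`k - ℓ`, take `A` to be the first `⌊n / (2(k-ℓ))⌋` vertices and all `k`-sets meeting
`A` as edges.  If `n` is an even multiple of `k - ℓ`, take `A` to be the first
`n / (2(k-ℓ)) - 1` vertices, fix the `ℓ + 1` following vertices (which lie in
`B = V ∖ A`), and take as edges all `k`-sets meeting `A` together with all `k`-subsets
of `B` containing all `ℓ + 1` fixed vertices. -/
def Xedges (n k ℓ : ℕ) : Finset (Finset (Fin n)) :=
  if Odd (n / (k - ℓ)) then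
    (Finset.powersetCard k (Finset.univ : Finset (Fin n))).filter fun e =>
      ∃ v ∈ e, (v : ℕ) < n / (2 * (k - ℓ))
  else
    (Finset.powersetCard k (Finset.univ : Finset (Fin n))).filter fun e =>
      (∃ v ∈ e, (v : ℕ) < n / (2 * (k - ℓ)) - 1) ∨
      ((∀ v ∈ e, n / (2 * (k - ℓ)) - 1 ≤ (v : ℕ)) ∧
        ∀ w : Fin n, n / (2 * (k - ℓ)) - 1 ≤ (w : ℕ) → (w : ℕ) < n / (2 * (k - ℓ)) + ℓ →
          w ∈ e)

/-- `e(B)`: the number of edges lying entirely inside `B`. -/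
def edgesIn {n : ℕ} (E : Finset (Finset (Fin n))) (B : Finset (Fin n)) : ℕ :=
  (E.filter fun e => e ⊆ B).card

/-- `(A, B)` is an `(ℓ,ξ)`-extremal partition of the vertex set:
`|A| = ⌈n/(2(k-ℓ))⌉ - 1`, `|B| = ⌊(2(k-ℓ)-1)n/(2(k-ℓ)) + 1⌋` and
`e(B) ≤ ξ · C(n,k)`. -/
def IsExtremalPartition (n k ℓ : ℕ) (E : Finset (Finset (Fin n))) (ξ : ℝ)
    (A B : Finset (Fin n)) : Prop :=
  Disjoint A B ∧ A ∪ B = Finset.univ ∧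
  A.card = ⌈(n : ℝ) / (2 * ((k - ℓ : ℕ) : ℝ))⌉₊ - 1 ∧
  B.card = ⌊(2 * ((k - ℓ : ℕ) : ℝ) - 1) * (n : ℝ) / (2 * ((k - ℓ : ℕ) : ℝ)) + 1⌋₊ ∧
  (edgesIn E B : ℝ) ≤ ξ * (n.choose k : ℝ)

/-- `H` is `(ℓ,ξ)`-extremal. -/
def IsExtremal (n k ℓ : ℕ) (E : Finset (Finset (Fin n))) (ξ : ℝ) : Prop :=
  ∃ A B, IsExtremalPartition n k ℓ E ξ A B

/-- `(A, B)` is a minimal `(ℓ,ξ)`-extremal partition: among all `(ℓ,ξ)`-extremal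
partitions it minimises `e(B)`. -/
def IsMinExtremalPartition (n k ℓ : ℕ) (E : Finset (Finset (Fin n))) (ξ : ℝ)
    (A B : Finset (Fin n)) : Prop :=
  IsExtremalPartition n k ℓ E ξ A B ∧
  ∀ A' B' : Finset (Fin n), IsExtremalPartition n k ℓ E ξ A' B' →
    edgesIn E B ≤ edgesIn E B'

open scoped Classical in
/-- `A_ε`: the set of vertices `v` with `d(v, B^(k-1)) ≥ (1-ε)·C(|B|, k-1)`. -/
noncomputable def Aeps (n k : ℕ) (E : Finset (Finset (Fin n))) (B : Finset (Fin n)) (ε : ℝ) :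
    Finset (Fin n) :=
  Finset.univ.filter fun v =>
    (1 - ε) * (B.card.choose (k - 1) : ℝ) ≤ (degIn E {v} B ∅ (k - 1) 0 : ℝ)

open scoped Classical in
/-- `B_ε`: the set of vertices `v` with `d(v, B^(k-1)) ≤ ε·C(|B|, k-1)`. -/
noncomputable def Beps (n k : ℕ) (E : Finset (Finset (Fin n))) (B : Finset (Fin n)) (ε : ℝ) :
    Finset (Fin n) :=
  Finset.univ.filter fun v =>
    (degIn E {v} B ∅ (k - 1) 0 : ℝ) ≤ ε * (B.card.choose (k - 1) : ℝ)

/-- `V_ε = V ∖ (A_ε ∪ B_ε)`. -/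
noncomputable def Veps (n k : ℕ) (E : Finset (Finset (Fin n))) (B : Finset (Fin n)) (ε : ℝ) :
    Finset (Fin n) :=
  Finset.univ \ (Aeps n k E B ε ∪ Beps n k E B ε)

/-- `L` is an ε-typical ℓ-set: `L ⊆ B_ε`, `|L| = ℓ` and
`d(L, B^(k-ℓ)) ≤ ε·C(|B|, k-ℓ)`. -/
def IsTypical (n k ℓ : ℕ) (E : Finset (Finset (Fin n))) (B : Finset (Fin n)) (ε : ℝ)
    (L : Finset (Fin n)) : Prop :=
  L.card = ℓ ∧ L ⊆ Beps n k E B ε ∧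
    (degIn E L B ∅ (k - ℓ) 0 : ℝ) ≤ ε * (B.card.choose (k - ℓ) : ℝ)

namespace LooseCycle

/-- The proportion of a finite type occupied by a set. -/
noncomputable def frac {Ω : Type*} (s : Set Ω) : ℝ := (s.ncard : ℝ) / (Nat.card Ω : ℝ)

section Frac

variable {Ω Ω' : Type*} [Finite Ω] [Finite Ω']

lemma frac_nonneg (s : Set Ω) : 0 ≤ frac s := by unfold frac; positivity

lemma frac_mono {s t : Set Ω} (h : s ⊆ t) : frac s ≤ frac t := by
  unfold frac
  gcongr
  exact Set.toFinite t

lemma frac_union_le (s t : Set Ω) : frac (s ∪ t) ≤ frac s + frac t := by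
  unfold frac
  rw [← add_div]
  gcongr
  exact_mod_cast Set.ncard_union_le s t

lemma frac_le_add {s t u : Set Ω} (h : s ⊆ t ∪ u) : frac s ≤ frac t + frac u :=
  (frac_mono h).trans (frac_union_le t u)

lemma frac_le_one (s : Set Ω) : frac s ≤ 1 := by
  unfold frac
  apply div_le_one_of_le₀ _ (by positivity)
  exact_mod_cast Set.ncard_le_card s

lemma exists_mem_notMem_of_frac_lt {s t : Set Ω} (h : frac t < frac s) : ∃ ω ∈ s, ω ∉ t := by
  by_contra! hc
  exact absurd (frac_mono (fun ω hω => hc ω hω : s ⊆ t)) (not_le.mpr h)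

lemma frac_univ [Nonempty Ω] : frac (Set.univ : Set Ω) = 1 := by
  unfold frac
  rw [Set.ncard_univ]
  exact div_self (by exact_mod_cast Nat.card_pos.ne')

lemma frac_preimage_equiv (e : Ω ≃ Ω') (s : Set Ω') : frac (e ⁻¹' s) = frac s := by
  unfold frac
  rw [Nat.card_congr e, Set.ncard_preimage_of_injective_subset_range e.injective (by simp)]

lemma frac_prod (s : Set Ω) (t : Set Ω') : frac (s ×ˢ t) = frac s * frac t := by
  unfold frac
  rw [Set.ncard_prod, Nat.card_prod]
  push_cast
  rw [div_mul_div_comm]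

lemma frac_empty : frac (∅ : Set Ω) = 0 := by simp [frac]

lemma frac_compl [Nonempty Ω] (s : Set Ω) : frac sᶜ = 1 - frac s := by
  unfold frac
  have := Set.ncard_add_ncard_compl s
  have h0 : (Nat.card Ω : ℝ) ≠ 0 := by exact_mod_cast Nat.card_pos.ne'
  field_simp
  rw [← this]; push_cast; ring

/-- Averaging over the first coordinate. -/
lemma frac_eq_avg {Ω : Type*} [Fintype Ω] (s : Set (Ω × Ω')) :
    frac s = (∑ ω, frac {y | (ω, y) ∈ s}) / (Nat.card Ω : ℝ) := by
  classical
  have := Fintype.ofFinite Ω'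
  have h : s.ncard = ∑ ω, {y | (ω, y) ∈ s}.ncard := by
    rw [Set.ncard_eq_toFinset_card', Finset.card_eq_sum_card_fiberwise
      (f := Prod.fst) (t := Finset.univ) (by simp)]
    refine Finset.sum_congr rfl fun ω _ => ?_
    rw [Set.ncard_eq_toFinset_card']
    refine Finset.card_nbij' Prod.snd (fun y => (ω, y)) ?_ ?_ ?_ ?_
    · rintro ⟨a, b⟩; simp; rintro h rfl; exact h
    · intro y; simp
    · rintro ⟨a, b⟩; simp; rintro h rfl; rfl
    · intro y; simp
  unfold frac
  rw [h, Nat.card_prod]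
  push_cast
  rw [← Finset.sum_div, div_div, mul_comm (Nat.card Ω : ℝ)]

lemma frac_eq_sum_indicator {Ω : Type*} [Fintype Ω] (s : Set Ω) :
    frac s = (∑ ω, s.indicator (fun _ => (1 : ℝ)) ω) / (Nat.card Ω : ℝ) := by
  classical
  unfold frac
  rw [Set.ncard_eq_toFinset_card']
  congr 1
  simp [Set.indicator_apply]

/-- A fibrewise inequality outside an exceptional set integrates. -/
lemma frac_le_of_fiber {Ω'' : Type*} [Finite Ω''] {s : Set (Ω × Ω')} {t : Set (Ω × Ω'')}
    {z : Set Ω} {C D : ℝ} (hC : 0 ≤ C) (hD : 0 ≤ D)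
    (h : ∀ ω, ω ∉ z → frac {y | (ω, y) ∈ s} ≤ C * frac {y | (ω, y) ∈ t} + D) :
    frac s ≤ C * frac t + D + frac z := by
  classical
  have := Fintype.ofFinite Ω
  rcases isEmpty_or_nonempty Ω with hΩ | hΩ
  · simp [frac]; positivity
  have hpos : (0 : ℝ) < Nat.card Ω := by exact_mod_cast Nat.card_pos
  rw [frac_eq_avg s, frac_eq_avg t, frac_eq_sum_indicator z]
  have hD' : D = (∑ _ω : Ω, D) / (Nat.card Ω : ℝ) := by
    rw [Finset.sum_const, Finset.card_univ, nsmul_eq_mul, Nat.card_eq_fintype_card]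
    rw [Nat.card_eq_fintype_card] at hpos
    field_simp
  rw [hD', mul_div_assoc', ← add_div, ← add_div]
  gcongr
  rw [Finset.mul_sum, ← Finset.sum_add_distrib, ← Finset.sum_add_distrib]
  refine Finset.sum_le_sum fun ω _ => ?_
  by_cases hω : ω ∈ z
  · have h1 := frac_le_one {y | (ω, y) ∈ s}
    have h2 := frac_nonneg {y | (ω, y) ∈ t}
    simp only [Set.indicator_of_mem hω]
    have : 0 ≤ C * frac {y | (ω, y) ∈ t} := by positivity
    linarith
  · simp only [Set.indicator_of_notMem hω, add_zero]
    exact h ω hω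

/-- Markov's inequality for fibres. -/
lemma frac_heavy_le {s : Set (Ω × Ω')} {t : ℝ} (ht : 0 < t) :
    frac {ω | t < frac {y | (ω, y) ∈ s}} ≤ frac s / t := by
  classical
  have := Fintype.ofFinite Ω
  rw [le_div_iff₀ ht, frac_eq_avg s, frac_eq_sum_indicator, div_mul_eq_mul_div]
  gcongr
  rw [Finset.sum_mul]
  refine Finset.sum_le_sum fun ω _ => ?_
  by_cases hω : t < frac {y | (ω, y) ∈ s}
  · rw [Set.indicator_of_mem (by exact hω)]; linarith
  · rw [Set.indicator_of_notMem (by exact hω)]; simpa using frac_nonneg _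

lemma frac_le_rich_add {s : Set (Ω × Ω')} {t : ℝ} (ht : 0 ≤ t) :
    frac s ≤ frac {ω | t ≤ frac {y | (ω, y) ∈ s}} + t := by
  have := frac_le_of_fiber (s := s) (t := (∅ : Set (Ω × Ω)))
    (z := {ω | t ≤ frac {y | (ω, y) ∈ s}}) (C := 0) (D := t) le_rfl ht
    (fun ω hω => by simp at hω; linarith)
  linarith

lemma frac_le_of_fiber_le {s : Set (Ω × Ω')} {D : ℝ} (hD : 0 ≤ D)
    (h : ∀ ω, frac {y | (ω, y) ∈ s} ≤ D) : frac s ≤ D := by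
  have := frac_le_of_fiber (s := s) (t := (∅ : Set (Ω × Ω)))
    (z := ∅) (C := 0) (D := D) le_rfl hD (fun ω _ => by simpa using h ω)
  simp only [frac_empty] at this
  linarith

lemma frac_preimage_le_of_injective [Nonempty Ω] {f : Ω → Ω'} (hf : Function.Injective f)
    (s : Set Ω') :
    frac (f ⁻¹' s) ≤ (Nat.card Ω' : ℝ) / (Nat.card Ω : ℝ) * frac s := by
  have h1 : (f ⁻¹' s).ncard ≤ s.ncard :=
    Set.ncard_le_ncard_of_injOn f (fun x hx => hx) hf.injOn (Set.toFinite s)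
  have h0 : (0 : ℝ) < Nat.card Ω' := by
    have : Nonempty Ω' := Nonempty.map f inferInstance
    exact_mod_cast Nat.card_pos
  unfold frac
  rw [div_mul_div_comm, mul_comm (Nat.card Ω' : ℝ), mul_div_mul_right _ _ h0.ne']
  gcongr

end Frac

section Tuples

variable {V : Type*} [Finite V] {ι κ : Type*} [Finite ι] [Finite κ]

/-- Cylinder events have the proportion of their base. -/
lemma frac_comp [Nonempty V] {e : κ → ι} (he : Function.Injective e) (s : Set (κ → V)) :
    frac {y : ι → V | y ∘ e ∈ s} = frac s := by
  classical
  let φ : (ι → V) ≃ (κ → V) × ({i // i ∉ Set.range e} → V) :=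
    (Equiv.piEquivPiSubtypeProd (fun i => i ∈ Set.range e) (fun _ => V)).trans
      (Equiv.prodCongr ((Equiv.ofInjective e he).arrowCongr (Equiv.refl V)).symm (Equiv.refl _))
  have h : {y : ι → V | y ∘ e ∈ s} = φ ⁻¹' (s ×ˢ Set.univ) := by
    ext y
    have : (φ y).1 = y ∘ e := by
      funext c
      simp [φ, Equiv.arrowCongr]
    simp [this]
  rw [h, frac_preimage_equiv, frac_prod, frac_univ, mul_one]

lemma frac_eval [Nonempty V] (i : ι) (s : Set V) : frac {y : ι → V | y i ∈ s} = frac s := by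
  have h := frac_comp (V := V) (e := fun _ : Unit => i) (fun _ _ _ => rfl)
    {z : Unit → V | z () ∈ s}
  have h2 := frac_preimage_equiv (Equiv.funUnique Unit V) s
  rw [← h2]
  exact h

lemma frac_hit_le [Nonempty V] [Fintype ι] (s : Set V) :
    frac {y : ι → V | ∃ i, y i ∈ s} ≤ Fintype.card ι * frac s := by
  classical
  have h : ∀ t : Finset ι, frac {y : ι → V | ∃ i ∈ t, y i ∈ s} ≤ t.card * frac s := by
    intro t
    induction t using Finset.induction_on with
    | empty => simp [frac_empty]
    | insert a t ha ih =>
      rw [Finset.card_insert_of_notMem ha]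
      have : {y : ι → V | ∃ i ∈ insert a t, y i ∈ s} ⊆
          {y : ι → V | y a ∈ s} ∪ {y : ι → V | ∃ i ∈ t, y i ∈ s} := by
        intro y; simp
      have h2 := frac_le_add this
      rw [frac_eval] at h2
      push_cast
      linarith
  have := h Finset.univ
  simpa using this

lemma frac_forall [Nonempty V] [Fintype ι] (s : Set V) :
    frac {y : ι → V | ∀ i, y i ∈ s} = frac s ^ Fintype.card ι := by
  classical
  have := Fintype.ofFinite V
  have h : {y : ι → V | ∀ i, y i ∈ s} = ↑(Fintype.piFinset fun _ : ι => s.toFinset) := by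
    ext y; simp
  unfold frac
  rw [h, Set.ncard_coe_finset, Fintype.card_piFinset, Nat.card_eq_fintype_card,
    Nat.card_eq_fintype_card, Fintype.card_fun, Set.ncard_eq_toFinset_card', div_pow]
  simp

lemma frac_eq_le [Nonempty V] {i j : ι} (hij : i ≠ j) :
    frac {y : ι → V | y i = y j} ≤ 1 / (Nat.card V : ℝ) := by
  classical
  let φ := (Equiv.funSplitAt (β := V) i).trans (Equiv.prodComm _ _)
  have h : {y : ι → V | y i = y j} = φ ⁻¹' {p | p.2 = p.1 ⟨j, hij.symm⟩} := by
    ext y; simp [φ]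
  rw [h, frac_preimage_equiv]
  refine frac_le_of_fiber_le (by positivity) fun ω => ?_
  have : {y : V | (ω, y) ∈ {p : ({j // j ≠ i} → V) × V | p.2 = p.1 ⟨j, hij.symm⟩}}
      = {ω ⟨j, hij.symm⟩} := by ext y; simp
  rw [this]
  simp [frac]

lemma frac_not_injective_le [Nonempty V] [Fintype ι] :
    frac {y : ι → V | ¬ Function.Injective y} ≤ (Fintype.card ι : ℝ) ^ 2 / (Nat.card V : ℝ) := by
  classical
  have h : ∀ t : Finset (ι × ι), frac {y : ι → V | ∃ p ∈ t, p.1 ≠ p.2 ∧ y p.1 = y p.2} ≤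
      t.card * (1 / (Nat.card V : ℝ)) := by
    intro t
    induction t using Finset.induction_on with
    | empty => simp [frac_empty]
    | insert a t ha ih =>
      rw [Finset.card_insert_of_notMem ha]
      have h1 : {y : ι → V | ∃ p ∈ insert a t, p.1 ≠ p.2 ∧ y p.1 = y p.2} ⊆
          {y : ι → V | a.1 ≠ a.2 ∧ y a.1 = y a.2} ∪
            {y : ι → V | ∃ p ∈ t, p.1 ≠ p.2 ∧ y p.1 = y p.2} := by
        intro y; simp only [Finset.mem_insert, Set.mem_ofPred_eq, Set.mem_union]
        rintro ⟨p, rfl | hp, h⟩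
        · exact Or.inl h
        · exact Or.inr ⟨p, hp, h⟩
      have h2 := frac_le_add h1
      have h3 : frac {y : ι → V | a.1 ≠ a.2 ∧ y a.1 = y a.2} ≤ 1 / (Nat.card V : ℝ) := by
        by_cases hne : a.1 = a.2
        · simp only [hne, ne_eq, not_true_eq_false, false_and, Set.ofPred_false, frac_empty]
          positivity
        · exact (frac_mono fun y hy => hy.2).trans (frac_eq_le hne)
      push_cast
      linarith
  have h2 := h Finset.univ
  refine (frac_mono ?_).trans (h2.trans (le_of_eq ?_))
  · intro y hy
    simp only [Function.Injective, not_forall, Set.mem_ofPred_eq] at hy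
    obtain ⟨i, j, hij, hne⟩ := hy
    exact ⟨(i, j), Finset.mem_univ _, hne, hij⟩
  · rw [Finset.card_univ, Fintype.card_prod]; push_cast; ring

end Tuples

/-- The set of entries of a tuple. -/
def im {V ι : Type*} [DecidableEq V] [Fintype ι] (y : ι → V) : Finset V := Finset.univ.image y

section Im

variable {V ι : Type*} [DecidableEq V] [Fintype ι]

lemma mem_im {y : ι → V} {v : V} : v ∈ im y ↔ ∃ i, y i = v := by simp [im]

lemma im_eq_toFinset {s : ℕ} (y : Fin s → V) : im y = (List.ofFn y).toFinset := by
  ext v; simp [mem_im, List.mem_ofFn]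

lemma card_im_le (y : ι → V) : (im y).card ≤ Fintype.card ι := by
  unfold im; exact Finset.card_image_le

lemma card_im {y : ι → V} (hy : Function.Injective y) : (im y).card = Fintype.card ι := by
  unfold im; rw [Finset.card_image_of_injective _ hy, Finset.card_univ]

end Im

/-- `Walk r E t S T vs`: a sequence of `t` edges, consecutive ones overlapping in `l + 1` listed
vertices, starting with the tuple `S`; `vs` lists all vertices before the final tuple `T`. -/
inductive Walk {V : Type*} [DecidableEq V] {l : ℕ} (r : ℕ) (E : Finset (Finset V)) :
    ℕ → (Fin (l + 1) → V) → (Fin (l + 1) → V) → List V → Prop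
  | nil (L : Fin (l + 1) → V) : Walk r E 0 L L []
  | cons {t : ℕ} {L : Fin (l + 1) → V} {M : Fin (r + 1) → V} {L' T : Fin (l + 1) → V}
      {vs : List V} (he : im L ∪ im M ∪ im L' ∈ E) (h : Walk r E t L' T vs) :
      Walk r E (t + 1) L T (List.ofFn L ++ List.ofFn M ++ vs)

namespace Walk

variable {V : Type*} [DecidableEq V] {l r : ℕ} {E : Finset (Finset V)}

lemma single {L : Fin (l + 1) → V} {M : Fin (r + 1) → V} {L' : Fin (l + 1) → V}
    (he : im L ∪ im M ∪ im L' ∈ E) :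
    Walk r E 1 L L' (List.ofFn L ++ List.ofFn M) := by
  have := Walk.cons (r := r) he (Walk.nil L')
  simpa using this

lemma append {s t : ℕ} {S T U : Fin (l + 1) → V} {vs ws : List V}
    (h₁ : Walk r E s S T vs) (h₂ : Walk r E t T U ws) :
    Walk r E (s + t) S U (vs ++ ws) := by
  induction h₁ with
  | nil L => simpa using h₂
  | cons he _ ih =>
    have := Walk.cons he (ih h₂)
    rw [List.append_assoc, Nat.add_right_comm]
    exact this

lemma length_eq {t : ℕ} {S T : Fin (l + 1) → V} {vs : List V}
    (h : Walk r E t S T vs) : vs.length = t * (l + r + 2) := by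
  induction h with
  | nil L => simp
  | cons he _ ih => simp only [List.length_append, List.length_ofFn, ih]; ring

lemma exists_eq_append {t : ℕ} {S T : Fin (l + 1) → V} {vs : List V}
    (h : Walk r E t S T vs) : ∃ ws, vs ++ List.ofFn T = List.ofFn S ++ ws := by
  cases h with
  | nil L => exact ⟨[], by simp⟩
  | cons he h => exact ⟨_, by rw [List.append_assoc, List.append_assoc]⟩

lemma window_mem {t : ℕ} {S T : Fin (l + 1) → V} {vs : List V}
    (h : Walk r E t S T vs) {i : ℕ} (hi : i < t) :
    (((vs ++ List.ofFn T).drop (i * (l + r + 2))).take (2 * l + r + 3)).toFinset ∈ E := by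
  induction h generalizing i with
  | nil L => simp at hi
  | @cons t L M L' T vs he h ih =>
    obtain ⟨ws, hws⟩ := h.exists_eq_append
    cases i with
    | zero =>
      have h1 : List.ofFn L ++ List.ofFn M ++ vs ++ List.ofFn T =
          (List.ofFn L ++ List.ofFn M ++ List.ofFn L') ++ ws := by
        rw [List.append_assoc, hws, ← List.append_assoc]
      rw [zero_mul, List.drop_zero, h1, List.take_left' (by simp; omega)]
      rw [List.toFinset_append, List.toFinset_append, ← im_eq_toFinset, ← im_eq_toFinset,
        ← im_eq_toFinset]
      exact he
    | succ i =>
      have h1 := ih (i := i) (by omega)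
      rw [List.append_assoc, show (i + 1) * (l + r + 2) = (l + r + 2) + i * (l + r + 2) by ring,
        ← List.drop_drop, List.drop_left' (by simp; omega)]
      exact h1

end Walk

/-- A closed walk through all vertices is a Hamiltonian cycle. -/
lemma Walk.hasHamCycle {n m l r : ℕ} {E : Finset (Finset (Fin n))}
    (hn : n = m * (l + r + 2)) (hm : 3 ≤ m) {L : Fin (l + 1) → Fin n} {vs : List (Fin n)}
    (h : Walk r E m L L vs) (hcover : ∀ v, v ∈ vs) :
    HasHamCycle n (2 * l + r + 3) (l + 1) E := by
  have hlen : vs.length = n := by rw [h.length_eq, hn]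
  have hd : 2 * l + r + 3 - (l + 1) = l + r + 2 := by omega
  have hnd : vs.Nodup := by
    have h1 : vs.toFinset = Finset.univ := by ext v; simp [hcover v]
    have h2 : vs.toFinset.card = vs.length := by rw [h1, hlen]; simp
    rw [List.card_toFinset] at h2
    rw [← List.dedup_eq_self]
    exact (List.dedup_sublist vs).eq_of_length h2
  have hnpos : 0 < n := by rw [hn]; positivity
  have hnm : n / (l + r + 2) = m := by rw [hn]; exact Nat.mul_div_cancel _ (by omega)
  set f : ℕ → Fin n := fun i => vs.getD i ⟨0, hnpos⟩ with hf
  have hfi : Set.InjOn f (Set.Iio n) := by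
    intro a ha b hb hab
    simp only [Set.mem_Iio] at ha hb
    simp only [hf] at hab
    rw [List.getD_eq_getElem _ _ (by omega), List.getD_eq_getElem _ _ (by omega)] at hab
    exact (hnd.getElem_inj_iff).mp hab
  have hpre : List.ofFn L <+: vs := by
    obtain ⟨ws, hws⟩ := h.exists_eq_append
    have h1 : vs <+: vs ++ List.ofFn L := List.prefix_append _ _
    have h2 : List.ofFn L <+: vs ++ List.ofFn L := by rw [hws]; exact List.prefix_append _ _
    refine List.prefix_of_prefix_length_le h2 h1 ?_
    rw [hlen, List.length_ofFn]
    have : 3 * (l + r + 2) ≤ n := by rw [hn]; exact Nat.mul_le_mul_right _ hm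
    omega
  obtain ⟨us, hus⟩ := hpre
  have hget : ∀ i (hi : i < (vs ++ List.ofFn L).length), (vs ++ List.ofFn L)[i] = f (i % n) := by
    intro i hi
    simp only [List.length_append, List.length_ofFn, hlen] at hi
    by_cases hin : i < n
    · rw [Nat.mod_eq_of_lt hin, List.getElem_append_left (by omega)]
      simp only [hf]
      rw [List.getD_eq_getElem _ _ (by omega)]
    · have h1 : i - n < n := by
        have : 3 * (l + r + 2) ≤ n := by rw [hn]; exact Nat.mul_le_mul_right _ hm
        omega
      have h2 : i % n = i - n := by
        rw [Nat.mod_eq_sub_mod (by omega), Nat.mod_eq_of_lt h1]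
      rw [List.getElem_append_right (by omega), h2]
      simp only [hf]
      rw [List.getD_eq_getElem _ _ (by omega)]
      simp only [← hus]
      rw [List.getElem_append_left (by simp; omega)]
      congr 1
      rw [hus, hlen]
  have hwin : ∀ i < m, cycEdge n (2 * l + r + 3) (l + 1) f i =
      (((vs ++ List.ofFn L).drop (i * (l + r + 2))).take (2 * l + r + 3)).toFinset := by
    intro i hi
    have hb : i * (l + r + 2) + (2 * l + r + 3) ≤ n + (l + 1) := by
      rw [hn]; nlinarith
    ext v
    unfold cycEdge
    rw [hd]
    simp only [Finset.mem_image, Finset.mem_range, List.mem_toFinset, List.mem_iff_getElem]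
    constructor
    · rintro ⟨j, hj, rfl⟩
      refine ⟨j, by simp [hlen]; omega, ?_⟩
      rw [List.getElem_take, List.getElem_drop, hget]
    · rintro ⟨j, hj, rfl⟩
      refine ⟨j, by simp at hj; omega, ?_⟩
      rw [List.getElem_take, List.getElem_drop, hget]
  refine ⟨f, hfi, ?_, ?_⟩
  · intro i hi
    rw [hd, hnm] at hi
    rw [hwin i hi]
    exact h.window_mem hi
  · intro i hi
    rw [hd, hnm] at hi ⊢
    have hk : ∀ c, (2 * l + r + 3) + (l + r + 2) ≤ n ∧ c ≤ (2 * l + r + 3) + (l + r + 2) →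
        ∀ a, ((Finset.range c).image fun j => f ((a + j) % n)).card = c := by
      rintro c ⟨hc, hcc⟩ a
      rw [Finset.card_image_of_injOn, Finset.card_range]
      intro x hx y hy hxy
      simp only [Finset.coe_range, Set.mem_Iio] at hx hy
      have h1 := hfi (Nat.mod_lt _ hnpos) (Nat.mod_lt _ hnpos) hxy
      have h2 : x ≡ y [MOD n] := Nat.ModEq.add_left_cancel' a h1
      exact Nat.ModEq.eq_of_lt_of_lt h2 (by omega) (by omega)
    have hkn : (2 * l + r + 3) + (l + r + 2) ≤ n := by rw [hn]; nlinarith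
    have e1 : cycEdge n (2 * l + r + 3) (l + 1) f i =
        (Finset.range (2 * l + r + 3)).image fun j => f ((i * (l + r + 2) + j) % n) := by
      unfold cycEdge; rw [hd]
    have e2 : cycEdge n (2 * l + r + 3) (l + 1) f ((i + 1) % m) =
        (Finset.range (2 * l + r + 3)).image
          fun j => f ((i * (l + r + 2) + (l + r + 2) + j) % n) := by
      unfold cycEdge
      rw [hd]
      refine Finset.image_congr fun j _ => ?_
      congr 1
      have : (i + 1) % m * (l + r + 2) ≡ i * (l + r + 2) + (l + r + 2) [MOD n] := by
        rw [← Nat.succ_mul, hn]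
        exact Nat.ModEq.mul_right' _ (Nat.mod_modEq _ _)
      exact this.add_right j
    have e3 : cycEdge n (2 * l + r + 3) (l + 1) f i ∪
        cycEdge n (2 * l + r + 3) (l + 1) f ((i + 1) % m) =
        (Finset.range ((2 * l + r + 3) + (l + r + 2))).image
          fun j => f ((i * (l + r + 2) + j) % n) := by
      rw [e1, e2]
      ext v
      simp only [Finset.mem_union, Finset.mem_image, Finset.mem_range]
      constructor
      · rintro (⟨j, hj, rfl⟩ | ⟨j, hj, rfl⟩)
        · exact ⟨j, by omega, rfl⟩
        · exact ⟨l + r + 2 + j, by omega, by rw [← add_assoc]⟩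
      · rintro ⟨j, hj, rfl⟩
        by_cases hjk : j < 2 * l + r + 3
        · exact Or.inl ⟨j, hjk, rfl⟩
        · exact Or.inr ⟨j - (l + r + 2), by omega, by congr 2; omega⟩
    have h3 := Finset.card_union_add_card_inter (cycEdge n (2 * l + r + 3) (l + 1) f i)
      (cycEdge n (2 * l + r + 3) (l + 1) f ((i + 1) % m))
    rw [e3, hk _ ⟨hkn, le_rfl⟩, e1, e2, hk _ ⟨hkn, by omega⟩, hk _ ⟨hkn, by omega⟩] at h3
    rw [e1, e2]
    omega

lemma frac_singleton {J : Type*} [Finite J] (v : J) :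
    frac ({v} : Set J) = 1 / (Nat.card J : ℝ) := by simp [frac]

lemma frac_eq_inter_le {J T : Type*} [Finite J] [Nonempty J] [Finite T] {z a b : T}
    (hab : a ≠ b) (haz : a ≠ z) (v : J) :
    frac {x : T → J | x z = v ∧ x a = x b} ≤ 1 / (Nat.card J : ℝ) ^ 2 := by
  classical
  let φ := (Equiv.funSplitAt (β := J) a).trans (Equiv.prodComm _ _)
  have h : {x : T → J | x z = v ∧ x a = x b} =
      φ ⁻¹' {p | p.1 ⟨z, haz.symm⟩ = v ∧ p.2 = p.1 ⟨b, hab.symm⟩} := by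
    ext y; simp [φ]
  rw [h, frac_preimage_equiv]
  have h1 := frac_le_of_fiber
    (s := {p : ({j // j ≠ a} → J) × J | p.1 ⟨z, haz.symm⟩ = v ∧ p.2 = p.1 ⟨b, hab.symm⟩})
    (t := {p : ({j // j ≠ a} → J) × Unit | p.1 ⟨z, haz.symm⟩ = v}) (z := ∅)
    (C := 1 / (Nat.card J : ℝ)) (D := 0) (by positivity) le_rfl (by
      intro ω _
      by_cases hω : ω ⟨z, haz.symm⟩ = v
      · have e1 : {y : J | (ω, y) ∈ {p : ({j // j ≠ a} → J) × J |
            p.1 ⟨z, haz.symm⟩ = v ∧ p.2 = p.1 ⟨b, hab.symm⟩}} = {ω ⟨b, hab.symm⟩} := by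
          ext y; simp [hω]
        have e2 : {y : Unit | (ω, y) ∈ {p : ({j // j ≠ a} → J) × Unit |
            p.1 ⟨z, haz.symm⟩ = v}} = Set.univ := by
          ext y; simp [hω]
        rw [e1, e2, frac_univ, frac_singleton]
        simp
      · have e1 : {y : J | (ω, y) ∈ {p : ({j // j ≠ a} → J) × J |
            p.1 ⟨z, haz.symm⟩ = v ∧ p.2 = p.1 ⟨b, hab.symm⟩}} = ∅ := by
          ext y; simp [hω]
        rw [e1, frac_empty, add_zero]
        exact mul_nonneg (by positivity) (frac_nonneg _))
  have h2 : {p : ({j // j ≠ a} → J) × Unit | p.1 ⟨z, haz.symm⟩ = v} =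
      {y : {j // j ≠ a} → J | y ⟨z, haz.symm⟩ ∈ ({v} : Set J)} ×ˢ Set.univ := by
    ext p; simp
  rw [h2, frac_prod, frac_univ, frac_eval, frac_singleton, frac_empty] at h1
  calc _ ≤ _ := h1
    _ = _ := by field_simp; ring

lemma frac_eval_inter_not_injective_le {J T : Type*} [Finite J] [Nonempty J] [Fintype T]
    (z : T) (v : J) :
    frac {x : T → J | x z = v ∧ ¬ Function.Injective x} ≤
      (Fintype.card T : ℝ) ^ 2 / (Nat.card J : ℝ) ^ 2 := by
  classical
  have h : ∀ t : Finset (T × T),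
      frac {x : T → J | x z = v ∧ ∃ p ∈ t, p.1 ≠ p.2 ∧ x p.1 = x p.2} ≤
      t.card * (1 / (Nat.card J : ℝ) ^ 2) := by
    intro t
    induction t using Finset.induction_on with
    | empty => simp [frac_empty]
    | insert a t ha ih =>
      rw [Finset.card_insert_of_notMem ha]
      have h1 : {x : T → J | x z = v ∧ ∃ p ∈ insert a t, p.1 ≠ p.2 ∧ x p.1 = x p.2} ⊆
          {x : T → J | x z = v ∧ a.1 ≠ a.2 ∧ x a.1 = x a.2} ∪
            {x : T → J | x z = v ∧ ∃ p ∈ t, p.1 ≠ p.2 ∧ x p.1 = x p.2} := by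
        intro y; simp only [Finset.mem_insert, Set.mem_ofPred_eq, Set.mem_union]
        rintro ⟨hz, p, rfl | hp, h⟩
        · exact Or.inl ⟨hz, h⟩
        · exact Or.inr ⟨hz, p, hp, h⟩
      have h2 := frac_le_add h1
      have h3 : frac {x : T → J | x z = v ∧ a.1 ≠ a.2 ∧ x a.1 = x a.2} ≤
          1 / (Nat.card J : ℝ) ^ 2 := by
        by_cases hne : a.1 = a.2
        · simp only [hne, ne_eq, not_true_eq_false, false_and, and_false, Set.ofPred_false,
            frac_empty]
          positivity
        · by_cases h1z : a.1 = z
          · refine (frac_mono (t := {x : T → J | x z = v ∧ x a.2 = x a.1})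
              fun y hy => ⟨hy.1, hy.2.2.symm⟩).trans
                (frac_eq_inter_le (Ne.symm hne) (fun h2z => hne (h1z.trans h2z.symm)) v)
          · exact (frac_mono (t := {x : T → J | x z = v ∧ x a.1 = x a.2})
              fun y hy => ⟨hy.1, hy.2.2⟩).trans (frac_eq_inter_le hne h1z v)
      push_cast
      linarith
  have h2 := h Finset.univ
  refine (frac_mono ?_).trans (h2.trans (le_of_eq ?_))
  · rintro y ⟨hz, hy⟩
    simp only [Function.Injective, not_forall] at hy
    obtain ⟨i, j, hij, hne⟩ := hy
    exact ⟨hz, (i, j), Finset.mem_univ _, hne, hij⟩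
  · rw [Finset.card_univ, Fintype.card_prod]; push_cast; ring

lemma frac_biUnion_le {Ω T : Type*} [Finite Ω] (t : Finset T) (s : T → Set Ω) {δ : ℝ}
    (h : ∀ i ∈ t, frac (s i) ≤ δ) : frac {ω | ∃ i ∈ t, ω ∈ s i} ≤ t.card * δ := by
  classical
  induction t using Finset.induction_on with
  | empty => simp [frac_empty]
  | insert a t ha ih =>
    have h1 : {ω | ∃ i ∈ insert a t, ω ∈ s i} ⊆ s a ∪ {ω | ∃ i ∈ t, ω ∈ s i} := by
      intro ω; simp
    have h2 := frac_le_add h1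
    have h3 := ih fun i hi => h i (Finset.mem_insert_of_mem hi)
    have h4 := h a (Finset.mem_insert_self _ _)
    rw [Finset.card_insert_of_notMem ha]
    push_cast
    linarith

section Latin

variable {J T : Type*} [Fintype J] [Fintype T] [DecidableEq T]

/-- The switching step: permutations can be changed along one cyclic shift so that a given bad
slot becomes good and no new bad slot appears. -/
lemma exists_switch [AddCommGroup T] {G : (T → J) → Prop} (σ : T → Equiv.Perm J) {x : T → J}
    (hx : Function.Injective x) (hG : ∀ i, G fun c => σ c (x (i + c))) :
    ∃ σ' : T → Equiv.Perm J, (∀ i, G fun c => σ' c (x i)) ∧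
      ∀ j, j ∉ Set.range x → ∀ c, σ' c j = σ c j := by
  classical
  let e : T ↪ J := ⟨x, hx⟩
  refine ⟨fun c => ((Equiv.addRight c).viaFintypeEmbedding e).trans (σ c), fun i => ?_,
    fun j hj c => ?_⟩
  · convert hG i using 2 with c
    simp only [Equiv.trans_apply]
    congr 1
    exact Equiv.Perm.viaFintypeEmbedding_apply_image (Equiv.addRight c) e i
  · simp only [Equiv.trans_apply]
    rw [Equiv.Perm.viaFintypeEmbedding_apply_notMem_range _ _ (by simpa [e] using hj)]

lemma exists_latin_of_group [Nonempty J] [AddCommGroup T] (G : (T → J) → Prop) {δ : ℝ}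
    (hδ : (Fintype.card T : ℝ) * δ + (Fintype.card T : ℝ) ^ 2 / (Nat.card J : ℝ) < 1)
    (h : ∀ t v, frac {x : T → J | x t = v ∧ ¬ G x} ≤ δ / (Nat.card J : ℝ)) :
    ∃ σ : T → Equiv.Perm J, ∀ j, G fun c => σ c j := by
  classical
  have hs : (0 : ℝ) < Nat.card J := by exact_mod_cast Nat.card_pos
  let bad : (T → Equiv.Perm J) → Finset J := fun σ => univ.filter fun j => ¬ G fun c => σ c j
  obtain ⟨σ, -, hmin⟩ := Finset.exists_min_image (univ : Finset (T → Equiv.Perm J))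
    (fun σ => (bad σ).card) ⟨fun _ => 1, mem_univ _⟩
  by_contra! hcon
  obtain ⟨j₀, hj₀⟩ := hcon σ
  have hbad : ∀ i : T, frac {x : T → J | x 0 = j₀ ∧ ¬ G fun c => σ c (x (i + c))} ≤
      δ / (Nat.card J : ℝ) := by
    intro i
    let φ : (T → J) ≃ (T → J) :=
      { toFun := fun x c => σ c (x (i + c))
        invFun := fun y c => (σ (c - i)).symm (y (c - i))
        left_inv := fun x => by funext c; simp
        right_inv := fun y => by
          funext c
          have : i + c - i = c := by abel
          simp only [this, Equiv.apply_symm_apply] }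
    have : {x : T → J | x 0 = j₀ ∧ ¬ G fun c => σ c (x (i + c))} =
        φ ⁻¹' {y | y (-i) = σ (-i) j₀ ∧ ¬ G y} := by
      ext x; simp [φ]
    rw [this, frac_preimage_equiv]
    exact h _ _
  have h1 := frac_biUnion_le univ _ fun i _ => hbad i
  have h2 := frac_eval_inter_not_injective_le (0 : T) j₀
  have h3 : frac {x : T → J | x 0 ∈ ({j₀} : Set J)} = 1 / (Nat.card J : ℝ) := by
    rw [frac_eval, frac_singleton]
  have h4 := frac_union_le {ω : T → J | ∃ i ∈ univ, ω ∈ {x : T → J | x 0 = j₀ ∧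
    ¬ G fun c => σ c (x (i + c))}} {x : T → J | x 0 = j₀ ∧ ¬ Function.Injective x}
  have h5 : (Fintype.card T : ℝ) * (δ / (Nat.card J : ℝ)) +
      (Fintype.card T : ℝ) ^ 2 / (Nat.card J : ℝ) ^ 2 < 1 / (Nat.card J : ℝ) := by
    rw [show (Fintype.card T : ℝ) * (δ / (Nat.card J : ℝ)) +
      (Fintype.card T : ℝ) ^ 2 / (Nat.card J : ℝ) ^ 2 = ((Fintype.card T : ℝ) * δ +
      (Fintype.card T : ℝ) ^ 2 / (Nat.card J : ℝ)) / (Nat.card J : ℝ) by field_simp]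
    gcongr
  rw [Finset.card_univ] at h1
  obtain ⟨x, hx0, hx⟩ := exists_mem_notMem_of_frac_lt
    (lt_of_le_of_lt (h4.trans (add_le_add h1 h2)) (h5.trans_eq h3.symm))
  simp only [Set.mem_singleton_iff, Set.mem_ofPred_eq] at hx0
  simp only [Set.mem_union, Set.mem_ofPred_eq, mem_univ, true_and, hx0, not_or, not_exists,
    not_not] at hx
  obtain ⟨σ', hσ1, hσ2⟩ := exists_switch σ hx.2 hx.1
  have hsub : bad σ' ⊂ bad σ := by
    rw [Finset.ssubset_iff_of_subset]
    · refine ⟨j₀, by simpa [bad] using hj₀, ?_⟩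
      simp only [bad, mem_filter, mem_univ, true_and, not_not]
      have := hσ1 0
      rwa [hx0] at this
    · intro j
      simp only [bad, mem_filter, mem_univ, true_and]
      intro hj hG
      by_cases hjx : j ∈ Set.range x
      · obtain ⟨i, rfl⟩ := hjx
        exact hj (hσ1 i)
      · apply hj
        simpa only [hσ2 j hjx] using hG
  exact absurd (hmin σ' (mem_univ _)) (not_le.mpr (Finset.card_lt_card hsub))

/-- If every value of every coordinate lies in few bad tuples, then `J` can be simultaneously
permuted in all coordinates so that all diagonal tuples are good. -/
lemma exists_latin [Nonempty J] [Nonempty T] (G : (T → J) → Prop) {δ : ℝ}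
    (hδ : (Fintype.card T : ℝ) * δ + (Fintype.card T : ℝ) ^ 2 / (Nat.card J : ℝ) < 1)
    (h : ∀ t v, frac {x : T → J | x t = v ∧ ¬ G x} ≤ δ / (Nat.card J : ℝ)) :
    ∃ σ : T → Equiv.Perm J, ∀ j, G fun c => σ c j := by
  have : NeZero (Fintype.card T) := ⟨Fintype.card_ne_zero⟩
  let _ : AddCommGroup T := (Fintype.equivFin T).addCommGroup
  exact exists_latin_of_group G hδ h

end Latin

lemma frac_fst_eq_le {J Ω : Type*} [Fintype J] [Finite Ω] {s : Set (J × Ω)} {v : J} {δ : ℝ}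
    (hδ : 0 ≤ δ) (h : frac {y | (v, y) ∈ s} ≤ δ) :
    frac {p : J × Ω | p.1 = v ∧ p ∈ s} ≤ δ / (Nat.card J : ℝ) := by
  have h1 := frac_le_of_fiber (s := {p : J × Ω | p.1 = v ∧ p ∈ s})
    (t := ({v} : Set J) ×ˢ (Set.univ : Set Unit)) (z := ∅) (C := δ) (D := 0) hδ le_rfl (by
      intro j _
      by_cases hj : j = v
      · subst hj
        have e : {y : Unit | (j, y) ∈ ({j} : Set J) ×ˢ (Set.univ : Set Unit)} = Set.univ := by
          ext; simp
        rw [e, frac_univ, mul_one, add_zero]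
        exact (frac_mono fun y hy => hy.2).trans h
      · have e : {y : Ω | (j, y) ∈ {p : J × Ω | p.1 = v ∧ p ∈ s}} = ∅ := by
          ext; simp [hj]
        rw [e, frac_empty, add_zero]
        exact mul_nonneg hδ (frac_nonneg _))
  rw [frac_prod, frac_univ, frac_singleton, frac_empty] at h1
  calc _ ≤ _ := h1
    _ = _ := by ring

/-- A perfect assignment of one element of `J` and a `κ`-tuple over `J` to every slot `j : J`. -/
lemma exists_assignment {J κ : Type*} [Fintype J] [Nonempty J] [Fintype κ]
    (G : J → J → (κ → J) → Prop) {δ : ℝ} (hδ0 : 0 ≤ δ)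
    (hδ : (Fintype.card κ + 2 : ℝ) * δ + (Fintype.card κ + 2 : ℝ) ^ 2 / (Nat.card J : ℝ) < 1)
    (h₁ : ∀ j, frac {p : J × (κ → J) | ¬ G j p.1 p.2} ≤ δ)
    (h₂ : ∀ a, frac {p : J × (κ → J) | ¬ G p.1 a p.2} ≤ δ)
    (h₃ : ∀ c v, frac {p : J × J × (κ → J) | p.2.2 c = v ∧ ¬ G p.1 p.2.1 p.2.2} ≤
      δ / (Nat.card J : ℝ)) :
    ∃ (ρ : Equiv.Perm J) (σ : κ → Equiv.Perm J), ∀ j, G j (ρ j) fun c => σ c j := by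
  classical
  let e : (Option (Option κ) → J) ≃ J × J × (κ → J) :=
    (Equiv.piOptionEquivProd (β := fun _ : Option (Option κ) => J)).trans
      (Equiv.prodCongr (Equiv.refl _) (Equiv.piOptionEquivProd (β := fun _ : Option κ => J)))
  have hcard : (Fintype.card (Option (Option κ)) : ℝ) = Fintype.card κ + 2 := by
    rw [Fintype.card_option, Fintype.card_option]; push_cast; ring
  obtain ⟨σ, hσ⟩ := exists_latin (T := Option (Option κ))
    (fun x => G (x none) (x (some none)) fun c => x (some (some c))) (δ := δ)
    (by rw [hcard]; exact hδ) (by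
      intro t v
      have hpre : ∀ P : J × J × (κ → J) → Prop,
          frac {x : Option (Option κ) → J | P (e x)} = frac {p | P p} := fun P =>
        frac_preimage_equiv e {p | P p}
      match t with
      | none =>
        have := hpre fun p => p.1 = v ∧ ¬ G p.1 p.2.1 p.2.2
        refine (le_of_eq this).trans ?_
        exact frac_fst_eq_le (s := {p : J × J × (κ → J) | ¬ G p.1 p.2.1 p.2.2}) hδ0 (h₁ v)
      | some none =>
        have := hpre fun p => p.2.1 = v ∧ ¬ G p.1 p.2.1 p.2.2
        refine (le_of_eq this).trans ?_
        let f : J × J × (κ → J) ≃ J × J × (κ → J) :=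
          { toFun := fun p => (p.2.1, p.1, p.2.2)
            invFun := fun p => (p.2.1, p.1, p.2.2)
            left_inv := fun _ => rfl
            right_inv := fun _ => rfl }
        have h5 := frac_preimage_equiv f {p | p.1 = v ∧ ¬ G p.2.1 p.1 p.2.2}
        refine (le_of_eq h5).trans ?_
        exact frac_fst_eq_le (s := {p : J × J × (κ → J) | ¬ G p.2.1 p.1 p.2.2}) hδ0 (h₂ v)
      | some (some c) =>
        have := hpre fun p => p.2.2 c = v ∧ ¬ G p.1 p.2.1 p.2.2
        exact (le_of_eq this).trans (h₃ c v))
  refine ⟨(σ none).symm.trans (σ (some none)),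
    fun c => (σ none).symm.trans (σ (some (some c))), fun j => ?_⟩
  have := hσ ((σ none).symm j)
  simpa using this

section Potential

variable {Ω W : Type*} [Fintype Ω] [Fintype W]

lemma exists_low_increment {Z : Set Ω} {bad : W → Set Ω} {p η : ℝ} (hp : 0 < p)
    (hZ : p ≤ frac Z) (hbad : ∀ w, frac (bad w) ≤ η) (hη : 0 ≤ η)
    (φ : W → ℝ) (hφ : ∀ w, 0 ≤ φ w) :
    ∃ c ∈ Z, ∑ w, (bad w).indicator (fun _ => φ w) c ≤ η / p * ∑ w, φ w := by
  classical
  by_contra! hcon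
  have hne : Z.toFinset.Nonempty := by
    rw [Set.toFinset_nonempty]
    by_contra h
    rw [Set.not_nonempty_iff_eq_empty] at h
    rw [h, frac_empty] at hZ
    linarith
  obtain ⟨c₀, hc₀⟩ := hne
  have : Nonempty Ω := ⟨c₀⟩
  have hN : (0 : ℝ) < Nat.card Ω := by exact_mod_cast Nat.card_pos
  have hΦ : 0 ≤ ∑ w, φ w := Finset.sum_nonneg fun w _ => hφ w
  have h1 : ∑ _c ∈ Z.toFinset, η / p * ∑ w, φ w <
      ∑ c ∈ Z.toFinset, ∑ w, (bad w).indicator (fun _ => φ w) c :=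
    Finset.sum_lt_sum_of_nonempty ⟨c₀, hc₀⟩ fun c hc => hcon c (Set.mem_toFinset.mp hc)
  have h2 : ∑ c ∈ Z.toFinset, ∑ w, (bad w).indicator (fun _ => φ w) c ≤
      ∑ c, ∑ w, (bad w).indicator (fun _ => φ w) c := by
    refine Finset.sum_le_univ_sum_of_nonneg fun c => Finset.sum_nonneg fun w _ => ?_
    exact Set.indicator_nonneg (fun _ _ => hφ w) _
  have h3 : ∑ c, ∑ w, (bad w).indicator (fun _ => φ w) c ≤ η * Nat.card Ω * ∑ w, φ w := by
    rw [Finset.sum_comm, Finset.mul_sum]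
    refine Finset.sum_le_sum fun w _ => ?_
    have : ∑ c, (bad w).indicator (fun _ => φ w) c = frac (bad w) * Nat.card Ω * φ w := by
      rw [frac_eq_sum_indicator, div_mul_cancel₀ _ hN.ne', Finset.sum_mul]
      refine Finset.sum_congr rfl fun c _ => ?_
      by_cases hc : c ∈ bad w <;> simp [hc]
    rw [this]
    gcongr
    · exact hφ w
    · exact hbad w
  rw [Finset.sum_const, nsmul_eq_mul] at h1
  have h4 : p * Nat.card Ω ≤ Z.toFinset.card := by
    rw [← Set.ncard_eq_toFinset_card']
    have := hZ
    unfold frac at this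
    rwa [le_div_iff₀ hN] at this
  have h5 : η * Nat.card Ω * ∑ w, φ w ≤ Z.toFinset.card * (η / p * ∑ w, φ w) := by
    calc η * Nat.card Ω * ∑ w, φ w = p * Nat.card Ω * (η / p * ∑ w, φ w) := by field_simp
      _ ≤ _ := by gcongr
  linarith

/-- Sequential choice of `s` objects keeping every test `w` rarely bad. -/
lemma exists_balanced_sequence {bad : W → Set Ω} {p η : ℝ} (hp : 0 < p) (hη : 0 ≤ η)
    (hbad : ∀ w, frac (bad w) ≤ η) (ok : ∀ i : ℕ, (Fin i → Ω) → Prop) {s : ℕ}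
    (h₀ : ∀ c, ok 0 c)
    (hstep : ∀ i < s, ∀ c : Fin i → Ω, ok i c →
      p ≤ frac {x : Ω | ok (i + 1) (Fin.cons (α := fun _ => Ω) x c)}) :
    ∃ c : Fin s → Ω, ok s c ∧ ∀ w, (2 : ℝ) ^ {j | c j ∈ bad w}.ncard ≤
      Nat.card W * (1 + η / p) ^ s := by
  classical
  have key : ∀ i ≤ s, ∃ c : Fin i → Ω, ok i c ∧ ∑ w, (2 : ℝ) ^ {j | c j ∈ bad w}.ncard ≤
      Nat.card W * (1 + η / p) ^ i := by
    intro i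
    induction i with
    | zero =>
      intro _
      refine ⟨Fin.elim0, h₀ _, ?_⟩
      simp [Set.eq_empty_of_isEmpty]
    | succ i ih =>
      intro hi
      obtain ⟨c, hc, hsum⟩ := ih (by omega)
      obtain ⟨x, hx, hinc⟩ := exists_low_increment hp (hstep i (by omega) c hc) hbad hη
        (fun w => (2 : ℝ) ^ {j | c j ∈ bad w}.ncard) (fun w => by positivity)
      refine ⟨Fin.cons x c, hx, ?_⟩
      have h1 : ∀ w, (2 : ℝ) ^ {j | (Fin.cons x c : Fin (i + 1) → Ω) j ∈ bad w}.ncard =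
          (2 : ℝ) ^ {j | c j ∈ bad w}.ncard +
            (bad w).indicator (fun _ => (2 : ℝ) ^ {j | c j ∈ bad w}.ncard) x := by
        intro w
        have h2 : {j | (Fin.cons x c : Fin (i + 1) → Ω) j ∈ bad w}.ncard =
            (if x ∈ bad w then 1 else 0) + {j | c j ∈ bad w}.ncard := by
          rw [Set.ncard_eq_toFinset_card', Set.ncard_eq_toFinset_card']
          simp only [Set.toFinset_ofPred]
          rw [Fin.card_filter_univ_succ]
          simp only [Fin.cons_zero, Fin.cons_succ]
          split_ifs <;> omega
        rw [h2]
        by_cases hxw : x ∈ bad w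
        · simp only [hxw, if_true, Set.indicator_of_mem, pow_add, pow_one]; ring
        · simp [hxw]
      simp only [h1, Finset.sum_add_distrib]
      calc _ ≤ (1 + η / p) * ∑ w, (2 : ℝ) ^ {j | c j ∈ bad w}.ncard := by linarith
        _ ≤ (1 + η / p) * (Nat.card W * (1 + η / p) ^ i) := by gcongr
        _ = _ := by ring
  obtain ⟨c, hc, hsum⟩ := key s le_rfl
  refine ⟨c, hc, fun w => le_trans ?_ hsum⟩
  exact Finset.single_le_sum (f := fun w => (2 : ℝ) ^ {j | c j ∈ bad w}.ncard)
    (fun w _ => by positivity) (Finset.mem_univ w)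

lemma ncard_le_of_two_pow_le {b N s : ℕ} {θ : ℝ} (hθ : 0 ≤ θ) (hN : 0 < N)
    (h : (2 : ℝ) ^ b ≤ N * (1 + θ) ^ s) (hlog : Real.log N ≤ θ * s) : (b : ℝ) ≤ 4 * θ * s := by
  have h1 := Real.log_le_log (by positivity) h
  rw [Real.log_pow, Real.log_mul (by positivity) (by positivity), Real.log_pow] at h1
  have h2 : Real.log (1 + θ) ≤ θ := by
    have := Real.log_le_sub_one_of_pos (show 0 < 1 + θ by linarith)
    linarith
  have h3 := Real.log_two_gt_d9
  have h4 : (s : ℝ) * Real.log (1 + θ) ≤ s * θ := by gcongr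
  have h5 : (b : ℝ) * (1 / 2) ≤ b * Real.log 2 := by gcongr; linarith
  linarith

end Potential

section Im2

variable {V ι κ : Type*} [DecidableEq V] [Fintype ι] [Fintype κ]

lemma im_comp_equiv (e : ι ≃ κ) (y : κ → V) : im (y ∘ e) = im y := by
  ext v
  simp only [mem_im, Function.comp_apply]
  exact ⟨fun ⟨i, h⟩ => ⟨e i, h⟩, fun ⟨i, h⟩ => ⟨e.symm i, by simpa using h⟩⟩

lemma im_sum (y : ι ⊕ κ → V) : im y = im (y ∘ Sum.inl) ∪ im (y ∘ Sum.inr) := by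
  ext v; simp [mem_im, Sum.exists]

lemma im_cons {s : ℕ} (a : V) (y : Fin s → V) :
    im (Fin.cons (α := fun _ => V) a y) = insert a (im y) := by
  ext v
  simp only [mem_im, mem_insert, Fin.exists_fin_succ, Fin.cons_zero, Fin.cons_succ, eq_comm]

end Im2

section Densities

variable {V : Type*} [Fintype V] [DecidableEq V] (E : Finset (Finset V)) (A : Finset V)

/-- Proportion of pairs `(a, y)`, with `a ∈ A` and `y` a tuple outside `A`, which do not complete
`T` to an edge. -/
noncomputable def neA (T : Finset V) (ι : Type*) [Fintype ι] : ℝ :=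
  frac {q : V × (ι → V) | q.1 ∈ A ∧ (∀ i, q.2 i ∉ A) ∧ insert q.1 (T ∪ im q.2) ∉ E}

/-- Proportion of pairs `(a, y)`, with `a ∈ A` and `y` a tuple outside `A`, which complete
`T` to an edge. -/
noncomputable def edA (T : Finset V) (ι : Type*) [Fintype ι] : ℝ :=
  frac {q : V × (ι → V) | q.1 ∈ A ∧ (∀ i, q.2 i ∉ A) ∧ insert q.1 (T ∪ im q.2) ∈ E}

/-- Proportion of tuples outside `A` which do not complete `T` to an edge. -/
noncomputable def neB (T : Finset V) (ι : Type*) [Fintype ι] : ℝ :=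
  frac {y : ι → V | (∀ i, y i ∉ A) ∧ T ∪ im y ∉ E}

/-- Proportion of tuples outside `A` which complete `T` to an edge. -/
noncomputable def edB (T : Finset V) (ι : Type*) [Fintype ι] : ℝ :=
  frac {y : ι → V | (∀ i, y i ∉ A) ∧ T ∪ im y ∈ E}

variable {E A} {ι κ : Type*} [Fintype ι] [Fintype κ]

lemma frac_pair_congr (e : ι ≃ κ) (P : V → (Prop) → Finset V → Prop) :
    frac {q : V × (ι → V) | P q.1 (∀ i, q.2 i ∉ A) (im q.2)} =
      frac {q : V × (κ → V) | P q.1 (∀ i, q.2 i ∉ A) (im q.2)} := by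
  rw [← frac_preimage_equiv ((Equiv.refl V).prodCongr (e.arrowCongr (Equiv.refl V)))]
  congr 1
  ext ⟨a, y⟩
  have h1 : im (y ∘ e.symm) = im y := im_comp_equiv e.symm y
  have h2 : (∀ i, y (e.symm i) ∉ A) ↔ ∀ i, y i ∉ A :=
    ⟨fun h i => by simpa using h (e i), fun h i => h _⟩
  have h3 : (e.arrowCongr (Equiv.refl V)) y = y ∘ e.symm := rfl
  simp [h3, h1, h2]

lemma neA_congr (e : ι ≃ κ) (T : Finset V) : neA E A T ι = neA E A T κ :=
  frac_pair_congr e fun a Q I => a ∈ A ∧ Q ∧ insert a (T ∪ I) ∉ E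

lemma frac_tuple_congr (e : ι ≃ κ) (P : (Prop) → Finset V → Prop) :
    frac {y : ι → V | P (∀ i, y i ∉ A) (im y)} = frac {y : κ → V | P (∀ i, y i ∉ A) (im y)} := by
  rw [← frac_preimage_equiv (e.arrowCongr (Equiv.refl V))]
  congr 1
  ext y
  have h1 : im (y ∘ e.symm) = im y := im_comp_equiv e.symm y
  have h2 : (∀ i, y (e.symm i) ∉ A) ↔ ∀ i, y i ∉ A :=
    ⟨fun h i => by simpa using h (e i), fun h i => h _⟩
  have h3 : (e.arrowCongr (Equiv.refl V)) y = y ∘ e.symm := rfl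
  simp [h3, h1, h2]

lemma neB_congr (e : ι ≃ κ) (T : Finset V) : neB E A T ι = neB E A T κ :=
  frac_tuple_congr e fun Q I => Q ∧ T ∪ I ∉ E

lemma edB_congr (e : ι ≃ κ) (T : Finset V) : edB E A T ι = edB E A T κ :=
  frac_tuple_congr e fun Q I => Q ∧ T ∪ I ∈ E

lemma frac_pair_comp {Ω : Type*} [Finite Ω] [Nonempty V] {e : κ → ι} (he : Function.Injective e)
    (s : Set (Ω × (κ → V))) : frac {q : Ω × (ι → V) | (q.1, q.2 ∘ e) ∈ s} = frac s := by
  have := Fintype.ofFinite Ω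
  rw [frac_eq_avg, frac_eq_avg s]
  congr 1
  refine Finset.sum_congr rfl fun ω _ => ?_
  exact frac_comp he {y | (ω, y) ∈ s}

/-- Selection of a tuple avoiding a small set `F`. -/
lemma exists_tuple [Nonempty V] {G : Set (ι → V)} {F : Finset V} {g : ℝ} (hg : g ≤ frac G)
    (h : Fintype.card ι * frac (F : Set V) + (Fintype.card ι : ℝ) ^ 2 / (Nat.card V : ℝ) < g) :
    ∃ y ∈ G, (∀ i, y i ∉ F) ∧ Function.Injective y := by
  have h1 := frac_hit_le (ι := ι) (F : Set V)
  have h2 := frac_not_injective_le (V := V) (ι := ι)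
  have h3 := frac_union_le {y : ι → V | ∃ i, y i ∈ (F : Set V)}
    {y : ι → V | ¬ Function.Injective y}
  obtain ⟨y, hy, hy2⟩ := exists_mem_notMem_of_frac_lt
    (lt_of_le_of_lt (h3.trans (add_le_add h1 h2)) (h.trans_le hg))
  simp only [Set.mem_union, Set.mem_ofPred_eq, not_or, not_exists, not_not,
    Finset.mem_coe] at hy2
  exact ⟨y, hy, hy2⟩

lemma frac_fst {Ω Ω' : Type*} [Finite Ω] [Finite Ω'] [Nonempty Ω'] (s : Set Ω) :
    frac {q : Ω × Ω' | q.1 ∈ s} = frac s := by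
  have : {q : Ω × Ω' | q.1 ∈ s} = s ×ˢ (Set.univ : Set Ω') := by ext; simp
  rw [this, frac_prod, frac_univ, mul_one]

lemma frac_snd {Ω Ω' : Type*} [Finite Ω] [Finite Ω'] [Nonempty Ω] (s : Set Ω') :
    frac {q : Ω × Ω' | q.2 ∈ s} = frac s := by
  have : {q : Ω × Ω' | q.2 ∈ s} = (Set.univ : Set Ω) ×ˢ s := by ext; simp
  rw [this, frac_prod, frac_univ, one_mul]

/-- Selection of a vertex and a tuple avoiding a small set `F`. -/
lemma exists_pair [Nonempty V] {G : Set (V × (ι → V))} {F : Finset V} {g : ℝ} (hg : g ≤ frac G)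
    (h : (Fintype.card ι + 1) * frac (F : Set V) +
      (Fintype.card ι : ℝ) ^ 2 / (Nat.card V : ℝ) < g) :
    ∃ a y, (a, y) ∈ G ∧ a ∉ F ∧ (∀ i, y i ∉ F) ∧ Function.Injective y := by
  have h1 := frac_hit_le (ι := ι) (F : Set V)
  have h2 := frac_not_injective_le (V := V) (ι := ι)
  have h3 := frac_union_le {y : ι → V | ∃ i, y i ∈ (F : Set V)}
    {y : ι → V | ¬ Function.Injective y}
  have h4 : frac {q : V × (ι → V) | q.1 ∈ (F : Set V)} = frac (F : Set V) := frac_fst _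
  have h5 : frac {q : V × (ι → V) | q.2 ∈ {y : ι → V | ∃ i, y i ∈ (F : Set V)} ∪
    {y : ι → V | ¬ Function.Injective y}} = _ := frac_snd _
  have h6 := frac_union_le {q : V × (ι → V) | q.1 ∈ (F : Set V)}
    {q : V × (ι → V) | q.2 ∈ {y : ι → V | ∃ i, y i ∈ (F : Set V)} ∪
    {y : ι → V | ¬ Function.Injective y}}
  obtain ⟨⟨a, y⟩, hy, hy2⟩ := exists_mem_notMem_of_frac_lt
    (show frac ({q : V × (ι → V) | q.1 ∈ (F : Set V)} ∪
      {q : V × (ι → V) | q.2 ∈ {y : ι → V | ∃ i, y i ∈ (F : Set V)} ∪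
      {y : ι → V | ¬ Function.Injective y}}) < frac G by linarith)
  simp only [Set.mem_union, Set.mem_ofPred_eq, not_or, not_exists, not_not,
    Finset.mem_coe] at hy2
  exact ⟨a, y, hy, hy2.1, hy2.2⟩

lemma frac_outside_pow [Nonempty V] :
    frac {y : ι → V | ∀ i, y i ∉ A} = frac ((A : Set V)ᶜ) ^ Fintype.card ι := by
  rw [← frac_forall]; rfl

lemma frac_pair_outside [Nonempty V] :
    frac {q : V × (ι → V) | q.1 ∈ A ∧ ∀ i, q.2 i ∉ A} =
      frac (A : Set V) * frac ((A : Set V)ᶜ) ^ Fintype.card ι := by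
  rw [← frac_outside_pow, ← frac_prod]; rfl

end Densities

section Setup

variable {V : Type*} [Fintype V] [DecidableEq V]

/-- Typical tuples: almost all completions of the tuple by one vertex of `A` are edges. -/
def Typ {l : ℕ} (r : ℕ) (E : Finset (Finset V)) (A : Finset V) (τ : ℝ) (L : Fin (l + 1) → V) :
    Prop :=
  neA E A (im L) (Fin (r + 1) ⊕ Fin l) ≤ τ

/-- Rich pairs: many completions outside `A` are edges. -/
def Rich {l : ℕ} (r : ℕ) (E : Finset (Finset V)) (A : Finset V) (γ : ℝ) (v : V)
    (R : Fin l → V) : Prop :=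
  γ ≤ edB E A (insert v (im R)) (Fin (r + 1) ⊕ Fin (l + 1))

/-- The weight of a set of forbidden vertices, including the cost of non-injective tuples. -/
noncomputable def weight (V : Type*) [Fintype V] (l r : ℕ) (F : Finset V) : ℝ :=
  (2 * (2 * l + r + 3 : ℕ) + 1 : ℝ) * frac (F : Set V) +
    (2 * (2 * l + r + 3 : ℕ) + 1 : ℝ) ^ 2 / (Nat.card V : ℝ)

/-- The structural facts about an almost extremal hypergraph used to build the cycle. -/
structure Ctx (l r : ℕ) (E : Finset (Finset V)) (A Bad A₂ : Finset V) (p γ τ ε : ℝ) : Prop where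
  p_pos : 0 < p
  γ_pos : 0 < γ
  γ_le : γ ≤ p / 8
  τ_pos : 0 < τ
  τ_le : τ ≤ p / 8
  ε_pos : 0 < ε
  ε_le : ε ≤ p / 8
  uniform : ∀ e ∈ E, e.card = 2 * l + r + 3
  le_prod : ∀ j ≤ 2 * (2 * l + r + 3),
    p ≤ frac (A : Set V) * frac ((A : Set V)ᶜ) ^ j
  not_typ_le : frac {x : Fin (l + 1) → V | (∀ i, x i ∉ A) ∧ ¬ Typ r E A τ x} ≤ γ / 8
  not_rich_le : ∀ a ∈ A, a ∉ Bad →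
    frac {R : Fin l → V | (∀ i, R i ∉ A) ∧ ¬ Rich r E A γ a R} ≤ p / 8
  le_rich : ∀ v ∈ A₂, γ ≤ frac {R : Fin l → V | (∀ i, R i ∉ A) ∧ Rich r E A γ v R}
  neA_le : ∀ v ∉ A₂, ∀ (ι : Type) [Fintype ι], Fintype.card ι = 2 * l + r + 1 →
    neA E A {v} ι ≤ ε
  neB_le : ∀ a ∈ A, a ∉ Bad → ∀ (ι : Type) [Fintype ι], Fintype.card ι = 2 * l + r + 2 →
    neB E A {a} ι ≤ ε
  neA_empty_le : ∀ (ι : Type) [Fintype ι], Fintype.card ι = 2 * l + r + 2 → neA E A ∅ ι ≤ ε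
  ext : ∀ L : Finset V, L.card = l + 1 → p ≤ edA E A L (Fin (r + 1) ⊕ Fin l) ∨
    p ≤ edB E A L (Fin (r + 1) ⊕ Fin (l + 1))
  mem_A₂ : ∀ a ∈ A, a ∉ Bad → a ∈ A₂
  notMem_A₂ : ∀ v ∉ A, v ∉ Bad → v ∉ A₂

variable {l r : ℕ} {E : Finset (Finset V)} {A Bad A₂ : Finset V} {p γ τ ε : ℝ}

lemma weight_union_le [Nonempty V] {F X : Finset V} (hX : X.card ≤ 2 * (2 * l + r + 3) + 1) :
    weight V l r (F ∪ X) ≤ 2 * weight V l r F := by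
  unfold weight
  have h1 := frac_union_le (F : Set V) (X : Set V)
  have h2 : frac (X : Set V) ≤ (2 * (2 * l + r + 3 : ℕ) + 1 : ℝ) / Nat.card V := by
    unfold frac
    rw [Set.ncard_coe_finset]
    gcongr
    exact_mod_cast hX
  rw [Finset.coe_union]
  have h3 := frac_nonneg (F : Set V)
  have h4 : (2 * (2 * l + r + 3 : ℕ) + 1 : ℝ) * frac (X : Set V) ≤
      (2 * (2 * l + r + 3 : ℕ) + 1 : ℝ) ^ 2 / Nat.card V := by
    calc _ ≤ (2 * (2 * l + r + 3 : ℕ) + 1 : ℝ) *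
        ((2 * (2 * l + r + 3 : ℕ) + 1 : ℝ) / Nat.card V) := by gcongr
      _ = _ := by ring
  have h5 : (2 * (2 * l + r + 3 : ℕ) + 1 : ℝ) * frac ((F : Set V) ∪ X) ≤
      (2 * (2 * l + r + 3 : ℕ) + 1 : ℝ) * frac (F : Set V) +
      (2 * (2 * l + r + 3 : ℕ) + 1 : ℝ) * frac (X : Set V) := by
    rw [← mul_add]; gcongr
  have h6 : 0 ≤ (2 * (2 * l + r + 3 : ℕ) + 1 : ℝ) * frac (F : Set V) := by positivity
  linarith

lemma exists_tuple_of_weight [Nonempty V] {ι : Type*} [Fintype ι] {G : Set (ι → V)}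
    {F : Finset V} {g : ℝ}
    (hι : Fintype.card ι ≤ 2 * (2 * l + r + 3)) (hg : g ≤ frac G) (h : weight V l r F < g) :
    ∃ y ∈ G, (∀ i, y i ∉ F) ∧ Function.Injective y := by
  refine exists_tuple hg (lt_of_le_of_lt ?_ h)
  unfold weight
  have hι' : (Fintype.card ι : ℝ) ≤ 2 * (2 * l + r + 3 : ℕ) := by exact_mod_cast hι
  have := frac_nonneg (F : Set V)
  gcongr <;> linarith

lemma exists_pair_of_weight [Nonempty V] {ι : Type*} [Fintype ι] {G : Set (V × (ι → V))}
    {F : Finset V} {g : ℝ}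
    (hι : Fintype.card ι ≤ 2 * (2 * l + r + 3)) (hg : g ≤ frac G) (h : weight V l r F < g) :
    ∃ a y, (a, y) ∈ G ∧ a ∉ F ∧ (∀ i, y i ∉ F) ∧ Function.Injective y := by
  refine exists_pair hg (lt_of_le_of_lt ?_ h)
  unfold weight
  have hι' : (Fintype.card ι : ℝ) ≤ 2 * (2 * l + r + 3 : ℕ) := by exact_mod_cast hι
  have := frac_nonneg (F : Set V)
  gcongr
  linarith

namespace Ctx

variable (h : Ctx l r E A Bad A₂ p γ τ ε)
include h

lemma nonempty : Nonempty V := by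
  by_contra hV
  rw [not_nonempty_iff] at hV
  have h1 := h.le_prod 0 (by omega)
  have : frac (A : Set V) = 0 := by simp [frac]
  rw [this, zero_mul] at h1
  exact absurd h.p_pos (not_lt.mpr h1)

lemma le_frac_pair {ι : Type*} [Fintype ι] (hι : Fintype.card ι ≤ 2 * (2 * l + r + 3)) :
    p ≤ frac {q : V × (ι → V) | q.1 ∈ A ∧ ∀ i, q.2 i ∉ A} := by
  have := h.nonempty
  rw [frac_pair_outside]
  exact h.le_prod _ hι

/-- A rich pair can be completed by a typical tuple. -/
lemma exists_completion {v : V} {R : Fin l → V} (hR : Rich r E A γ v R) {F : Finset V}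
    (hF : weight V l r F ≤ γ / 4) :
    ∃ (M : Fin (r + 1) → V) (L : Fin (l + 1) → V), insert v (im R) ∪ (im M ∪ im L) ∈ E ∧
      Typ r E A τ L ∧ (List.ofFn M ++ List.ofFn L).Nodup ∧
      ∀ x ∈ List.ofFn M ++ List.ofFn L, x ∉ F ∧ x ∉ A := by
  have := h.nonempty
  have h1 : frac {y : Fin (r + 1) ⊕ Fin (l + 1) → V | y ∘ Sum.inr ∈
      {x : Fin (l + 1) → V | (∀ i, x i ∉ A) ∧ ¬ Typ r E A τ x}} ≤ γ / 8 := by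
    rw [frac_comp Sum.inr_injective]; exact h.not_typ_le
  have h2 : {y : Fin (r + 1) ⊕ Fin (l + 1) → V | (∀ i, y i ∉ A) ∧ insert v (im R) ∪ im y ∈ E} ⊆
      {y | ((∀ i, y i ∉ A) ∧ insert v (im R) ∪ im y ∈ E) ∧ Typ r E A τ (y ∘ Sum.inr)} ∪
      {y : Fin (r + 1) ⊕ Fin (l + 1) → V | y ∘ Sum.inr ∈
        {x : Fin (l + 1) → V | (∀ i, x i ∉ A) ∧ ¬ Typ r E A τ x}} := by
    intro y hy
    by_cases hT : Typ r E A τ (y ∘ Sum.inr)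
    · exact Or.inl ⟨hy, hT⟩
    · exact Or.inr ⟨fun i => hy.1 _, hT⟩
  have h3 := frac_le_add h2
  have h4 : γ ≤ _ := hR
  unfold edB at h4
  have h5 := h.γ_pos
  obtain ⟨y, ⟨⟨hyA, hyE⟩, hyT⟩, hyF, hinj⟩ := exists_tuple_of_weight (l := l) (r := r)
    (F := F) (by simp; omega) (sub_le_iff_le_add.mpr (h4.trans h3)) (by linarith)
  refine ⟨y ∘ Sum.inl, y ∘ Sum.inr, by rwa [im_sum] at hyE, hyT, ?_, ?_⟩
  · rw [List.nodup_append, List.nodup_ofFn, List.nodup_ofFn]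
    refine ⟨hinj.comp Sum.inl_injective, hinj.comp Sum.inr_injective, ?_⟩
    simp only [List.mem_ofFn]
    rintro a ⟨i, rfl⟩ b ⟨j, rfl⟩ hab
    exact absurd (hinj hab) (by simp)
  · intro x hx
    simp only [List.mem_append, List.mem_ofFn] at hx
    rcases hx with ⟨i, rfl⟩ | ⟨i, rfl⟩
    · exact ⟨hyF _, hyA _⟩
    · exact ⟨hyF _, hyA _⟩

lemma exists_join {L L' : Fin (l + 1) → V} (hL : Typ r E A τ L) (hL' : Typ r E A τ L')
    {F : Finset V} (hF : weight V l r F ≤ γ / 8) :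
    ∃ (M₀ : Fin (r + 1) → V) (a : V) (R : Fin l → V) (M₁ : Fin (r + 1) → V),
      im L ∪ im M₀ ∪ insert a (im R) ∈ E ∧ insert a (im R) ∪ im M₁ ∪ im L' ∈ E ∧
      (List.ofFn M₀ ++ (a :: List.ofFn R) ++ List.ofFn M₁).Nodup ∧ a ∈ A ∧ a ∉ F ∧
      ∀ x ∈ List.ofFn M₀ ++ List.ofFn R ++ List.ofFn M₁, x ∉ F ∧ x ∉ A := by
  have := h.nonempty
  let ι := Fin (r + 1) ⊕ Fin l ⊕ Fin (r + 1)
  let e₀ : Fin (r + 1) ⊕ Fin l → ι := Sum.map id Sum.inl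
  have he₀ : Function.Injective e₀ := Sum.map_injective.mpr ⟨fun _ _ h => h, Sum.inl_injective⟩
  let e₁ : Fin (r + 1) ⊕ Fin l → ι := fun c => Sum.inr c.swap
  have he₁ : Function.Injective e₁ := fun a b hab => by
    have : a.swap = b.swap := Sum.inr_injective hab
    simpa using congrArg Sum.swap this
  let N : (Fin (l + 1) → V) → Set (V × (Fin (r + 1) ⊕ Fin l → V)) := fun L =>
    {q | q.1 ∈ A ∧ (∀ i, q.2 i ∉ A) ∧ insert q.1 (im L ∪ im q.2) ∉ E}
  have h1 : frac {q : V × (ι → V) | (q.1, q.2 ∘ e₀) ∈ N L} ≤ τ := by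
    rw [frac_pair_comp he₀]; exact hL
  have h2 : frac {q : V × (ι → V) | (q.1, q.2 ∘ e₁) ∈ N L'} ≤ τ := by
    rw [frac_pair_comp he₁]; exact hL'
  have h3 : {q : V × (ι → V) | q.1 ∈ A ∧ ∀ i, q.2 i ∉ A} ⊆
      {q : V × (ι → V) | (q.1 ∈ A ∧ ∀ i, q.2 i ∉ A) ∧
        insert q.1 (im L ∪ im (q.2 ∘ e₀)) ∈ E ∧ insert q.1 (im L' ∪ im (q.2 ∘ e₁)) ∈ E} ∪
      ({q : V × (ι → V) | (q.1, q.2 ∘ e₀) ∈ N L} ∪ {q : V × (ι → V) | (q.1, q.2 ∘ e₁) ∈ N L'}) := by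
    intro q hq
    by_cases hE₀ : insert q.1 (im L ∪ im (q.2 ∘ e₀)) ∈ E
    · by_cases hE₁ : insert q.1 (im L' ∪ im (q.2 ∘ e₁)) ∈ E
      · exact Or.inl ⟨hq, hE₀, hE₁⟩
      · exact Or.inr (Or.inr ⟨hq.1, fun i => hq.2 _, hE₁⟩)
    · exact Or.inr (Or.inl ⟨hq.1, fun i => hq.2 _, hE₀⟩)
  have h4 := frac_le_add h3
  have h5 := frac_union_le {q : V × (ι → V) | (q.1, q.2 ∘ e₀) ∈ N L}
    {q : V × (ι → V) | (q.1, q.2 ∘ e₁) ∈ N L'}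
  have h6 := h.le_frac_pair (ι := ι) (by simp [ι]; omega)
  have h7 := h.τ_le
  have h8 := h.p_pos
  have h9 := h.γ_le
  obtain ⟨a, y, ⟨⟨haA, hyA⟩, hE₀, hE₁⟩, haF, hyF, hinj⟩ := exists_pair_of_weight (l := l) (r := r)
    (F := F) (by simp [ι]; omega) (sub_le_iff_le_add.mpr (h6.trans h4)) (by linarith)
  have i₀ : im (y ∘ e₀) = im (y ∘ Sum.inl) ∪ im (y ∘ Sum.inr ∘ Sum.inl) := by
    rw [im_sum]; rfl
  have i₁ : im (y ∘ e₁) = im (y ∘ Sum.inr ∘ Sum.inr) ∪ im (y ∘ Sum.inr ∘ Sum.inl) := by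
    rw [im_sum]; rfl
  rw [i₀] at hE₀
  rw [i₁] at hE₁
  refine ⟨y ∘ Sum.inl, a, y ∘ Sum.inr ∘ Sum.inl, y ∘ Sum.inr ∘ Sum.inr, ?_, ?_, ?_, haA, haF, ?_⟩
  · convert hE₀ using 1
    rw [union_insert, union_assoc]
  · convert hE₁ using 1
    rw [insert_union, insert_union]
    congr 1
    ext; simp; tauto
  · have ha : ∀ i, y i ≠ a := fun i hi => hyA i (hi ▸ haA)
    simp only [List.nodup_append, List.nodup_cons, List.nodup_ofFn, List.mem_append,
      List.mem_cons, List.mem_ofFn, Function.comp_apply]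
    refine ⟨⟨hinj.comp Sum.inl_injective, ⟨?_, hinj.comp (Sum.inr_injective.comp
      Sum.inl_injective)⟩, ?_⟩, hinj.comp (Sum.inr_injective.comp Sum.inr_injective), ?_⟩
    · rintro ⟨i, hi⟩; exact ha _ hi
    · rintro _ ⟨i, rfl⟩ _ (rfl | ⟨j, rfl⟩) hab
      · exact ha _ hab
      · exact nomatch hinj (a₁ := Sum.inl i) (a₂ := Sum.inr (Sum.inl j)) hab
    · rintro _ (⟨i, rfl⟩ | rfl | ⟨i, rfl⟩) _ ⟨j, rfl⟩ hab
      · exact nomatch hinj (a₁ := Sum.inl i) (a₂ := Sum.inr (Sum.inr j)) hab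
      · exact ha _ hab.symm
      · exact nomatch Sum.inr_injective
          (hinj (a₁ := Sum.inr (Sum.inl i)) (a₂ := Sum.inr (Sum.inr j)) hab)
  · intro x hx
    simp only [List.mem_append, List.mem_ofFn] at hx
    rcases hx with (⟨i, rfl⟩ | ⟨i, rfl⟩) | ⟨i, rfl⟩ <;> exact ⟨hyF _, hyA _⟩

end Ctx

end Setup

lemma Walk.symm {V : Type*} [DecidableEq V] {l r : ℕ} {E : Finset (Finset V)} {t : ℕ}
    {S T : Fin (l + 1) → V} {vs : List V} (h : Walk r E t S T vs) :
    ∃ ws, Walk r E t T S ws ∧ (ws ++ List.ofFn S).Perm (vs ++ List.ofFn T) := by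
  induction h with
  | nil L => exact ⟨[], Walk.nil L, List.Perm.refl _⟩
  | @cons t L M L' T vs he h ih =>
    obtain ⟨ws, hw, hp⟩ := ih
    have he' : im L' ∪ im M ∪ im L ∈ E := by
      rwa [union_comm, union_comm (im L'), ← union_assoc]
    refine ⟨_, hw.append (Walk.single he'), ?_⟩
    calc ws ++ (List.ofFn L' ++ List.ofFn M) ++ List.ofFn L
        = (ws ++ List.ofFn L') ++ (List.ofFn M ++ List.ofFn L) := by simp
      _ |>.Perm ((vs ++ List.ofFn T) ++ (List.ofFn L ++ List.ofFn M)) :=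
        hp.append List.perm_append_comm
      _ |>.Perm ((List.ofFn L ++ List.ofFn M) ++ (vs ++ List.ofFn T)) := List.perm_append_comm
      _ = _ := by simp

section Setup

variable {V : Type*} [Fintype V] [DecidableEq V]

/-- A walk with typical ends; `z` is the number of edges minus twice the number of vertices
in `A₂`. -/
def Seg (l r : ℕ) (E : Finset (Finset V)) (A A₂ : Finset V) (τ : ℝ) (z : ℤ) (t : ℕ)
    (xs : List V) : Prop :=
  ∃ (S T : Fin (l + 1) → V) (vs : List V), Walk r E t S T vs ∧ xs = vs ++ List.ofFn T ∧
    xs.Nodup ∧ Typ r E A τ S ∧ Typ r E A τ T ∧ (t : ℤ) - 2 * xs.countP (· ∈ A₂) = z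

/-- A walk avoiding `A₂`. -/
def Raw (l r : ℕ) (E : Finset (Finset V)) (A₂ : Finset V) (t : ℕ) (xs : List V) : Prop :=
  ∃ (S T : Fin (l + 1) → V) (vs : List V), Walk r E t S T vs ∧ xs = vs ++ List.ofFn T ∧
    xs.Nodup ∧ ∀ x ∈ xs, x ∉ A₂

variable {l r : ℕ} {E : Finset (Finset V)} {A Bad A₂ : Finset V} {p γ τ ε : ℝ}

lemma Seg.length_eq {z : ℤ} {t : ℕ} {xs : List V} (h : Seg l r E A A₂ τ z t xs) :
    xs.length = t * (l + r + 2) + (l + 1) := by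
  obtain ⟨S, T, vs, hw, rfl, -⟩ := h
  simp [hw.length_eq]

lemma Seg.le {z : ℤ} {t : ℕ} {xs : List V} (h : Seg l r E A A₂ τ z t xs) : z ≤ t := by
  obtain ⟨S, T, vs, -, -, -, -, -, hz⟩ := h
  omega

lemma Raw.length_eq {t : ℕ} {xs : List V} (h : Raw l r E A₂ t xs) :
    xs.length = t * (l + r + 2) + (l + 1) := by
  obtain ⟨S, T, vs, hw, rfl, -⟩ := h
  simp [hw.length_eq]

lemma nodup_append_of_forall {F : Finset V} {xs ys : List V} (hx : xs.Nodup) (hy : ys.Nodup)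
    (hxF : ∀ x ∈ xs, x ∈ F) (hyF : ∀ y ∈ ys, y ∉ F) : (xs ++ ys).Nodup :=
  List.nodup_append.mpr ⟨hx, hy, fun a ha b hb hab => hyF b hb (hab ▸ hxF a ha)⟩

namespace Ctx

variable (h : Ctx l r E A Bad A₂ p γ τ ε)
include h

lemma countP_eq_zero {F : Finset V} (hBad : Bad ⊆ F) {xs : List V}
    (hxs : ∀ x ∈ xs, x ∉ F ∧ x ∉ A) : xs.countP (· ∈ A₂) = 0 := by
  rw [List.countP_eq_zero]
  intro x hx
  have := h.notMem_A₂ x (hxs x hx).2 fun hb => (hxs x hx).1 (hBad hb)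
  simpa using this

/-- Two segments can be joined. -/
lemma join {F : Finset V} (hBad : Bad ⊆ F) (hF : weight V l r F ≤ γ / 8) {z₁ z₂ : ℤ}
    {t₁ t₂ : ℕ} {xs ys : List V} (hx : Seg l r E A A₂ τ z₁ t₁ xs)
    (hy : Seg l r E A A₂ τ z₂ t₂ ys) (hxF : ∀ x ∈ xs, x ∈ F) (hyF : ∀ y ∈ ys, y ∈ F)
    (hxy : ∀ x ∈ xs, x ∉ ys) :
    ∃ zs, Seg l r E A A₂ τ (z₁ + z₂) (t₁ + t₂ + 2) (xs ++ zs ++ ys) ∧ ∀ x ∈ zs, x ∉ F := by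
  obtain ⟨S, T, vs, hw, rfl, hn, hS, hT, hz⟩ := hx
  obtain ⟨S', T', vs', hw', rfl, hn', hS', hT', hz'⟩ := hy
  obtain ⟨M₀, a, R, M₁, he₀, he₁, hnew, haA, haF, hall⟩ := h.exists_join hT hS' hF
  have haA₂ : a ∈ A₂ := h.mem_A₂ a haA fun hb => haF (hBad hb)
  have hzs : ∀ x ∈ List.ofFn M₀ ++ (a :: List.ofFn R) ++ List.ofFn M₁, x ∉ F := by
    intro x hx
    simp only [List.mem_append, List.mem_cons] at hx
    by_cases hxa : x = a
    · exact hxa ▸ haF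
    · exact (hall x (by simp only [List.mem_append]; tauto)).1
  refine ⟨List.ofFn M₀ ++ (a :: List.ofFn R) ++ List.ofFn M₁, ?_, hzs⟩
  have hcons : List.ofFn (Fin.cons (α := fun _ => V) a R) = a :: List.ofFn R := by
    simp [List.ofFn_succ]
  rw [← im_cons] at he₀ he₁
  have hW := hw.append ((Walk.single he₀).append ((Walk.single he₁).append hw'))
  rw [show t₁ + (1 + (1 + t₂)) = t₁ + t₂ + 2 by ring] at hW
  refine ⟨S, T', _, hW, ?_,
    ?_, hS, hT', ?_⟩
  · rw [hcons]; simp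
  · rw [List.nodup_append]
    refine ⟨nodup_append_of_forall hn hnew hxF hzs, hn', ?_⟩
    rintro x hx y hy rfl
    rw [List.mem_append] at hx
    rcases hx with hx | hx
    · exact hxy _ hx hy
    · exact hzs _ hx (hyF _ hy)
  · have h1 := h.countP_eq_zero hBad hall
    simp only [List.countP_append, List.countP_cons, haA₂, decide_true] at h1 hz hz' ⊢
    push_cast at h1 hz hz' ⊢
    omega

lemma exists_typ_bound :
    frac {y : Fin (l + 1) → V | (∀ i, y i ∉ A) ∧ ¬ Typ r E A τ y} ≤ p / 64 := by
  have h1 := h.not_typ_le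
  have h2 := h.γ_le
  linarith

/-- The trivial segment. -/
lemma exists_trivial {F : Finset V} (hBad : Bad ⊆ F) (hF : weight V l r F ≤ γ / 8) :
    ∃ xs, Seg l r E A A₂ τ 0 0 xs ∧ ∀ x ∈ xs, x ∉ F := by
  have := h.nonempty
  have h1 : p ≤ frac {y : Fin (l + 1) → V | ∀ i, y i ∉ A} := by
    rw [frac_outside_pow, Fintype.card_fin]
    refine (h.le_prod (l + 1) (by omega)).trans ?_
    exact mul_le_of_le_one_left (pow_nonneg (frac_nonneg _) _) (frac_le_one _)
  have h2 : {y : Fin (l + 1) → V | ∀ i, y i ∉ A} ⊆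
      {y : Fin (l + 1) → V | (∀ i, y i ∉ A) ∧ Typ r E A τ y} ∪
      {y : Fin (l + 1) → V | (∀ i, y i ∉ A) ∧ ¬ Typ r E A τ y} := by
    intro y hy
    by_cases hT : Typ r E A τ y
    · exact Or.inl ⟨hy, hT⟩
    · exact Or.inr ⟨hy, hT⟩
  have h3 := frac_le_add h2
  have h4 := h.exists_typ_bound
  have h5 := h.p_pos
  have h6 := h.γ_le
  obtain ⟨y, ⟨hyA, hyT⟩, hyF, hinj⟩ := exists_tuple_of_weight (l := l) (r := r) (F := F)
    (ι := Fin (l + 1)) (by rw [Fintype.card_fin]; omega) (sub_le_iff_le_add.mpr (h1.trans h3))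
    (by linarith)
  have hall : ∀ x ∈ List.ofFn y, x ∉ F ∧ x ∉ A := by
    intro x hx
    rw [List.mem_ofFn] at hx
    obtain ⟨i, rfl⟩ := hx
    exact ⟨hyF i, hyA i⟩
  refine ⟨List.ofFn y, ⟨y, y, [], Walk.nil y, rfl, List.nodup_ofFn.mpr hinj, hyT, hyT, ?_⟩,
    fun x hx => (hall x hx).1⟩
  rw [h.countP_eq_zero hBad hall]; rfl

/-- Two edges through a rich pair. -/
lemma exists_seg_of_rich {F : Finset V} (hBad : Bad ⊆ F) {v : V} (hv : v ∈ A₂) {R : Fin l → V}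
    (hR : Rich r E A γ v R) (hRi : (v :: List.ofFn R).Nodup) (hRA : ∀ i, R i ∉ F ∧ R i ∉ A)
    (hF : weight V l r F ≤ γ / 8) :
    ∃ ws, Seg l r E A A₂ τ 0 2 ws ∧ v ∈ ws ∧ ∀ x ∈ ws, x = v ∨ x ∉ F := by
  have := h.nonempty
  let X₁ : Finset V := insert v (im R)
  have hX₁ : X₁.card ≤ l + 1 := (card_insert_le _ _).trans (by
    have := card_im_le R; simp at this; omega)
  obtain ⟨M₁, L₁, he₁, hL₁, hn₁, ha₁⟩ := h.exists_completion hR (F := F ∪ X₁)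
    ((weight_union_le (hX₁.trans (by omega))).trans (by linarith))
  let X₂ : Finset V := X₁ ∪ (im M₁ ∪ im L₁)
  have hX₂ : X₂.card ≤ l + 1 + ((r + 1) + (l + 1)) := by
    have h1 := card_im_le M₁
    have h2 := card_im_le L₁
    simp only [Fintype.card_fin] at h1 h2
    exact (card_union_le _ _).trans (add_le_add hX₁ ((card_union_le _ _).trans (add_le_add h1 h2)))
  obtain ⟨M₀, L₀, he₀, hL₀, hn₀, ha₀⟩ := h.exists_completion hR (F := F ∪ X₂)
    ((weight_union_le (hX₂.trans (by omega))).trans (by linarith))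
  have hcons : List.ofFn (Fin.cons (α := fun _ => V) v R) = v :: List.ofFn R := by
    simp [List.ofFn_succ]
  rw [← im_cons] at he₀ he₁
  have he₀' : im L₀ ∪ im M₀ ∪ im (Fin.cons (α := fun _ => V) v R) ∈ E := by
    rwa [union_comm, union_comm (im L₀)]
  rw [← union_assoc] at he₁
  have hW := (Walk.single he₀').append (Walk.single he₁)
  have hx₁ : ∀ x ∈ v :: List.ofFn R, x ∈ F ∪ X₁ := by
    intro x hx
    simp only [List.mem_cons, List.mem_ofFn] at hx
    refine mem_union_right _ ?_
    simp only [X₁, mem_insert, mem_im]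
    exact hx
  have hn₂ := nodup_append_of_forall hRi hn₁ hx₁ fun x hx => (ha₁ x hx).1
  have hx₂ : ∀ x ∈ (v :: List.ofFn R) ++ (List.ofFn M₁ ++ List.ofFn L₁), x ∈ F ∪ X₂ := by
    intro x hx
    simp only [List.mem_append, List.mem_cons, List.mem_ofFn] at hx
    refine mem_union_right _ ?_
    simp only [X₂, X₁, mem_insert, mem_im, mem_union]
    exact hx
  have hn₃ := nodup_append_of_forall hn₂ hn₀ hx₂ fun x hx => (ha₀ x hx).1
  have hp : (List.ofFn L₀ ++ List.ofFn M₀ ++ (List.ofFn (Fin.cons (α := fun _ => V) v R) ++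
      List.ofFn M₁) ++ List.ofFn L₁).Perm
      ((v :: List.ofFn R) ++ (List.ofFn M₁ ++ List.ofFn L₁) ++ (List.ofFn M₀ ++ List.ofFn L₀)) := by
    rw [hcons, List.append_assoc, List.append_assoc (v :: List.ofFn R)]
    exact List.perm_append_comm.trans ((List.Perm.append_left _ List.perm_append_comm).trans
      (by simp))
  have hall : ∀ x ∈ List.ofFn R ++ (List.ofFn M₁ ++ List.ofFn L₁) ++
      (List.ofFn M₀ ++ List.ofFn L₀), x ∉ F ∧ x ∉ A := by
    intro x hx
    rw [List.mem_append, List.mem_append] at hx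
    rcases hx with (hx | hx) | hx
    · rw [List.mem_ofFn] at hx
      obtain ⟨i, rfl⟩ := hx
      exact hRA i
    · exact ⟨fun hF => (ha₁ x hx).1 (mem_union_left _ hF), (ha₁ x hx).2⟩
    · exact ⟨fun hF => (ha₀ x hx).1 (mem_union_left _ hF), (ha₀ x hx).2⟩
  refine ⟨_, ⟨L₀, L₁, _, hW, rfl, hp.nodup_iff.mpr hn₃, hL₀, hL₁, ?_⟩, ?_, ?_⟩
  · rw [hp.countP_eq]
    have h1 := h.countP_eq_zero hBad hall
    simp only [List.countP_append, List.cons_append, List.countP_cons, hv, decide_true] at h1 ⊢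
    push_cast at h1 ⊢
    omega
  · rw [hp.mem_iff]; simp
  · intro x hx
    rw [hp.mem_iff, List.cons_append, List.cons_append, List.mem_cons] at hx
    exact hx.imp_right fun hx => (hall x hx).1

end Ctx

end Setup

section Setup

variable {V : Type*} [Fintype V] [DecidableEq V]
variable {l r : ℕ} {E : Finset (Finset V)} {A Bad A₂ : Finset V} {p γ τ ε : ℝ}

lemma ofFn_finCons {s : ℕ} (a : V) (y : Fin s → V) :
    List.ofFn (Fin.cons (α := fun _ => V) a y) = a :: List.ofFn y := by
  simp [List.ofFn_succ]

namespace Ctx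

variable (h : Ctx l r E A Bad A₂ p γ τ ε)
include h

lemma frac_not_typ_comp_le {Ω ι : Type*} [Finite Ω] [Nonempty Ω] [Fintype ι]
    {e : Fin (l + 1) → ι} (he : Function.Injective e) :
    frac {q : Ω × (ι → V) | (∀ i, q.2 i ∉ A) ∧ ¬ Typ r E A τ (q.2 ∘ e)} ≤ p / 64 := by
  have := h.nonempty
  refine le_trans (frac_mono fun q hq => ?_) ((frac_snd (Ω := Ω) {y : ι → V | y ∘ e ∈
    {x : Fin (l + 1) → V | (∀ i, x i ∉ A) ∧ ¬ Typ r E A τ x}}).le.trans ?_)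
  · exact ⟨fun i => hq.1 _, hq.2⟩
  · rw [frac_comp he]; exact h.exists_typ_bound

lemma frac_not_rich_comp_le {ι : Type*} [Fintype ι] {e : Fin l → ι} (he : Function.Injective e) :
    frac {q : V × (ι → V) | q.1 ∈ A ∧ q.1 ∉ Bad ∧ (∀ i, q.2 i ∉ A) ∧
      ¬ Rich r E A γ q.1 (q.2 ∘ e)} ≤ p / 8 := by
  have := h.nonempty
  have hp := h.p_pos
  refine frac_le_of_fiber_le (by positivity) fun a => ?_
  by_cases ha : a ∈ A ∧ a ∉ Bad
  · refine le_trans (frac_mono fun y hy => ?_) ((frac_comp he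
      {R : Fin l → V | (∀ i, R i ∉ A) ∧ ¬ Rich r E A γ a R}).le.trans (h.not_rich_le a ha.1 ha.2))
    exact ⟨fun i => hy.2.2.1 _, hy.2.2.2⟩
  · have : {y : ι → V | (a, y) ∈ {q : V × (ι → V) | q.1 ∈ A ∧ q.1 ∉ Bad ∧ (∀ i, q.2 i ∉ A) ∧
      ¬ Rich r E A γ q.1 (q.2 ∘ e)}} = ∅ := by
      ext y; simp; tauto
    rw [this, frac_empty]
    positivity

/-- Every vertex can be covered by a short segment. -/
lemma exists_cover {F : Finset V} (hBad : Bad ⊆ F) (hF : weight V l r F ≤ γ / 8) (v : V) :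
    ∃ ws, Seg l r E A A₂ τ 0 2 ws ∧ v ∈ ws ∧ ∀ x ∈ ws, x = v ∨ x ∉ F := by
  have := h.nonempty
  have hγ := h.γ_pos
  have hp := h.p_pos
  have hγp := h.γ_le
  have hF' : weight V l r (F ∪ {v}) ≤ γ / 4 := (weight_union_le (by simp)).trans (by linarith)
  by_cases hv : v ∈ A₂
  · obtain ⟨R, ⟨hRA, hR⟩, hRF, hinj⟩ := exists_tuple_of_weight (l := l) (r := r) (F := F ∪ {v})
      (ι := Fin l) (by rw [Fintype.card_fin]; omega) (h.le_rich v hv) (by linarith)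
    simp only [mem_union, mem_singleton, not_or] at hRF
    refine h.exists_seg_of_rich hBad hv hR ?_ (fun i => ⟨(hRF i).1, hRA i⟩) hF
    rw [List.nodup_cons, List.nodup_ofFn, List.mem_ofFn]
    exact ⟨fun ⟨i, hi⟩ => (hRF i).2 hi, hinj⟩
  · let ι := Fin l ⊕ Fin (l + 1) ⊕ Fin r
    have h1 := h.neA_le v hv ι (by simp [ι]; omega)
    unfold neA at h1
    have h2 := h.frac_not_typ_comp_le (Ω := V) (ι := ι) (e := fun i => Sum.inr (Sum.inl i))
      (Sum.inr_injective.comp Sum.inl_injective)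
    have h3 := h.frac_not_rich_comp_le (ι := ι) (e := Sum.inl) Sum.inl_injective
    have h4 := h.le_frac_pair (ι := ι) (by simp [ι]; omega)
    have hsub : {q : V × (ι → V) | q.1 ∈ A ∧ ∀ i, q.2 i ∉ A} ⊆
        {q : V × (ι → V) | (q.1 ∈ A ∧ ∀ i, q.2 i ∉ A) ∧ insert q.1 ({v} ∪ im q.2) ∈ E ∧
          Typ r E A τ (q.2 ∘ fun i => Sum.inr (Sum.inl i)) ∧
          (q.1 ∉ Bad → Rich r E A γ q.1 (q.2 ∘ Sum.inl))} ∪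
        ({q : V × (ι → V) | q.1 ∈ A ∧ (∀ i, q.2 i ∉ A) ∧ insert q.1 ({v} ∪ im q.2) ∉ E} ∪
        ({q : V × (ι → V) | (∀ i, q.2 i ∉ A) ∧
          ¬ Typ r E A τ (q.2 ∘ fun i => Sum.inr (Sum.inl i))} ∪
        {q : V × (ι → V) | q.1 ∈ A ∧ q.1 ∉ Bad ∧ (∀ i, q.2 i ∉ A) ∧
          ¬ Rich r E A γ q.1 (q.2 ∘ Sum.inl)})) := by
      intro q hq
      by_contra hcon
      simp only [Set.mem_union, Set.mem_ofPred_eq] at hcon hq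
      tauto
    have h5 := frac_le_add hsub
    have h6 := frac_union_le {q : V × (ι → V) | q.1 ∈ A ∧ (∀ i, q.2 i ∉ A) ∧
      insert q.1 ({v} ∪ im q.2) ∉ E} ({q : V × (ι → V) | (∀ i, q.2 i ∉ A) ∧
          ¬ Typ r E A τ (q.2 ∘ fun i => Sum.inr (Sum.inl i))} ∪
        {q : V × (ι → V) | q.1 ∈ A ∧ q.1 ∉ Bad ∧ (∀ i, q.2 i ∉ A) ∧
          ¬ Rich r E A γ q.1 (q.2 ∘ Sum.inl)})
    have h7 := frac_union_le {q : V × (ι → V) | (∀ i, q.2 i ∉ A) ∧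
          ¬ Typ r E A τ (q.2 ∘ fun i => Sum.inr (Sum.inl i))}
        {q : V × (ι → V) | q.1 ∈ A ∧ q.1 ∉ Bad ∧ (∀ i, q.2 i ∉ A) ∧
          ¬ Rich r E A γ q.1 (q.2 ∘ Sum.inl)}
    have h8 := h.ε_le
    obtain ⟨a, y, ⟨⟨haA, hyA⟩, he₀, hL₀, hR⟩, haF, hyF, hinj⟩ := exists_pair_of_weight (l := l)
      (r := r) (F := F ∪ {v}) (ι := ι) (by simp [ι]; omega)
      (sub_le_iff_le_add.mpr (h4.trans h5)) (by linarith)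
    simp only [mem_union, mem_singleton, not_or] at haF hyF
    have hab : a ∉ Bad := fun hb => haF.1 (hBad hb)
    have haA₂ := h.mem_A₂ a haA hab
    replace hR := hR hab
    let X : Finset V := insert v (insert a (im y))
    have hX : X.card ≤ 2 * (2 * l + r + 3) + 1 := by
      have h1 := card_im_le y
      have h2 := card_insert_le v (insert a (im y))
      have h3 := card_insert_le a (im y)
      simp only [ι, Fintype.card_sum, Fintype.card_fin] at h1
      simp only [X]
      omega
    obtain ⟨M₁, L₁, he₁, hL₁, hn₁, ha₁⟩ := h.exists_completion hR (F := F ∪ X)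
      ((weight_union_le hX).trans (by linarith))
    let M₀ : Fin (r + 1) → V := Fin.cons v (y ∘ fun i => Sum.inr (Sum.inr i))
    have he₀' : im (y ∘ fun i => Sum.inr (Sum.inl i)) ∪ im M₀ ∪
        im (Fin.cons (α := fun _ => V) a (y ∘ Sum.inl)) ∈ E := by
      convert he₀ using 1
      rw [im_cons, im_cons]
      ext x
      simp only [mem_union, mem_insert, mem_im, mem_singleton, ι, Sum.exists, Function.comp_apply]
      tauto
    have he₁' : im (Fin.cons (α := fun _ => V) a (y ∘ Sum.inl)) ∪ im M₁ ∪ im L₁ ∈ E := by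
      rwa [im_cons, union_assoc]
    have hW := (Walk.single he₀').append (Walk.single he₁')
    have hyne : ∀ i, y i ≠ a := fun i hi => hyA i (hi ▸ haA)
    let ys := List.ofFn (y ∘ fun i => Sum.inr (Sum.inl i)) ++
      (List.ofFn (y ∘ fun i => Sum.inr (Sum.inr i)) ++ List.ofFn (y ∘ Sum.inl))
    have hys : ys.Nodup := by
      simp only [ys, List.nodup_append, List.nodup_ofFn, List.mem_append, List.mem_ofFn]
      refine ⟨hinj.comp (Sum.inr_injective.comp Sum.inl_injective),
        ⟨hinj.comp (Sum.inr_injective.comp Sum.inr_injective), hinj.comp Sum.inl_injective, ?_⟩, ?_⟩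
      · rintro _ ⟨i, rfl⟩ _ ⟨j, rfl⟩ hij
        exact nomatch hinj hij
      · rintro _ ⟨i, rfl⟩ _ (⟨j, rfl⟩ | ⟨j, rfl⟩) hij
        · exact nomatch Sum.inr_injective (hinj hij)
        · exact nomatch hinj hij
    have hys' : ∀ x ∈ ys, ∃ i, y i = x := by
      intro x hx
      simp only [ys, List.mem_append, List.mem_ofFn] at hx
      rcases hx with ⟨i, rfl⟩ | ⟨i, rfl⟩ | ⟨i, rfl⟩ <;> exact ⟨_, rfl⟩
    have hp : (List.ofFn (y ∘ fun i => Sum.inr (Sum.inl i)) ++ List.ofFn M₀ ++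
        (List.ofFn (Fin.cons (α := fun _ => V) a (y ∘ Sum.inl)) ++ List.ofFn M₁) ++
        List.ofFn L₁).Perm (v :: a :: ys ++ (List.ofFn M₁ ++ List.ofFn L₁)) := by
      simp only [M₀, ofFn_finCons, ys]
      rw [← List.append_assoc _ _ (List.ofFn M₁), List.append_assoc _ (List.ofFn M₁)]
      refine List.Perm.append_right _ ?_
      rw [List.append_assoc, List.cons_append]
      refine List.perm_middle.trans (List.Perm.cons _ ?_)
      rw [← List.append_assoc]
      refine List.perm_middle.trans (List.Perm.cons _ ?_)
      rw [List.append_assoc]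
    have hn : (v :: a :: ys ++ (List.ofFn M₁ ++ List.ofFn L₁)).Nodup := by
      refine nodup_append_of_forall (F := F ∪ X) ?_ hn₁ ?_ fun x hx => (ha₁ x hx).1
      · rw [List.nodup_cons, List.nodup_cons, List.mem_cons]
        refine ⟨?_, fun hx => ?_, hys⟩
        · rintro (rfl | hx)
          · exact haF.2 rfl
          · obtain ⟨i, hi⟩ := hys' _ hx
            exact (hyF i).2 hi
        · obtain ⟨i, hi⟩ := hys' _ hx
          exact hyne i hi
      · intro x hx
        refine mem_union_right _ ?_
        simp only [X, mem_insert, mem_im]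
        simp only [List.mem_cons] at hx
        exact hx.imp_right fun hx => hx.imp_right (hys' x)
    have hall : ∀ x ∈ ys ++ (List.ofFn M₁ ++ List.ofFn L₁), x ∉ F ∧ x ∉ A := by
      intro x hx
      rw [List.mem_append] at hx
      rcases hx with hx | hx
      · obtain ⟨i, rfl⟩ := hys' x hx
        exact ⟨(hyF i).1, hyA i⟩
      · exact ⟨fun hF => (ha₁ x hx).1 (mem_union_left _ hF), (ha₁ x hx).2⟩
    refine ⟨_, ⟨_, L₁, _, hW, rfl, hp.nodup_iff.mpr hn, hL₀, hL₁, ?_⟩, ?_, ?_⟩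
    · rw [hp.countP_eq]
      have h1 := h.countP_eq_zero hBad hall
      rw [List.cons_append, List.cons_append]
      simp only [List.countP_cons, h1, haA₂, hv, decide_true, decide_false]
      simp
    · rw [hp.mem_iff]; simp
    · intro x hx
      rw [hp.mem_iff, List.cons_append, List.cons_append, List.mem_cons, List.mem_cons] at hx
      rcases hx with rfl | rfl | hx
      · exact Or.inl rfl
      · exact Or.inr haF.1
      · exact Or.inr (hall x hx).1

/-- A single edge meeting `A₂` in one vertex with typical ends. -/
lemma exists_waste {F : Finset V} (hBad : Bad ⊆ F) (hF : weight V l r F ≤ γ / 8) :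
    ∃ ws, Seg l r E A A₂ τ (-1) 1 ws ∧ ∀ x ∈ ws, x ∉ F := by
  have := h.nonempty
  have hγ := h.γ_pos
  have hp := h.p_pos
  have hγp := h.γ_le
  let ι := Fin (l + 1) ⊕ Fin r ⊕ Fin (l + 1)
  have h1 := h.neA_empty_le ι (by simp [ι]; omega)
  unfold neA at h1
  have h2 := h.frac_not_typ_comp_le (Ω := V) (ι := ι) (e := Sum.inl) Sum.inl_injective
  have h3 := h.frac_not_typ_comp_le (Ω := V) (ι := ι) (e := fun i => Sum.inr (Sum.inr i))
    (Sum.inr_injective.comp Sum.inr_injective)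
  have h4 := h.le_frac_pair (ι := ι) (by simp [ι]; omega)
  have hsub : {q : V × (ι → V) | q.1 ∈ A ∧ ∀ i, q.2 i ∉ A} ⊆
      {q : V × (ι → V) | (q.1 ∈ A ∧ ∀ i, q.2 i ∉ A) ∧ insert q.1 (∅ ∪ im q.2) ∈ E ∧
        Typ r E A τ (q.2 ∘ Sum.inl) ∧ Typ r E A τ (q.2 ∘ fun i => Sum.inr (Sum.inr i))} ∪
      ({q : V × (ι → V) | q.1 ∈ A ∧ (∀ i, q.2 i ∉ A) ∧ insert q.1 (∅ ∪ im q.2) ∉ E} ∪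
      ({q : V × (ι → V) | (∀ i, q.2 i ∉ A) ∧ ¬ Typ r E A τ (q.2 ∘ Sum.inl)} ∪
      {q : V × (ι → V) | (∀ i, q.2 i ∉ A) ∧
        ¬ Typ r E A τ (q.2 ∘ fun i => Sum.inr (Sum.inr i))})) := by
    intro q hq
    by_contra hcon
    simp only [Set.mem_union, Set.mem_ofPred_eq] at hcon hq
    tauto
  have h5 := frac_le_add hsub
  have h6 := frac_union_le {q : V × (ι → V) | q.1 ∈ A ∧ (∀ i, q.2 i ∉ A) ∧
      insert q.1 (∅ ∪ im q.2) ∉ E}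
      ({q : V × (ι → V) | (∀ i, q.2 i ∉ A) ∧ ¬ Typ r E A τ (q.2 ∘ Sum.inl)} ∪
      {q : V × (ι → V) | (∀ i, q.2 i ∉ A) ∧
        ¬ Typ r E A τ (q.2 ∘ fun i => Sum.inr (Sum.inr i))})
  have h7 := frac_union_le {q : V × (ι → V) | (∀ i, q.2 i ∉ A) ∧ ¬ Typ r E A τ (q.2 ∘ Sum.inl)}
      {q : V × (ι → V) | (∀ i, q.2 i ∉ A) ∧
        ¬ Typ r E A τ (q.2 ∘ fun i => Sum.inr (Sum.inr i))}
  have h8 := h.ε_le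
  obtain ⟨a, y, ⟨⟨haA, hyA⟩, he, hL, hL'⟩, haF, hyF, hinj⟩ := exists_pair_of_weight (l := l)
    (r := r) (F := F) (ι := ι) (by simp [ι]; omega)
    (sub_le_iff_le_add.mpr (h4.trans h5)) (by linarith)
  have haA₂ := h.mem_A₂ a haA fun hb => haF (hBad hb)
  have hyne : ∀ i, y i ≠ a := fun i hi => hyA i (hi ▸ haA)
  let M : Fin (r + 1) → V := Fin.cons a (y ∘ fun i => Sum.inr (Sum.inl i))
  have he' : im (y ∘ Sum.inl) ∪ im M ∪ im (y ∘ fun i => Sum.inr (Sum.inr i)) ∈ E := by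
    convert he using 1
    rw [im_cons]
    ext x
    simp only [mem_union, mem_insert, mem_im, ι, Sum.exists, Function.comp_apply, notMem_empty]
    tauto
  have hW := Walk.single he'
  let ys := List.ofFn (y ∘ Sum.inl) ++ (List.ofFn (y ∘ fun i => Sum.inr (Sum.inl i)) ++
    List.ofFn (y ∘ fun i => Sum.inr (Sum.inr i)))
  have hys : ys.Nodup := by
    simp only [ys, List.nodup_append, List.nodup_ofFn, List.mem_append, List.mem_ofFn]
    refine ⟨hinj.comp Sum.inl_injective,
      ⟨hinj.comp (Sum.inr_injective.comp Sum.inl_injective),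
        hinj.comp (Sum.inr_injective.comp Sum.inr_injective), ?_⟩, ?_⟩
    · rintro _ ⟨i, rfl⟩ _ ⟨j, rfl⟩ hij
      exact nomatch Sum.inr_injective (hinj hij)
    · rintro _ ⟨i, rfl⟩ _ (⟨j, rfl⟩ | ⟨j, rfl⟩) hij
      · exact nomatch hinj hij
      · exact nomatch hinj hij
  have hys' : ∀ x ∈ ys, ∃ i, y i = x := by
    intro x hx
    simp only [ys, List.mem_append, List.mem_ofFn] at hx
    rcases hx with ⟨i, rfl⟩ | ⟨i, rfl⟩ | ⟨i, rfl⟩ <;> exact ⟨_, rfl⟩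
  have hp : (List.ofFn (y ∘ Sum.inl) ++ List.ofFn M ++
      List.ofFn (y ∘ fun i => Sum.inr (Sum.inr i))).Perm (a :: ys) := by
    simp only [M, ofFn_finCons, ys]
    rw [List.append_assoc, List.cons_append]
    exact List.perm_middle
  have hall : ∀ x ∈ ys, x ∉ F ∧ x ∉ A := by
    intro x hx
    obtain ⟨i, rfl⟩ := hys' x hx
    exact ⟨hyF i, hyA i⟩
  refine ⟨_, ⟨_, _, _, hW, rfl, hp.nodup_iff.mpr ?_, hL, hL', ?_⟩, ?_⟩
  · rw [List.nodup_cons]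
    refine ⟨fun hx => ?_, hys⟩
    obtain ⟨i, hi⟩ := hys' _ hx
    exact hyne i hi
  · rw [hp.countP_eq, List.countP_cons, h.countP_eq_zero hBad hall]
    simp [haA₂]
  · intro x hx
    rw [hp.mem_iff, List.mem_cons] at hx
    rcases hx with rfl | hx
    · exact haF
    · exact (hall x hx).1

end Ctx

end Setup

section Setup

variable {V : Type*} [Fintype V] [DecidableEq V]
variable {l r : ℕ} {E : Finset (Finset V)} {A Bad A₂ : Finset V} {p γ τ ε : ℝ}

namespace Ctx

variable (h : Ctx l r E A Bad A₂ p γ τ ε)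
include h

/-- Every walk can be extended so as to end in a typical tuple. -/
lemma exists_extension {F : Finset V} (hBad : Bad ⊆ F) (hF : weight V l r F ≤ γ / 8) {t : ℕ}
    {S T : Fin (l + 1) → V} {vs : List V} (hW : Walk r E t S T vs)
    (hn : (vs ++ List.ofFn T).Nodup) (hxF : ∀ x ∈ vs ++ List.ofFn T, x ∈ F) :
    ∃ (t' : ℕ) (T' : Fin (l + 1) → V) (vs' ns : List V), Walk r E t' S T' vs' ∧
      vs' ++ List.ofFn T' = vs ++ List.ofFn T ++ ns ∧ (vs' ++ List.ofFn T').Nodup ∧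
      Typ r E A τ T' ∧ (∀ x ∈ ns, x ∉ F) ∧ t' ≤ t + 2 ∧
      (t : ℤ) ≤ t' - 2 * ns.countP (· ∈ A₂) := by
  have := h.nonempty
  have hγ := h.γ_pos
  have hp := h.p_pos
  have hγp := h.γ_le
  have hT : (im T).card = l + 1 := by
    rw [card_im, Fintype.card_fin]
    exact List.nodup_ofFn.mp (List.nodup_append.mp hn).2.1
  rcases h.ext _ hT with h1 | h1
  · let ι := Fin (r + 1) ⊕ Fin l
    unfold edA at h1
    have h3 := h.frac_not_rich_comp_le (ι := ι) (e := Sum.inr) Sum.inr_injective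
    have hsub : {q : V × (ι → V) | q.1 ∈ A ∧ (∀ i, q.2 i ∉ A) ∧ insert q.1 (im T ∪ im q.2) ∈ E} ⊆
        {q : V × (ι → V) | (q.1 ∈ A ∧ (∀ i, q.2 i ∉ A) ∧ insert q.1 (im T ∪ im q.2) ∈ E) ∧
          (q.1 ∉ Bad → Rich r E A γ q.1 (q.2 ∘ Sum.inr))} ∪
        {q : V × (ι → V) | q.1 ∈ A ∧ q.1 ∉ Bad ∧ (∀ i, q.2 i ∉ A) ∧
          ¬ Rich r E A γ q.1 (q.2 ∘ Sum.inr)} := by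
      intro q hq
      by_contra hcon
      simp only [Set.mem_union, Set.mem_ofPred_eq] at hcon hq
      tauto
    have h5 := frac_le_add hsub
    obtain ⟨a, y, ⟨⟨haA, hyA, he₀⟩, hR⟩, haF, hyF, hinj⟩ := exists_pair_of_weight (l := l)
      (r := r) (F := F) (ι := ι) (by simp [ι]; omega)
      (sub_le_iff_le_add.mpr (h1.trans h5)) (by linarith)
    have hab : a ∉ Bad := fun hb => haF (hBad hb)
    have haA₂ := h.mem_A₂ a haA hab
    replace hR := hR hab
    let X : Finset V := insert a (im y)
    have hX : X.card ≤ 2 * (2 * l + r + 3) + 1 := by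
      have h1 := card_im_le y
      have h3 := card_insert_le a (im y)
      simp only [ι, Fintype.card_sum, Fintype.card_fin] at h1
      simp only [X]
      omega
    obtain ⟨M₁, L₁, he₁, hL₁, hn₁, ha₁⟩ := h.exists_completion hR (F := F ∪ X)
      ((weight_union_le hX).trans (by linarith))
    have he₀' : im T ∪ im (y ∘ Sum.inl) ∪ im (Fin.cons (α := fun _ => V) a (y ∘ Sum.inr)) ∈ E := by
      convert he₀ using 1
      rw [im_cons]
      ext x
      simp only [mem_union, mem_insert, mem_im, ι, Sum.exists, Function.comp_apply]
      tauto
    have he₁' : im (Fin.cons (α := fun _ => V) a (y ∘ Sum.inr)) ∪ im M₁ ∪ im L₁ ∈ E := by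
      rwa [im_cons, union_assoc]
    have hyne : ∀ i, y i ≠ a := fun i hi => hyA i (hi ▸ haA)
    let ns := List.ofFn (y ∘ Sum.inl) ++ (a :: List.ofFn (y ∘ Sum.inr)) ++
      (List.ofFn M₁ ++ List.ofFn L₁)
    have hall : ∀ x ∈ List.ofFn (y ∘ Sum.inl) ++ List.ofFn (y ∘ Sum.inr) ++
        (List.ofFn M₁ ++ List.ofFn L₁), x ∉ F ∧ x ∉ A := by
      intro x hx
      rw [List.mem_append] at hx
      rcases hx with hx | hx
      · simp only [List.mem_append, List.mem_ofFn] at hx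
        rcases hx with ⟨i, rfl⟩ | ⟨i, rfl⟩ <;> exact ⟨hyF _, hyA _⟩
      · exact ⟨fun hF => (ha₁ x hx).1 (mem_union_left _ hF), (ha₁ x hx).2⟩
    have hnsF : ∀ x ∈ ns, x ∉ F := by
      intro x hx
      by_cases hxa : x = a
      · exact hxa ▸ haF
      · refine (hall x ?_).1
        simp only [ns, List.mem_append, List.mem_cons] at hx ⊢
        tauto
    have hns : ns.Nodup := by
      refine nodup_append_of_forall (F := F ∪ X) ?_ hn₁ ?_ fun x hx => (ha₁ x hx).1
      · simp only [List.nodup_append, List.nodup_cons, List.nodup_ofFn, List.mem_cons,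
          List.mem_ofFn]
        refine ⟨hinj.comp Sum.inl_injective, ⟨?_, hinj.comp Sum.inr_injective⟩, ?_⟩
        · rintro ⟨i, hi⟩; exact hyne _ hi
        · rintro _ ⟨i, rfl⟩ _ (rfl | ⟨j, rfl⟩) hij
          · exact hyne _ hij
          · exact nomatch hinj hij
      · intro x hx
        refine mem_union_right _ ?_
        simp only [List.mem_append, List.mem_cons, List.mem_ofFn] at hx
        simp only [X, mem_insert, mem_im]
        rcases hx with ⟨i, rfl⟩ | rfl | ⟨i, rfl⟩
        · exact Or.inr ⟨_, rfl⟩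
        · exact Or.inl rfl
        · exact Or.inr ⟨_, rfl⟩
    have heq : vs ++ (List.ofFn T ++ List.ofFn (y ∘ Sum.inl) ++
        (List.ofFn (Fin.cons (α := fun _ => V) a (y ∘ Sum.inr)) ++ List.ofFn M₁)) ++
        List.ofFn L₁ = vs ++ List.ofFn T ++ ns := by
      simp only [ns, ofFn_finCons, List.append_assoc, List.cons_append]
    refine ⟨_, L₁, _, ns, hW.append ((Walk.single he₀').append (Walk.single he₁')), heq, ?_, hL₁,
      hnsF, le_rfl, ?_⟩
    · rw [heq]
      exact nodup_append_of_forall hn hns hxF hnsF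
    · have h1 := h.countP_eq_zero hBad hall
      simp only [ns, List.countP_append, List.countP_cons, haA₂, decide_true] at h1 ⊢
      push_cast at h1 ⊢
      omega
  · unfold edB at h1
    let ι := Fin (r + 1) ⊕ Fin (l + 1)
    have h2 : frac {y : ι → V | y ∘ Sum.inr ∈
        {x : Fin (l + 1) → V | (∀ i, x i ∉ A) ∧ ¬ Typ r E A τ x}} ≤ γ / 8 := by
      rw [frac_comp Sum.inr_injective]; exact h.not_typ_le
    have hsub : {y : ι → V | (∀ i, y i ∉ A) ∧ im T ∪ im y ∈ E} ⊆
        {y : ι → V | ((∀ i, y i ∉ A) ∧ im T ∪ im y ∈ E) ∧ Typ r E A τ (y ∘ Sum.inr)} ∪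
        {y : ι → V | y ∘ Sum.inr ∈
          {x : Fin (l + 1) → V | (∀ i, x i ∉ A) ∧ ¬ Typ r E A τ x}} := by
      intro y hy
      by_cases hT : Typ r E A τ (y ∘ Sum.inr)
      · exact Or.inl ⟨hy, hT⟩
      · exact Or.inr ⟨fun i => hy.1 _, hT⟩
    have h3 := frac_le_add hsub
    obtain ⟨y, ⟨⟨hyA, hyE⟩, hyT⟩, hyF, hinj⟩ := exists_tuple_of_weight (l := l) (r := r)
      (F := F) (ι := ι) (by simp [ι]; omega) (sub_le_iff_le_add.mpr (h1.trans h3)) (by linarith)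
    rw [im_sum, ← union_assoc] at hyE
    let ns := List.ofFn (y ∘ Sum.inl) ++ List.ofFn (y ∘ Sum.inr)
    have hall : ∀ x ∈ ns, x ∉ F ∧ x ∉ A := by
      intro x hx
      simp only [ns, List.mem_append, List.mem_ofFn] at hx
      rcases hx with ⟨i, rfl⟩ | ⟨i, rfl⟩ <;> exact ⟨hyF _, hyA _⟩
    have hns : ns.Nodup := by
      simp only [ns, List.nodup_append, List.nodup_ofFn, List.mem_ofFn]
      refine ⟨hinj.comp Sum.inl_injective, hinj.comp Sum.inr_injective, ?_⟩
      rintro _ ⟨i, rfl⟩ _ ⟨j, rfl⟩ hij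
      exact nomatch hinj hij
    have heq : vs ++ (List.ofFn T ++ List.ofFn (y ∘ Sum.inl)) ++ List.ofFn (y ∘ Sum.inr) =
        vs ++ List.ofFn T ++ ns := by simp [ns]
    refine ⟨_, _, _, ns, hW.append (Walk.single hyE), heq, ?_, hyT, fun x hx => (hall x hx).1,
      by omega, ?_⟩
    · rw [heq]
      exact nodup_append_of_forall hn hns hxF fun x hx => (hall x hx).1
    · rw [h.countP_eq_zero hBad hall]; push_cast; omega

/-- A walk avoiding `A₂` extends to a segment of at least the same value. -/
lemma exists_seg_of_raw {F : Finset V} (hBad : Bad ⊆ F) (hF : weight V l r F ≤ γ / 16) {t : ℕ}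
    {xs : List V} (hx : Raw l r E A₂ t xs) (hxF : ∀ x ∈ xs, x ∈ F) :
    ∃ (z : ℤ) (t' : ℕ) (ws : List V), Seg l r E A A₂ τ z t' ws ∧ t ≤ z ∧ t' ≤ t + 4 ∧
      (∀ x ∈ xs, x ∈ ws) ∧ ∀ x ∈ ws, x ∈ xs ∨ x ∉ F := by
  have := h.nonempty
  have hγ := h.γ_pos
  obtain ⟨S, T, vs, hW, rfl, hn, hA₂⟩ := hx
  obtain ⟨t₁, T₁, vs₁, ns₁, hW₁, he₁, hn₁, hT₁, hns₁, ht₁, hz₁⟩ :=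
    h.exists_extension hBad (hF.trans (by linarith)) hW hn hxF
  obtain ⟨us, hWu, hp⟩ := hW₁.symm
  have hlen : ns₁.length ≤ 2 * (2 * l + r + 3) + 1 := by
    have h1 := congrArg List.length he₁
    have h2 : t₁ * (l + r + 2) ≤ (t + 2) * (l + r + 2) := Nat.mul_le_mul_right _ ht₁
    simp only [List.length_append, List.length_ofFn, hW₁.length_eq, hW.length_eq] at h1
    rw [Nat.add_mul] at h2
    omega
  have hF' : weight V l r (F ∪ ns₁.toFinset) ≤ γ / 8 :=
    (weight_union_le ((List.toFinset_card_le _).trans hlen)).trans (by linarith)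
  obtain ⟨t₂, T₂, vs₂, ns₂, hW₂, he₂, hn₂, hT₂, hns₂, ht₂, hz₂⟩ :=
    h.exists_extension (hBad.trans subset_union_left) hF' hWu (hp.nodup_iff.mpr hn₁) (by
      intro x hx
      rw [hp.mem_iff, he₁, List.mem_append] at hx
      rcases hx with hx | hx
      · exact mem_union_left _ (hxF x hx)
      · exact mem_union_right _ (List.mem_toFinset.mpr hx))
  have hperm : (vs₂ ++ List.ofFn T₂).Perm (vs ++ List.ofFn T ++ ns₁ ++ ns₂) := by
    rw [he₂]
    refine List.Perm.append_right _ ?_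
    rwa [← he₁]
  refine ⟨_, t₂, _, ⟨_, T₂, vs₂, hW₂, rfl, hn₂, hT₁, hT₂, rfl⟩, ?_, by omega, ?_, ?_⟩
  · have h0 : (vs ++ List.ofFn T).countP (· ∈ A₂) = 0 := by
      rw [List.countP_eq_zero]
      intro x hx
      simpa using hA₂ x hx
    rw [hperm.countP_eq, List.countP_append, List.countP_append, h0]
    push_cast
    omega
  · intro x hx
    rw [hperm.mem_iff]
    simp only [List.mem_append] at hx ⊢
    tauto
  · intro x hx
    rw [hperm.mem_iff, List.mem_append, List.mem_append] at hx
    rcases hx with (hx | hx) | hx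
    · exact Or.inl hx
    · exact Or.inr (hns₁ x hx)
    · exact Or.inr fun hF => hns₂ x hx (mem_union_left _ hF)

/-- Appending a segment produced by a construction avoiding the current segment. -/
lemma absorb {F : Finset V} (hBad : Bad ⊆ F) (hF : weight V l r F ≤ γ / 8) {z₁ z₂ : ℤ}
    {t₁ t₂ : ℕ} {xs ys : List V} (hx : Seg l r E A A₂ τ z₁ t₁ xs)
    (hy : Seg l r E A A₂ τ z₂ t₂ ys) (hxF : ∀ x ∈ xs, x ∈ F) (hyF : ∀ y ∈ ys, y ∈ F)
    (hxy : ∀ x ∈ xs, x ∉ ys) :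
    ∃ ws, Seg l r E A A₂ τ (z₁ + z₂) (t₁ + t₂ + 2) ws ∧ (∀ x ∈ xs, x ∈ ws) ∧
      (∀ x ∈ ys, x ∈ ws) ∧ ∀ x ∈ ws, x ∈ xs ∨ x ∈ ys ∨ x ∉ F := by
  obtain ⟨zs, hzs, hzF⟩ := h.join hBad hF hx hy hxF hyF hxy
  refine ⟨_, hzs, ?_, ?_, ?_⟩
  · intro x hx; simp [hx]
  · intro x hx; simp [hx]
  · intro x hx
    simp only [List.mem_append] at hx
    rcases hx with (hx | hx) | hx
    · exact Or.inl hx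
    · exact Or.inr (Or.inr (hzF x hx))
    · exact Or.inr (Or.inl hx)

end Ctx

end Setup

section Setup

variable {V : Type*} [Fintype V] [DecidableEq V]
variable {l r : ℕ} {E : Finset (Finset V)} {A Bad A₂ : Finset V} {p γ τ ε : ℝ}

lemma Seg.card_le {z : ℤ} {t : ℕ} {xs : List V} (h : Seg l r E A A₂ τ z t xs) :
    xs.toFinset.card ≤ (t + 1) * (2 * l + r + 3) := by
  refine (List.toFinset_card_le xs).trans ?_
  rw [h.length_eq]
  nlinarith

lemma length_flatMap_raw_le (rs : List (ℕ × List V))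
    (hrs : ∀ q ∈ rs, 1 ≤ q.1 ∧ Raw l r E A₂ q.1 q.2) :
    (rs.flatMap Prod.snd).length ≤ 2 * (rs.map Prod.fst).sum * (2 * l + r + 3) := by
  induction rs with
  | nil => simp
  | cons q rs ih =>
    have h1 := ih fun q hq => hrs q (List.mem_cons_of_mem _ hq)
    obtain ⟨hq1, hq2⟩ := hrs q List.mem_cons_self
    simp only [List.flatMap_cons, List.length_append, List.map_cons, List.sum_cons,
      hq2.length_eq]
    have h3 : q.1 * (l + r + 2) + (l + 1) ≤ 2 * q.1 * (2 * l + r + 3) := by nlinarith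
    calc _ ≤ _ := add_le_add h3 h1
      _ = _ := by ring

namespace Ctx

variable (h : Ctx l r E A Bad A₂ p γ τ ε)
include h

lemma absorb_all {N : ℕ} (hN : ∀ F : Finset V, F.card ≤ N → weight V l r F ≤ γ / 16)
    (raws : List (ℕ × List V)) (hraw : ∀ q ∈ raws, 1 ≤ q.1 ∧ Raw l r E A₂ q.1 q.2)
    (hdisj : raws.Pairwise fun q q' => ∀ x ∈ q.2, x ∉ q'.2) {z : ℤ} {t : ℕ} {xs : List V}
    (hx : Seg l r E A A₂ τ z t xs) (hxr : ∀ q ∈ raws, ∀ x ∈ q.2, x ∉ xs)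
    (hb : (t + 9 * (raws.map Prod.fst).sum + 10) * (2 * l + r + 3) + Bad.card ≤ N) :
    ∃ (z' : ℤ) (t' : ℕ) (ws : List V), Seg l r E A A₂ τ z' t' ws ∧
      z + (raws.map Prod.fst).sum ≤ z' ∧ t' ≤ t + 7 * (raws.map Prod.fst).sum := by
  have hγ := h.γ_pos
  induction raws generalizing z t xs with
  | nil => exact ⟨z, t, xs, hx, by simp, by simp⟩
  | cons q rest ih =>
    set σ := (rest.map Prod.fst).sum with hσ
    have hYl := length_flatMap_raw_le (q :: rest) hraw
    let Y : Finset V := ((q :: rest).flatMap Prod.snd).toFinset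
    have hYc : Y.card ≤ 2 * (q.1 + σ) * (2 * l + r + 3) := by
      refine (List.toFinset_card_le _).trans (hYl.trans ?_)
      rw [List.map_cons, List.sum_cons]
    rw [List.pairwise_cons] at hdisj
    obtain ⟨hq1, hq2⟩ := hraw q List.mem_cons_self
    let F : Finset V := xs.toFinset ∪ (Bad ∪ Y)
    have hFc : F.card ≤ (t + 1) * (2 * l + r + 3) + (Bad.card + 2 * (q.1 + σ) * (2 * l + r + 3)) :=
      (card_union_le _ _).trans (add_le_add hx.card_le ((card_union_le _ _).trans
        (Nat.add_le_add_left hYc _)))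
    have hBF : Bad ⊆ F := fun x hx => mem_union_right _ (mem_union_left _ hx)
    have hYF : Y ⊆ F := fun x hx => mem_union_right _ (mem_union_right _ hx)
    have hxF : ∀ x ∈ xs, x ∈ F := fun x hx => mem_union_left _ (List.mem_toFinset.mpr hx)
    rw [List.map_cons, List.sum_cons, ← hσ] at hb
    have hqF : ∀ x ∈ q.2, x ∈ F := fun x hx => hYF (List.mem_toFinset.mpr (by simp [hx]))
    obtain ⟨z₂, t₂, ys, hys, hz₂, ht₂, hqy, hyF⟩ := h.exists_seg_of_raw hBF
      (hN F (hFc.trans (le_trans (by nlinarith) hb))) hq2 hqF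
    have hxy : ∀ x ∈ xs, x ∉ ys := by
      intro x hx hxy
      rcases hyF x hxy with hq | hF
      · exact hxr q List.mem_cons_self x hq hx
      · exact hF (hxF x hx)
    have hFc' : (F ∪ ys.toFinset).card ≤ N := by
      refine (card_union_le _ _).trans ((add_le_add hFc hys.card_le).trans (le_trans ?_ hb))
      nlinarith
    obtain ⟨ws, hws, hxw, hyw, hw⟩ := h.absorb (hBF.trans subset_union_left)
      ((hN _ hFc').trans (by linarith)) hx hys (fun x hx => mem_union_left _ (hxF x hx))
      (fun x hx => mem_union_right _ (List.mem_toFinset.mpr hx)) hxy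
    obtain ⟨z', t', us, hus, hz', ht'⟩ := ih
      (fun q hq => hraw q (List.mem_cons_of_mem _ hq)) hdisj.2 hws (by
        intro q' hq' x hx hxw
        have hxF' : x ∈ F := hYF (List.mem_toFinset.mpr (by
          rw [List.flatMap_cons, List.mem_append, List.mem_flatMap]
          exact Or.inr ⟨q', hq', hx⟩))
        rcases hw x hxw with h1 | h1 | h1
        · exact hxr q' (List.mem_cons_of_mem _ hq') x hx h1
        · rcases hyF x h1 with h2 | h2
          · exact hdisj.1 q' hq' x h2 hx
          · exact h2 hxF'
        · exact h1 (mem_union_left _ hxF')) (by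
        exact (Nat.add_le_add_right (Nat.mul_le_mul_right _ (by omega)) _).trans hb)
    refine ⟨z', t', us, hus, ?_, ?_⟩
    · rw [List.map_cons, List.sum_cons, ← hσ, Nat.cast_add]; omega
    · rw [List.map_cons, List.sum_cons]; omega

lemma cover_all {N : ℕ} (hN : ∀ F : Finset V, F.card ≤ N → weight V l r F ≤ γ / 16) (b : ℕ)
    {z : ℤ} {t : ℕ} {xs : List V} (hx : Seg l r E A A₂ τ z t xs)
    (hbad : (Bad \ xs.toFinset).card ≤ b)
    (hb : (t + 4 * b + 10) * (2 * l + r + 3) + Bad.card ≤ N) :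
    ∃ (t' : ℕ) (ws : List V), Seg l r E A A₂ τ z t' ws ∧ t' ≤ t + 4 * b ∧ ∀ v ∈ Bad, v ∈ ws := by
  have hγ := h.γ_pos
  induction b generalizing t xs with
  | zero =>
    refine ⟨t, xs, hx, by omega, fun v hv => ?_⟩
    rw [Nat.le_zero, card_eq_zero, sdiff_eq_empty_iff_subset] at hbad
    exact List.mem_toFinset.mp (hbad hv)
  | succ b ih =>
    by_cases hne : (Bad \ xs.toFinset).Nonempty
    · obtain ⟨v, hv⟩ := hne
      rw [mem_sdiff, List.mem_toFinset] at hv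
      let F : Finset V := xs.toFinset ∪ Bad
      have hFc : F.card ≤ (t + 1) * (2 * l + r + 3) + Bad.card :=
        (card_union_le _ _).trans (Nat.add_le_add_right hx.card_le _)
      have hBF : Bad ⊆ F := subset_union_right
      have hxF : ∀ x ∈ xs, x ∈ F := fun x hx => mem_union_left _ (List.mem_toFinset.mpr hx)
      obtain ⟨ys, hys, hvy, hyF⟩ := h.exists_cover hBF
        ((hN F (hFc.trans (le_trans (by nlinarith) hb))).trans (by linarith)) v
      have hxy : ∀ x ∈ xs, x ∉ ys := by
        intro x hx hxy
        rcases hyF x hxy with rfl | hF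
        · exact hv.2 hx
        · exact hF (hxF x hx)
      have hFc' : (F ∪ ys.toFinset).card ≤ N := by
        refine (card_union_le _ _).trans ((add_le_add hFc hys.card_le).trans (le_trans ?_ hb))
        nlinarith
      obtain ⟨ws, hws, hxw, hyw, hw⟩ := h.absorb (hBF.trans subset_union_left)
        ((hN _ hFc').trans (by linarith)) hx hys (fun x hx => mem_union_left _ (hxF x hx))
        (fun x hx => mem_union_right _ (List.mem_toFinset.mpr hx)) hxy
      rw [add_zero] at hws
      have hlt : (Bad \ ws.toFinset).card < (Bad \ xs.toFinset).card := by
        refine card_lt_card ⟨fun x hx => ?_, fun hsub => ?_⟩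
        · rw [mem_sdiff, List.mem_toFinset] at hx ⊢
          exact ⟨hx.1, fun h => hx.2 (hxw x h)⟩
        · have := hsub (mem_sdiff.mpr ⟨hv.1, fun h => hv.2 (List.mem_toFinset.mp h)⟩)
          rw [mem_sdiff, List.mem_toFinset] at this
          exact this.2 (hyw v hvy)
      obtain ⟨t', us, hus, ht', hcov⟩ := ih hws (by omega) (by
        exact (Nat.add_le_add_right (Nat.mul_le_mul_right _ (by omega)) _).trans hb)
      exact ⟨t', us, hus, by omega, hcov⟩
    · rw [not_nonempty_iff_eq_empty, sdiff_eq_empty_iff_subset] at hne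
      exact ⟨t, xs, hx, by omega, fun v hv => List.mem_toFinset.mp (hne hv)⟩

lemma waste_all {N : ℕ} (hN : ∀ F : Finset V, F.card ≤ N → weight V l r F ≤ γ / 16) (b : ℕ)
    {z : ℤ} {t : ℕ} {xs : List V} (hx : Seg l r E A A₂ τ z t xs)
    (hb : (t + 3 * b + 10) * (2 * l + r + 3) + Bad.card ≤ N) :
    ∃ ws : List V, Seg l r E A A₂ τ (z - b) (t + 3 * b) ws ∧ ∀ v ∈ xs, v ∈ ws := by
  have hγ := h.γ_pos
  induction b generalizing z t xs with
  | zero => exact ⟨xs, by simpa using hx, fun v hv => hv⟩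
  | succ b ih =>
    let F : Finset V := xs.toFinset ∪ Bad
    have hFc : F.card ≤ (t + 1) * (2 * l + r + 3) + Bad.card :=
      (card_union_le _ _).trans (Nat.add_le_add_right hx.card_le _)
    have hBF : Bad ⊆ F := subset_union_right
    have hxF : ∀ x ∈ xs, x ∈ F := fun x hx => mem_union_left _ (List.mem_toFinset.mpr hx)
    obtain ⟨ys, hys, hyF⟩ := h.exists_waste hBF
      ((hN F (hFc.trans (le_trans (by nlinarith) hb))).trans (by linarith))
    have hxy : ∀ x ∈ xs, x ∉ ys := fun x hx hxy => hyF x hxy (hxF x hx)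
    have hFc' : (F ∪ ys.toFinset).card ≤ N := by
      refine (card_union_le _ _).trans ((add_le_add hFc hys.card_le).trans (le_trans ?_ hb))
      nlinarith
    obtain ⟨ws, hws, hxw, -, -⟩ := h.absorb (hBF.trans subset_union_left)
      ((hN _ hFc').trans (by linarith)) hx hys (fun x hx => mem_union_left _ (hxF x hx))
      (fun x hx => mem_union_right _ (List.mem_toFinset.mpr hx)) hxy
    obtain ⟨us, hus, hxu⟩ := ih hws (by
      exact (Nat.add_le_add_right (Nat.mul_le_mul_right _ (by omega)) _).trans hb)
    refine ⟨us, ?_, fun v hv => hxu v (hxw v hv)⟩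
    convert hus using 1
    · push_cast; ring
    · ring

/-- A short segment of prescribed value covering all exceptional vertices. -/
theorem exists_absorbing {N : ℕ}
    (hN : ∀ F : Finset V, F.card ≤ N → weight V l r F ≤ γ / 16)
    (raws : List (ℕ × List V)) (hraw : ∀ q ∈ raws, 1 ≤ q.1 ∧ Raw l r E A₂ q.1 q.2)
    (hdisj : raws.Pairwise fun q q' => ∀ x ∈ q.2, x ∉ q'.2) {D : ℤ}
    (hD : D ≤ (raws.map Prod.fst).sum) {b : ℕ} (hbD : -D ≤ b) (hbad : Bad.card ≤ b)
    (hbr : (raws.map Prod.fst).sum ≤ b)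
    (hb : 100 * (b + 1) * (2 * l + r + 3) ≤ N) :
    ∃ (t : ℕ) (xs : List V), Seg l r E A A₂ τ D t xs ∧ (∀ v ∈ Bad, v ∈ xs) ∧ t ≤ 50 * b := by
  have hγ := h.γ_pos
  set σ := (raws.map Prod.fst).sum with hσ
  let Y : Finset V := (raws.flatMap Prod.snd).toFinset
  have hYc : Y.card ≤ 2 * b * (2 * l + r + 3) :=
    (List.toFinset_card_le _).trans ((length_flatMap_raw_le raws hraw).trans (by gcongr))
  obtain ⟨xs, hx, hxF⟩ := h.exists_trivial (F := Bad ∪ Y) subset_union_left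
    ((hN _ ((card_union_le _ _).trans ((add_le_add hbad hYc).trans
      (le_trans (by nlinarith) hb)))).trans (by linarith))
  obtain ⟨z₁, t₁, ws₁, hs₁, hz₁, ht₁⟩ := h.absorb_all hN raws hraw hdisj hx (by
    intro q hq x hx hxs
    refine hxF x hxs (mem_union_right _ (List.mem_toFinset.mpr (List.mem_flatMap.mpr ⟨q, hq, hx⟩))))
    (by rw [← hσ]; nlinarith)
  obtain ⟨t₂, ws₂, hs₂, ht₂, hcov⟩ := h.cover_all hN b hs₁
    ((card_le_card sdiff_subset).trans hbad) (by
      rw [← hσ] at ht₁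
      have : t₁ + 4 * b + 10 ≤ 11 * b + 10 := by omega
      calc _ ≤ (11 * b + 10) * (2 * l + r + 3) + b := by gcongr
        _ ≤ N := by nlinarith)
  have hle := hs₂.le
  rw [← hσ] at hz₁ ht₁
  obtain ⟨w, hw⟩ := Int.eq_ofNat_of_zero_le (show 0 ≤ z₁ - D by omega)
  have hwb : w ≤ 12 * b := by omega
  obtain ⟨ws₃, hs₃, hsub⟩ := h.waste_all hN w hs₂ (by
    have : t₂ + 3 * w + 10 ≤ 47 * b + 10 := by omega
    calc _ ≤ (47 * b + 10) * (2 * l + r + 3) + b := by gcongr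
      _ ≤ N := by nlinarith)
  refine ⟨_, ws₃, ?_, fun v hv => hsub v (hcov v hv), (by omega : t₂ + 3 * w ≤ 50 * b)⟩
  rwa [show z₁ - (w : ℤ) = D by omega] at hs₃

end Ctx

end Setup

lemma frac_eval_eq_and_le {Ω κ J : Type*} [Finite Ω] [Finite κ] [DecidableEq κ] [Finite J]
    (P : Set (Ω × (κ → J))) (c : κ) (v : J) :
    frac {q : Ω × (κ → J) | q.2 c = v ∧ q ∈ P} ≤
      frac {q : Ω × (κ → J) | (q.1, Function.update q.2 c v) ∈ P} / Nat.card J := by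
  unfold frac
  rw [div_div, mul_comm, ← div_div]
  gcongr
  have : Nonempty J := ⟨v⟩
  rw [le_div_iff₀ (by exact_mod_cast Nat.card_pos)]
  rw [← Set.ncard_univ, ← Nat.cast_mul, ← Set.ncard_prod]
  norm_cast
  refine Set.ncard_le_ncard_of_injOn (fun x => (x.1.1, Function.update x.1.2 c x.2)) ?_ ?_
    (Set.toFinite _)
  · rintro ⟨⟨ω, y⟩, x⟩ ⟨⟨h1, h2⟩, -⟩
    simp only at h1
    subst h1
    simpa using h2
  · rintro ⟨⟨ω, y⟩, x⟩ ⟨⟨h1, h2⟩, -⟩ ⟨⟨ω', y'⟩, x'⟩ ⟨⟨h1', h2'⟩, -⟩ heq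
    simp only [Prod.mk.injEq] at heq h1 h1' ⊢
    refine ⟨⟨heq.1, ?_⟩, by simpa using congrFun heq.2 c⟩
    funext i
    by_cases hi : i = c
    · rw [hi, h1, h1']
    · simpa [hi] using congrFun heq.2 i

lemma frac_eval_eq_and_le' {Ω Ω' κ J : Type*} [Finite Ω] [Finite Ω'] [Finite κ] [DecidableEq κ]
    [Finite J] (Q : Set (Ω × Ω' × (κ → J))) (c : κ) (v : J) :
    frac {p : Ω × Ω' × (κ → J) | p.2.2 c = v ∧ p ∈ Q} ≤
      frac {p : Ω × Ω' × (κ → J) | (p.1, p.2.1, Function.update p.2.2 c v) ∈ Q} / Nat.card J := by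
  have h := frac_eval_eq_and_le (Equiv.prodAssoc Ω Ω' (κ → J) ⁻¹' Q) c v
  rw [← frac_preimage_equiv (Equiv.prodAssoc Ω Ω' (κ → J)),
    ← frac_preimage_equiv (Equiv.prodAssoc Ω Ω' (κ → J))]
  exact h

section Setup

variable {V : Type*} [Fintype V] [DecidableEq V]
variable {l r : ℕ} {E : Finset (Finset V)} {A : Finset V} {τ : ℝ}

lemma frac_slot_le [Nonempty V] {ι : Type*} [Fintype ι] [DecidableEq ι] {D : Fin (l + 1) → V}
    (hD : Typ r E A τ D)
    {e : Fin (r + 1) ⊕ Fin l → ι} (he : Function.Injective e) (c : ι) {w : V}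
    (hw : neA E A (insert w (im D)) (Fin l ⊕ Fin r) ≤ τ) :
    frac {q : V × (ι → V) | q.1 ∈ A ∧ (∀ i ≠ c, q.2 i ∉ A) ∧
      insert q.1 (im D ∪ im (Function.update q.2 c w ∘ e)) ∉ E} ≤ τ := by
  by_cases hc : c ∈ Set.range e
  · obtain ⟨c₀, rfl⟩ := hc
    let f : {x // x ≠ c₀} → ι := fun x => e x
    have hf : Function.Injective f := fun x y hxy => Subtype.ext (he hxy)
    have hcard : Fintype.card {x // x ≠ c₀} = Fintype.card (Fin l ⊕ Fin r) := by
      rw [Fintype.card_subtype_compl]; simp; omega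
    rw [neA_congr (Fintype.equivOfCardEq hcard.symm)] at hw
    unfold neA at hw
    rw [← frac_pair_comp hf] at hw
    refine (frac_mono ?_).trans hw
    rintro ⟨a, y⟩ ⟨h1, h2, h3⟩
    refine ⟨h1, fun i => h2 _ fun hi => i.2 (he hi), ?_⟩
    have : im (Function.update y (e c₀) w ∘ e) = insert w (im (y ∘ f)) := by
      ext x
      simp only [mem_im, Function.comp_apply, mem_insert, f, Subtype.exists]
      constructor
      · rintro ⟨i, rfl⟩
        by_cases hi : i = c₀
        · left; simp [hi]
        · right; exact ⟨i, hi, by simp [he.ne hi]⟩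
      · rintro (rfl | ⟨i, hi, rfl⟩)
        · exact ⟨c₀, by simp⟩
        · exact ⟨i, by simp [he.ne hi]⟩
    rw [this, union_insert, ← insert_union] at h3
    exact h3
  · refine (frac_mono ?_).trans ((frac_pair_comp he _).trans_le hD)
    rintro ⟨a, y⟩ ⟨h1, h2, h3⟩
    have hne : ∀ i, e i ≠ c := fun i hi => hc ⟨i, hi⟩
    refine ⟨h1, fun i => h2 _ (hne i), ?_⟩
    have : Function.update y c w ∘ e = y ∘ e := by
      funext i; simp [hne i]
    rw [this] at h3
    exact h3

lemma Walk.chain {s t : ℕ} (D : Fin (s + 1) → Fin (l + 1) → V) (us : Fin s → List V)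
    (h : ∀ j, Walk r E t (D j.castSucc) (D j.succ) (us j)) :
    Walk r E (t * s) (D 0) (D (Fin.last s)) (List.ofFn us).flatten := by
  induction s with
  | zero => simpa using Walk.nil (r := r) (E := E) (D 0)
  | succ s ih =>
    have h1 := ih (fun j => D j.castSucc) (fun j => us j.castSucc) fun j => h j.castSucc
    have h2 := h1.append (h (Fin.last s))
    rw [List.ofFn_succ', List.concat_eq_append, List.flatten_append, List.flatten_singleton]
    exact h2

end Setup

section Setup

variable {V : Type*} [Fintype V] [DecidableEq V]
variable {l r : ℕ} {E : Finset (Finset V)} {A : Finset V} {τ : ℝ}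

lemma frac_preimage_tuple_le {κ J : Type*} [Fintype κ] [Finite J] [Nonempty J] {β : κ → J → V}
    (hβ : ∀ c, Function.Injective (β c)) {Λ : ℝ} (hn : (Nat.card V : ℝ) ≤ Λ * Nat.card J)
    (s : Set (κ → V)) :
    frac {v : κ → J | (fun c => β c (v c)) ∈ s} ≤ Λ ^ Fintype.card κ * frac s := by
  have hf : Function.Injective fun v : κ → J => fun c => β c (v c) := fun v v' h =>
    funext fun c => hβ c (congrFun h c)
  refine (frac_preimage_le_of_injective hf s).trans ?_
  have hJ : (0 : ℝ) < Nat.card J := by exact_mod_cast Nat.card_pos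
  have := frac_nonneg s
  gcongr
  rw [Nat.card_fun, Nat.card_fun, Nat.card_eq_fintype_card (α := κ), Nat.cast_pow, Nat.cast_pow,
    ← div_pow]
  gcongr
  rwa [div_le_iff₀ hJ]

lemma frac_preimage_pair_le {κ J : Type*} [Fintype κ] [Finite J] [Nonempty J] {α : J → V}
    (hα : Function.Injective α) {β : κ → J → V}
    (hβ : ∀ c, Function.Injective (β c)) {Λ : ℝ} (hn : (Nat.card V : ℝ) ≤ Λ * Nat.card J)
    (s : Set (V × (κ → V))) :
    frac {p : J × (κ → J) | (α p.1, fun c => β c (p.2 c)) ∈ s} ≤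
      Λ ^ (Fintype.card κ + 1) * frac s := by
  have hf : Function.Injective fun p : J × (κ → J) => (α p.1, fun c => β c (p.2 c)) := by
    rintro ⟨a, v⟩ ⟨a', v'⟩ h
    simp only [Prod.mk.injEq] at h
    exact Prod.ext (hα h.1) (funext fun c => hβ c (congrFun h.2 c))
  refine (frac_preimage_le_of_injective hf s).trans ?_
  have hJ : (0 : ℝ) < Nat.card J := by exact_mod_cast Nat.card_pos
  have := frac_nonneg s
  gcongr
  rw [Nat.card_prod, Nat.card_prod, Nat.card_fun, Nat.card_fun,
    Nat.card_eq_fintype_card (α := κ), Nat.cast_mul, Nat.cast_mul, Nat.cast_pow, Nat.cast_pow,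
    ← pow_succ', ← pow_succ', ← div_pow]
  gcongr
  rwa [div_le_iff₀ hJ]

/-- Simultaneous choice of the vertices between consecutive tuples. -/
lemma exists_linking {κ J : Type*} [Fintype κ] [Fintype J] [Nonempty J]
    {e₀ e₁ : Fin (r + 1) ⊕ Fin l → κ} (he₀ : Function.Injective e₀) (he₁ : Function.Injective e₁)
    {D₀ D₁ : J → Fin (l + 1) → V} (hD₀ : ∀ j, Typ r E A τ (D₀ j)) (hD₁ : ∀ j, Typ r E A τ (D₁ j))
    {α : J → V} (hα : Function.Injective α) (hαA : ∀ j, α j ∈ A)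
    {β : κ → J → V} (hβ : ∀ c, Function.Injective (β c)) (hβA : ∀ c j, β c j ∉ A) {b Λ δ : ℝ}
    (hαb : ∀ i, ({j | ¬ (neB E A (insert (α i) (im (D₀ j))) (Fin l ⊕ Fin (r + 1)) ≤ τ ∧
      neB E A (insert (α i) (im (D₁ j))) (Fin l ⊕ Fin (r + 1)) ≤ τ)}.ncard : ℝ) ≤ b)
    (hβb : ∀ c i, ({j | ¬ (neA E A (insert (β c i) (im (D₀ j))) (Fin l ⊕ Fin r) ≤ τ ∧
      neA E A (insert (β c i) (im (D₁ j))) (Fin l ⊕ Fin r) ≤ τ)}.ncard : ℝ) ≤ b)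
    (hΛ : 1 ≤ Λ) (hn : (Nat.card V : ℝ) ≤ Λ * Nat.card J) (hτ : 0 ≤ τ)
    (hδ : Λ ^ (Fintype.card κ + 1) * (2 * τ) + b / Nat.card J ≤ δ)
    (hcond : (Fintype.card κ + 2) * δ + (Fintype.card κ + 2 : ℝ) ^ 2 / Nat.card J < 1) :
    ∃ (ρ : Equiv.Perm J) (σ : κ → Equiv.Perm J), ∀ j,
      insert (α (ρ j)) (im (D₀ j) ∪ im ((fun c => β c (σ c j)) ∘ e₀)) ∈ E ∧
      insert (α (ρ j)) (im (D₁ j) ∪ im ((fun c => β c (σ c j)) ∘ e₁)) ∈ E := by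
  classical
  have hV : Nonempty V := ⟨α (Classical.arbitrary J)⟩
  let G : J → J → (κ → J) → Prop := fun j a v =>
    insert (α a) (im (D₀ j) ∪ im ((fun c => β c (v c)) ∘ e₀)) ∈ E ∧
    insert (α a) (im (D₁ j) ∪ im ((fun c => β c (v c)) ∘ e₁)) ∈ E
  have hJ : (0 : ℝ) < Nat.card J := by exact_mod_cast Nat.card_pos
  have hb : 0 ≤ b := (Nat.cast_nonneg _).trans (hαb (Classical.arbitrary J))
  have hbJ : 0 ≤ b / Nat.card J := by positivity
  have hΛκ : 0 ≤ Λ ^ (Fintype.card κ + 1) * (2 * τ) := by positivity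
  refine exists_assignment G (δ := δ) (by linarith) hcond ?_ ?_ ?_
  · intro j
    let N : Set (V × (κ → V)) := {q | (q.1, q.2 ∘ e₀) ∈ {q : V × (Fin (r + 1) ⊕ Fin l → V) |
        q.1 ∈ A ∧ (∀ i, q.2 i ∉ A) ∧ insert q.1 (im (D₀ j) ∪ im q.2) ∉ E}} ∪
      {q | (q.1, q.2 ∘ e₁) ∈ {q : V × (Fin (r + 1) ⊕ Fin l → V) |
        q.1 ∈ A ∧ (∀ i, q.2 i ∉ A) ∧ insert q.1 (im (D₁ j) ∪ im q.2) ∉ E}}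
    have h1 : frac N ≤ 2 * τ := by
      refine (frac_union_le _ _).trans ?_
      rw [frac_pair_comp he₀, frac_pair_comp he₁]
      have h2 := hD₀ j
      have h3 := hD₁ j
      unfold Typ neA at h2 h3
      linarith
    have h2 := frac_preimage_pair_le hα hβ hn N
    have h3 : {p : J × (κ → J) | ¬ G j p.1 p.2} ⊆
        {p : J × (κ → J) | (α p.1, fun c => β c (p.2 c)) ∈ N} := by
      rintro ⟨a, v⟩ hp
      rcases not_and_or.mp hp with hp | hp
      · exact Or.inl ⟨hαA a, fun i => hβA _ _, hp⟩
      · exact Or.inr ⟨hαA a, fun i => hβA _ _, hp⟩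
    calc _ ≤ _ := frac_mono h3
      _ ≤ _ := h2
      _ ≤ Λ ^ (Fintype.card κ + 1) * (2 * τ) := by gcongr
      _ ≤ δ := by linarith
  · intro a
    let z : Set J := {j | ¬ (neB E A (insert (α a) (im (D₀ j))) (Fin l ⊕ Fin (r + 1)) ≤ τ ∧
      neB E A (insert (α a) (im (D₁ j))) (Fin l ⊕ Fin (r + 1)) ≤ τ)}
    have hz : frac z ≤ b / Nat.card J := by unfold frac; gcongr; exact hαb a
    have key := frac_le_of_fiber (s := {p : J × (κ → J) | ¬ G p.1 a p.2})
      (t := (∅ : Set (J × J))) (z := z) (C := 0) (D := Λ ^ Fintype.card κ * (2 * τ)) le_rfl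
      (by positivity) ?_
    · have h1 : Λ ^ Fintype.card κ ≤ Λ ^ (Fintype.card κ + 1) := by gcongr; omega
      have h2 : Λ ^ Fintype.card κ * (2 * τ) ≤ Λ ^ (Fintype.card κ + 1) * (2 * τ) := by gcongr
      linarith
    · intro j hj
      simp only [z, Set.mem_ofPred_eq, not_not] at hj
      let N : Set (κ → V) := {y | y ∘ e₀ ∈ {y : Fin (r + 1) ⊕ Fin l → V | (∀ i, y i ∉ A) ∧
          insert (α a) (im (D₀ j)) ∪ im y ∉ E}} ∪
        {y | y ∘ e₁ ∈ {y : Fin (r + 1) ⊕ Fin l → V | (∀ i, y i ∉ A) ∧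
          insert (α a) (im (D₁ j)) ∪ im y ∉ E}}
      have h1 : frac N ≤ 2 * τ := by
        refine (frac_union_le _ _).trans ?_
        rw [frac_comp he₀, frac_comp he₁]
        have h2 := hj.1
        have h3 := hj.2
        rw [neB_congr (Equiv.sumComm _ _)] at h2 h3
        unfold neB at h2 h3
        linarith
      have h2 := frac_preimage_tuple_le hβ hn N
      have h3 : {v : κ → J | (j, v) ∈ {p : J × (κ → J) | ¬ G p.1 a p.2}} ⊆
          {v : κ → J | (fun c => β c (v c)) ∈ N} := by
        intro v hp
        rcases not_and_or.mp hp with hp | hp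
        · rw [← insert_union] at hp
          exact Or.inl ⟨fun i => hβA _ _, hp⟩
        · rw [← insert_union] at hp
          exact Or.inr ⟨fun i => hβA _ _, hp⟩
      simp only [zero_mul, zero_add]
      calc _ ≤ _ := frac_mono h3
        _ ≤ _ := h2
        _ ≤ Λ ^ (Fintype.card κ) * (2 * τ) := by gcongr
  · intro c v
    refine (frac_eval_eq_and_le' {p : J × J × (κ → J) | ¬ G p.1 p.2.1 p.2.2} c v).trans ?_
    gcongr
    let z : Set J := {j | ¬ (neA E A (insert (β c v) (im (D₀ j))) (Fin l ⊕ Fin r) ≤ τ ∧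
      neA E A (insert (β c v) (im (D₁ j))) (Fin l ⊕ Fin r) ≤ τ)}
    have hz : frac z ≤ b / Nat.card J := by unfold frac; gcongr; exact hβb c v
    have key := frac_le_of_fiber
      (s := {p : J × J × (κ → J) | (p.1, p.2.1, Function.update p.2.2 c v) ∈
        {p : J × J × (κ → J) | ¬ G p.1 p.2.1 p.2.2}})
      (t := (∅ : Set (J × J))) (z := z) (C := 0) (D := Λ ^ (Fintype.card κ + 1) * (2 * τ)) le_rfl
      (by positivity) ?_
    · linarith
    · intro j hj
      simp only [z, Set.mem_ofPred_eq, not_not] at hj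
      let N : Set (V × (κ → V)) := {q | q.1 ∈ A ∧ (∀ i ≠ c, q.2 i ∉ A) ∧
          insert q.1 (im (D₀ j) ∪ im (Function.update q.2 c (β c v) ∘ e₀)) ∉ E} ∪
        {q | q.1 ∈ A ∧ (∀ i ≠ c, q.2 i ∉ A) ∧
          insert q.1 (im (D₁ j) ∪ im (Function.update q.2 c (β c v) ∘ e₁)) ∉ E}
      have h1 : frac N ≤ 2 * τ := by
        refine (frac_union_le _ _).trans ?_
        have h2 := frac_slot_le (hD₀ j) he₀ c hj.1
        have h3 := frac_slot_le (hD₁ j) he₁ c hj.2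
        linarith
      have h2 := frac_preimage_pair_le hα hβ hn N
      have h3 : {q : J × (κ → J) | (j, q) ∈
          {p : J × J × (κ → J) | (p.1, p.2.1, Function.update p.2.2 c v) ∈
            {p : J × J × (κ → J) | ¬ G p.1 p.2.1 p.2.2}}} ⊆
          {p : J × (κ → J) | (α p.1, fun c => β c (p.2 c)) ∈ N} := by
        rintro ⟨a, u⟩ hp
        have hu : (fun c' => β c' (Function.update u c v c')) =
            Function.update (fun c' => β c' (u c')) c (β c v) := by
          funext c'
          by_cases hc : c' = c
          · subst hc; simp
          · simp [hc]
        rcases not_and_or.mp hp with hp | hp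
        · rw [hu] at hp
          exact Or.inl ⟨hαA a, fun i _ => hβA _ _, hp⟩
        · rw [hu] at hp
          exact Or.inr ⟨hαA a, fun i _ => hβA _ _, hp⟩
      simp only [zero_mul, zero_add]
      calc _ ≤ _ := frac_mono h3
        _ ≤ _ := h2
        _ ≤ Λ ^ (Fintype.card κ + 1) * (2 * τ) := by gcongr

end Setup

section Setup

variable {V : Type*} [Fintype V] [DecidableEq V]
variable {l r : ℕ} {E : Finset (Finset V)} {A Bad A₂ : Finset V} {p γ τ ε : ℝ}

lemma frac_heavy_neB_le {κ ι : Type*} [Fintype κ] [Fintype ι] {T : Finset V} {t η : ℝ}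
    (ht : 0 < t) (h : neB E A T (κ ⊕ ι) ≤ η) :
    frac {C : κ → V | (∀ i, C i ∉ A) ∧ t < neB E A (T ∪ im C) ι} ≤ η / t := by
  let s : Set ((κ → V) × (ι → V)) :=
    {q | (∀ i, q.1 i ∉ A) ∧ (∀ i, q.2 i ∉ A) ∧ T ∪ im q.1 ∪ im q.2 ∉ E}
  have h1 : frac s ≤ η := by
    refine le_trans ?_ h
    unfold neB
    rw [← frac_preimage_equiv (Equiv.sumArrowEquivProdArrow κ ι V)]
    refine frac_mono ?_
    rintro y ⟨h1, h2, h3⟩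
    refine ⟨?_, ?_⟩
    · rintro (i | i)
      · exact h1 i
      · exact h2 i
    · rw [im_sum, ← union_assoc]; exact h3
  calc _ ≤ frac {C | t < frac {y | (C, y) ∈ s}} := by
        refine frac_mono ?_
        rintro C ⟨h1, h2⟩
        refine h2.trans_le (frac_mono ?_)
        rintro y ⟨h3, h4⟩
        exact ⟨h1, h3, h4⟩
    _ ≤ frac s / t := frac_heavy_le ht
    _ ≤ η / t := by gcongr

lemma frac_heavy_neA_le {κ ι : Type*} [Fintype κ] [Fintype ι] {T : Finset V} {t η : ℝ}
    (ht : 0 < t) (h : neA E A T (κ ⊕ ι) ≤ η) :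
    frac {C : κ → V | (∀ i, C i ∉ A) ∧ t < neA E A (T ∪ im C) ι} ≤ η / t := by
  let s : Set ((κ → V) × (V × (ι → V))) :=
    {q | (∀ i, q.1 i ∉ A) ∧ q.2.1 ∈ A ∧ (∀ i, q.2.2 i ∉ A) ∧
      insert q.2.1 (T ∪ im q.1 ∪ im q.2.2) ∉ E}
  let f : V × (κ ⊕ ι → V) ≃ (κ → V) × (V × (ι → V)) :=
    { toFun := fun q => (q.2 ∘ Sum.inl, (q.1, q.2 ∘ Sum.inr))
      invFun := fun q => (q.2.1, Sum.elim q.1 q.2.2)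
      left_inv := fun q => by simp
      right_inv := fun q => by simp }
  have h1 : frac s ≤ η := by
    refine le_trans ?_ h
    unfold neA
    rw [← frac_preimage_equiv f]
    refine frac_mono ?_
    rintro ⟨a, y⟩ ⟨h1, h2, h3, h4⟩
    refine ⟨h2, ?_, ?_⟩
    · rintro (i | i)
      · exact h1 i
      · exact h3 i
    · rw [im_sum, ← union_assoc]; exact h4
  calc _ ≤ frac {C | t < frac {y | (C, y) ∈ s}} := by
        refine frac_mono ?_
        rintro C ⟨h1, h2⟩
        refine h2.trans_le (frac_mono ?_)
        rintro y ⟨h3, h4, h5⟩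
        exact ⟨h1, h3, h4, h5⟩
    _ ≤ frac s / t := frac_heavy_le ht
    _ ≤ η / t := by gcongr

namespace Ctx

variable (h : Ctx l r E A Bad A₂ p γ τ ε)
include h

/-- Typical disjoint tuples such that every vertex combines well with almost all of them. -/
lemma exists_connectors {X : Finset V} (hAX : A ⊆ X) {s : ℕ} {Λ q θ : ℝ} (hΛ : 1 ≤ Λ)
    (hX : (Nat.card V : ℝ) ≤ Λ * (Nat.card V - X.card - s * (l + 1 : ℕ))) (hq : 0 < q)
    (hqΛ : 3 * q * Λ ^ (l + 1) ≤ 1) (hγq : γ / 8 ≤ q)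
    (hnq : ((l + 1 : ℕ) : ℝ) ^ 2 / Nat.card V ≤ q) (hθ : ε / τ / q ≤ θ)
    (hlog : Real.log (Nat.card V) ≤ θ * s) :
    ∃ c : Fin s → Fin (l + 1) → V, (∀ j, Typ r E A τ (c j)) ∧
      Function.Injective (Function.uncurry c) ∧ (∀ j i, c j i ∉ X) ∧
      (∀ a ∈ A, a ∉ Bad →
        ({j | ¬ neB E A (insert a (im (c j))) (Fin l ⊕ Fin (r + 1)) ≤ τ}.ncard : ℝ) ≤
          4 * θ * s) ∧
      (∀ w ∉ A, w ∉ Bad →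
        ({j | ¬ neA E A (insert w (im (c j))) (Fin l ⊕ Fin r) ≤ τ}.ncard : ℝ) ≤
          4 * θ * s) := by
  have := h.nonempty
  have hτ := h.τ_pos
  have hε := h.ε_pos
  have hV : (0 : ℝ) < Nat.card V := by exact_mod_cast Nat.card_pos
  let bad : V → Set (Fin (l + 1) → V) := fun w => {C | w ∉ Bad ∧ (∀ i, C i ∉ A) ∧
    (w ∈ A → τ < neB E A (insert w (im C)) (Fin l ⊕ Fin (r + 1))) ∧
    (w ∉ A → τ < neA E A (insert w (im C)) (Fin l ⊕ Fin r))}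
  have hbad : ∀ w, frac (bad w) ≤ ε / τ := by
    intro w
    by_cases hw : w ∈ Bad
    · have : bad w = ∅ := by
        ext C; simp [bad, hw]
      rw [this, frac_empty]; positivity
    · by_cases hwA : w ∈ A
      · have h1 := h.neB_le w hwA hw (Fin (l + 1) ⊕ (Fin l ⊕ Fin (r + 1))) (by simp; omega)
        refine le_trans (frac_mono ?_) (frac_heavy_neB_le hτ h1)
        rintro C ⟨-, h2, h3, -⟩
        have h3 := h3 hwA
        rw [insert_eq] at h3
        exact ⟨h2, h3⟩
      · have h1 := h.neA_le w (h.notMem_A₂ w hwA hw) (Fin (l + 1) ⊕ (Fin l ⊕ Fin r))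
          (by simp; omega)
        refine le_trans (frac_mono ?_) (frac_heavy_neA_le hτ h1)
        rintro C ⟨-, h2, -, h3⟩
        have h3 := h3 hwA
        rw [insert_eq] at h3
        exact ⟨h2, h3⟩
  let ok : ∀ i : ℕ, (Fin i → Fin (l + 1) → V) → Prop := fun i c => (∀ j, Typ r E A τ (c j)) ∧
    Function.Injective (Function.uncurry c) ∧ (∀ j a, c j a ∉ X)
  have hstep : ∀ i < s, ∀ c : Fin i → Fin (l + 1) → V, ok i c →
      q ≤ frac {x | ok (i + 1) (Fin.cons (α := fun _ => Fin (l + 1) → V) x c)} := by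
    rintro i hi c ⟨hc1, hc2, hc3⟩
    let U : Finset V := Finset.univ.image (Function.uncurry c)
    have hU : U.card ≤ i * (l + 1) := by
      refine Finset.card_image_le.trans ?_
      simp
    have hUX : ((X ∪ U).card : ℝ) ≤ X.card + s * (l + 1 : ℕ) := by
      have h1 := Finset.card_union_le X U
      have h2 : i * (l + 1) ≤ s * (l + 1) := Nat.mul_le_mul_right _ hi.le
      exact_mod_cast h1.trans (by omega)
    have hsub : {x : Fin (l + 1) → V | ∀ a, x a ∉ X ∪ U} ⊆
        {x | ok (i + 1) (Fin.cons (α := fun _ => Fin (l + 1) → V) x c)} ∪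
        ({x : Fin (l + 1) → V | (∀ i, x i ∉ A) ∧ ¬ Typ r E A τ x} ∪
          {x : Fin (l + 1) → V | ¬ Function.Injective x}) := by
      intro x hx
      have hxX : ∀ a, x a ∉ X := fun a ha => hx a (mem_union_left _ ha)
      have hxU : ∀ a, x a ∉ U := fun a ha => hx a (mem_union_right _ ha)
      by_cases hT : Typ r E A τ x
      · by_cases hI : Function.Injective x
        · left
          refine ⟨Fin.cases hT hc1, ?_, Fin.cases hxX hc3⟩
          have hxc : ∀ a j b, x a ≠ c j b := fun a j b hab =>
            hxU a (Finset.mem_image.mpr ⟨(j, b), mem_univ _, hab.symm⟩)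
          rintro ⟨j, a⟩ ⟨j', a'⟩ hj
          simp only [Function.uncurry] at hj
          induction j using Fin.cases with
          | zero =>
            induction j' using Fin.cases with
            | zero => rw [hI hj]
            | succ j' => exact absurd hj (hxc _ _ _)
          | succ j =>
            induction j' using Fin.cases with
            | zero => exact absurd hj.symm (hxc _ _ _)
            | succ j' =>
              have := hc2 (a₁ := (j, a)) (a₂ := (j', a')) hj
              simp only [Prod.mk.injEq] at this
              rw [this.1, this.2]
        · exact Or.inr (Or.inr hI)
      · exact Or.inr (Or.inl ⟨fun i hi => hxX i (hAX hi), hT⟩)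
    have h1 := frac_le_add hsub
    have h2 := frac_union_le {x : Fin (l + 1) → V | (∀ i, x i ∉ A) ∧ ¬ Typ r E A τ x}
      {x : Fin (l + 1) → V | ¬ Function.Injective x}
    have h3 := h.not_typ_le
    have h4 := frac_not_injective_le (V := V) (ι := Fin (l + 1))
    rw [Fintype.card_fin] at h4
    have h5 : 1 ≤ Λ * frac (((X ∪ U : Finset V) : Set V)ᶜ) := by
      rw [frac_compl]
      unfold frac
      rw [Set.ncard_coe_finset, one_sub_div hV.ne', mul_div_assoc', le_div_iff₀ hV, one_mul]
      exact hX.trans (mul_le_mul_of_nonneg_left (by linarith) (by linarith))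
    have h6 : 3 * q ≤ frac {x : Fin (l + 1) → V | ∀ a, x a ∉ X ∪ U} := by
      rw [frac_outside_pow, Fintype.card_fin]
      have h7 : 1 ≤ (Λ * frac (((X ∪ U : Finset V) : Set V)ᶜ)) ^ (l + 1) := one_le_pow₀ h5
      rw [mul_pow] at h7
      have h8 : 0 < Λ ^ (l + 1) := by positivity
      by_contra! h9
      have := mul_lt_mul_of_pos_right h9 h8
      linarith
    linarith
  obtain ⟨c, ⟨hc1, hc2, hc3⟩, hc4⟩ := exists_balanced_sequence (bad := bad) hq
    (by positivity : 0 ≤ ε / τ) hbad ok (s := s)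
    (fun c => ⟨fun j => j.elim0, fun j => j.1.elim0, fun j => j.elim0⟩) hstep
  have hθ0 : 0 ≤ θ := le_trans (by positivity) hθ
  have hcnt : ∀ w, ({j | c j ∈ bad w}.ncard : ℝ) ≤ 4 * θ * s := by
    intro w
    refine ncard_le_of_two_pow_le hθ0 (N := Nat.card V) Nat.card_pos ((hc4 w).trans ?_) hlog
    gcongr
  have hcA : ∀ j i, c j i ∉ A := fun j i hi => hc3 j i (hAX hi)
  refine ⟨c, hc1, hc2, hc3, fun a ha haB => le_trans ?_ (hcnt a),
    fun w hw hwB => le_trans ?_ (hcnt w)⟩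
  · rw [Nat.cast_le]
    refine Set.ncard_le_ncard (fun j hj => ?_) (Set.toFinite _)
    exact ⟨haB, hcA j, fun _ => not_le.mp hj, fun h => absurd ha h⟩
  · rw [Nat.cast_le]
    refine Set.ncard_le_ncard (fun j hj => ?_) (Set.toFinite _)
    exact ⟨hwB, hcA j, fun h => absurd h hw, fun _ => not_le.mp hj⟩

end Ctx

end Setup

lemma ncard_cons_snoc_le {X : Type*} {s : ℕ} (P : X → Prop) (S T : X) (c : Fin s → X) {b : ℝ}
    (hb : ({j | ¬ P (c j)}.ncard : ℝ) ≤ b) :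
    ({j : Fin (s + 1) | ¬ (P (Fin.cons (α := fun _ => X) T c j) ∧
      P (Fin.snoc (α := fun _ => X) c S j))}.ncard : ℝ) ≤ 2 * b + 2 := by
  have h1 : {j : Fin (s + 1) | ¬ (P (Fin.cons (α := fun _ => X) T c j) ∧
      P (Fin.snoc (α := fun _ => X) c S j))} ⊆
      ({0} ∪ Fin.succ '' {j | ¬ P (c j)}) ∪ ({Fin.last s} ∪ Fin.castSucc '' {j | ¬ P (c j)}) := by
    intro j hj
    rcases not_and_or.mp hj with hj | hj
    · left
      induction j using Fin.cases with
      | zero => exact Or.inl rfl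
      | succ j => exact Or.inr ⟨j, by simpa using hj, rfl⟩
    · right
      induction j using Fin.lastCases with
      | last => exact Or.inl rfl
      | cast j => exact Or.inr ⟨j, by simpa using hj, rfl⟩
  have h2 := Set.ncard_le_ncard h1 (Set.toFinite _)
  have h3 := Set.ncard_union_le ({0} ∪ Fin.succ '' {j | ¬ P (c j)})
    ({Fin.last s} ∪ Fin.castSucc '' {j | ¬ P (c j)})
  have h4 := Set.ncard_union_le {0} (Fin.succ '' {j | ¬ P (c j)})
  have h5 := Set.ncard_union_le {Fin.last s} (Fin.castSucc '' {j | ¬ P (c j)})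
  have h6 := Set.ncard_image_le (f := Fin.succ) (Set.toFinite {j | ¬ P (c j)})
  have h7 := Set.ncard_image_le (f := Fin.castSucc) (Set.toFinite {j | ¬ P (c j)})
  rw [Set.ncard_singleton] at h4 h5
  have h8 : ({j : Fin (s + 1) | ¬ (P (Fin.cons (α := fun _ => X) T c j) ∧
      P (Fin.snoc (α := fun _ => X) c S j))}.ncard : ℝ) ≤ 2 * ({j | ¬ P (c j)}.ncard : ℝ) + 2 := by
    exact_mod_cast (by omega)
  linarith

lemma exists_equiv_fin_prod {V κ : Type*} [Fintype κ] {s : ℕ} (X : Finset V)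
    (hX : X.card = Fintype.card κ * s) :
    ∃ β : κ → Fin s → V, Function.Injective (Function.uncurry β) ∧ (∀ c j, β c j ∈ X) ∧
      ∀ v ∈ X, ∃ c j, β c j = v := by
  have e : κ × Fin s ≃ X := Fintype.equivOfCardEq (by simp [hX])
  refine ⟨fun c j => e (c, j), ?_, fun c j => (e _).2, fun v hv => ?_⟩
  · rintro ⟨c, j⟩ ⟨c', j'⟩ hcj
    exact e.injective (Subtype.ext hcj)
  · exact ⟨(e.symm ⟨v, hv⟩).1, (e.symm ⟨v, hv⟩).2, by simp⟩

section Setup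

variable {V : Type*} [Fintype V] [DecidableEq V]
variable {l r : ℕ} {E : Finset (Finset V)} {A Bad A₂ : Finset V} {p γ τ ε : ℝ}

lemma Walk.double {D₀ D₁ : Fin (l + 1) → V} {a : V}
    {y : Fin (r + 1) ⊕ Fin l ⊕ Fin (r + 1) → V}
    (h₀ : insert a (im D₀ ∪ im (y ∘ Sum.map id Sum.inl)) ∈ E)
    (h₁ : insert a (im D₁ ∪ im (y ∘ fun c : Fin (r + 1) ⊕ Fin l => Sum.inr c.swap)) ∈ E) :
    ∃ vs, Walk r E 2 D₀ D₁ vs ∧ a ∈ vs ∧ (∀ i, D₀ i ∈ vs) ∧ ∀ i, y i ∈ vs := by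
  have i₀ : im (y ∘ Sum.map id Sum.inl) = im (y ∘ Sum.inl) ∪ im (y ∘ Sum.inr ∘ Sum.inl) := by
    rw [im_sum]; rfl
  have i₁ : im (y ∘ fun c : Fin (r + 1) ⊕ Fin l => Sum.inr c.swap) =
      im (y ∘ Sum.inr ∘ Sum.inr) ∪ im (y ∘ Sum.inr ∘ Sum.inl) := by
    rw [im_sum]; rfl
  rw [i₀] at h₀
  rw [i₁] at h₁
  have w₀ : Walk r E 1 D₀ (Fin.cons (α := fun _ => V) a (y ∘ Sum.inr ∘ Sum.inl)) _ :=
    Walk.single (M := y ∘ Sum.inl) (by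
      rw [im_cons]; convert h₀ using 1
      rw [union_insert, union_assoc])
  have w₁ : Walk r E 1 (Fin.cons (α := fun _ => V) a (y ∘ Sum.inr ∘ Sum.inl)) D₁ _ :=
    Walk.single (M := y ∘ Sum.inr ∘ Sum.inr) (by
      rw [im_cons]; convert h₁ using 1
      rw [insert_union, insert_union]
      congr 1
      ext; simp; tauto)
  refine ⟨_, w₀.append w₁, ?_, ?_, ?_⟩
  · simp [-List.ofFn_succ, ofFn_finCons]
  · intro i; simp [-List.ofFn_succ, List.mem_ofFn]
  · rintro (i | i | i) <;> simp [-List.ofFn_succ, ofFn_finCons, List.mem_ofFn]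

namespace Ctx

variable (h : Ctx l r E A Bad A₂ p γ τ ε)
include h

/-- Closing a walk which covers all exceptional vertices to a spanning closed walk. -/
lemma exists_closed_walk {m t s : ℕ} {xs : List V}
    (hseg : Seg l r E A A₂ τ (m - 2 * A₂.card) t xs) (hBad : ∀ v ∈ Bad, v ∈ xs)
    (hn : Nat.card V = m * (l + r + 2)) (hs : t + 2 * (s + 1) = m) {Λ q θ : ℝ} (hΛ : 1 ≤ Λ)
    (hΛs : (Nat.card V : ℝ) ≤ Λ * s) (hq : 0 < q)
    (hqΛ : 3 * q * Λ ^ (l + 1) ≤ 1) (hγq : γ / 8 ≤ q)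
    (hnq : ((l + 1 : ℕ) : ℝ) ^ 2 / Nat.card V ≤ q) (hθ : ε / τ / q ≤ θ)
    (hlog : Real.log (Nat.card V) ≤ θ * s)
    (hcond : ((l + 2 * r + 2 : ℕ) + 2) * (Λ ^ (l + 2 * r + 3) * (2 * τ) + 8 * θ + 2 / (s + 1)) +
      ((l + 2 * r + 2 : ℕ) + 2 : ℝ) ^ 2 / (s + 1) < 1) :
    ∃ (L : Fin (l + 1) → V) (vs : List V), Walk r E m L L vs ∧ ∀ v, v ∈ vs := by
  obtain ⟨S, T, vs, hw, hxs, hnd, hS, hT, hz⟩ := hseg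
  have hlen : xs.length = t * (l + r + 2) + (l + 1) := by
    rw [hxs, List.length_append, hw.length_eq, List.length_ofFn]
  let X : Finset V := xs.toFinset ∪ A₂
  have hAX : A ⊆ X := by
    intro a ha
    by_cases haB : a ∈ Bad
    · exact mem_union_left _ (List.mem_toFinset.mpr (hBad a haB))
    · exact mem_union_right _ (h.mem_A₂ a ha haB)
  have hcount : (A₂ ∩ xs.toFinset).card = xs.countP (· ∈ A₂) := by
    have : A₂ ∩ xs.toFinset = (xs.filter (· ∈ A₂)).toFinset := by
      ext; simp; tauto
    rw [this, List.toFinset_card_of_nodup (hnd.filter _), List.countP_eq_length_filter]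
  have hArem : (A₂ \ xs.toFinset).card = s + 1 := by
    have := card_sdiff_add_card_inter A₂ xs.toFinset
    omega
  have hXcard : X.card = t * (l + r + 2) + (l + 1) + (s + 1) := by
    have : X = xs.toFinset ∪ (A₂ \ xs.toFinset) := by simp [X]
    rw [this, card_union_of_disjoint disjoint_sdiff, hArem,
      List.toFinset_card_of_nodup hnd, hlen]
  have hVcard : Nat.card V = X.card + s * (l + 1) + (l + 2 * r + 2) * (s + 1) := by
    rw [hn, hXcard, ← hs]; ring
  obtain ⟨c, hcT, hcI, hcX, hcA, hcB⟩ := h.exists_connectors hAX (s := s) hΛ (by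
      rw [hVcard] at hΛs ⊢
      push_cast at hΛs ⊢
      refine hΛs.trans (mul_le_mul_of_nonneg_left ?_ (by linarith))
      have h1 : (0 : ℝ) ≤ l := by positivity
      have h2 : (0 : ℝ) ≤ r := by positivity
      have h3 : (0 : ℝ) ≤ s := by positivity
      nlinarith [mul_nonneg h1 h3, mul_nonneg h2 h3]) hq hqΛ hγq hnq hθ hlog
  let U : Finset V := Finset.univ.image (Function.uncurry c)
  have hU : U.card = s * (l + 1) := by
    rw [card_image_of_injective _ hcI]; simp
  have hXU : Disjoint X U := by
    rw [Finset.disjoint_left]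
    intro v hv hvU
    obtain ⟨⟨j, i⟩, -, rfl⟩ := mem_image.mp hvU
    exact hcX _ _ hv
  let κ := Fin (r + 1) ⊕ Fin l ⊕ Fin (r + 1)
  have hκ : Fintype.card κ = l + 2 * r + 2 := by simp [κ]; omega
  have hrest : ((X ∪ U)ᶜ).card = Fintype.card κ * (s + 1) := by
    rw [card_compl, card_union_of_disjoint hXU, hU, hκ, ← Nat.card_eq_fintype_card, hVcard]
    omega
  obtain ⟨β, hβI, hβ, hβs⟩ := exists_equiv_fin_prod (κ := κ) _ hrest
  obtain ⟨α', hαI', hα', hαs'⟩ := exists_equiv_fin_prod (κ := Unit) (A₂ \ xs.toFinset)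
    (by simpa using hArem)
  let α := α' ()
  have hαI : Function.Injective α := fun i j hij =>
    congrArg Prod.snd (hαI' (a₁ := ((), i)) (a₂ := ((), j)) hij)
  have hαB : ∀ j, α j ∉ Bad := fun j hj =>
    (mem_sdiff.mp (hα' () j)).2 (List.mem_toFinset.mpr (hBad _ hj))
  have hαA : ∀ j, α j ∈ A := fun j => by
    by_contra hA
    exact h.notMem_A₂ _ hA (hαB j) (mem_sdiff.mp (hα' () j)).1
  have hβX : ∀ c j, β c j ∉ X := fun c j hj => (mem_compl.mp (hβ c j)) (mem_union_left _ hj)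
  have hβA : ∀ c j, β c j ∉ A := fun c j hj => hβX c j (hAX hj)
  have hβB : ∀ c j, β c j ∉ Bad := fun c j hj =>
    hβX c j (mem_union_left _ (List.mem_toFinset.mpr (hBad _ hj)))
  let D : Fin (s + 2) → Fin (l + 1) → V := Fin.cons (α := fun _ => Fin (l + 1) → V) T
    (Fin.snoc (α := fun _ => Fin (l + 1) → V) c S)
  have hD₀ : ∀ j : Fin (s + 1), D j.castSucc = Fin.cons (α := fun _ => Fin (l + 1) → V) T c j := by
    intro j
    simp only [D]
    rw [Fin.cons_snoc_eq_snoc_cons, Fin.snoc_castSucc]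
  have hD₁ : ∀ j : Fin (s + 1), D j.succ = Fin.snoc (α := fun _ => Fin (l + 1) → V) c S j :=
    fun j => by simp only [D, Fin.cons_succ]
  have hDT : ∀ j, Typ r E A τ (D j) := by
    refine Fin.cases hT fun j => ?_
    rw [hD₁]
    induction j using Fin.lastCases with
    | last => rw [Fin.snoc_last]; exact hS
    | cast j => rw [Fin.snoc_castSucc]; exact hcT j
  have hθ0 : 0 ≤ θ := le_trans (by have := h.ε_pos; have := h.τ_pos; positivity) hθ
  have hbs : (2 * (4 * θ * s) + 2) / (Nat.card (Fin (s + 1)) : ℝ) ≤ 8 * θ + 2 / (s + 1) := by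
    rw [Nat.card_fin, Nat.cast_add_one, div_le_iff₀ (by positivity), add_mul,
      div_mul_cancel₀ _ (by positivity)]
    nlinarith
  obtain ⟨ρ, σ, hρ⟩ := exists_linking (κ := κ) (J := Fin (s + 1)) (r := r) (τ := τ)
    (E := E) (A := A)
    (e₀ := Sum.map id Sum.inl) (e₁ := fun c => Sum.inr c.swap)
    (Sum.map_injective.mpr ⟨fun _ _ h => h, Sum.inl_injective⟩)
    (fun a b hab => by
      have : a.swap = b.swap := Sum.inr_injective hab
      simpa using congrArg Sum.swap this)
    (D₀ := fun j => D j.castSucc) (D₁ := fun j => D j.succ) (fun j => hDT _) (fun j => hDT _)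
    hαI hαA (β := β) (fun c i j hij => congrArg Prod.snd (hβI (a₁ := (c, i)) (a₂ := (c, j)) hij))
    hβA (b := 2 * (4 * θ * s) + 2) (Λ := Λ)
    (δ := Λ ^ (l + 2 * r + 3) * (2 * τ) + 8 * θ + 2 / (s + 1))
    (fun i => by
      simp only [hD₀, hD₁]
      exact ncard_cons_snoc_le (fun L => neB E A (insert (α i) (im L)) (Fin l ⊕ Fin (r + 1)) ≤ τ)
        S T c (hcA _ (hαA i) (hαB i)))
    (fun k i => by
      simp only [hD₀, hD₁]
      exact ncard_cons_snoc_le (fun L => neA E A (insert (β k i) (im L)) (Fin l ⊕ Fin r) ≤ τ)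
        S T c (hcB _ (hβA k i) (hβB k i)))
    hΛ (by
      rw [Nat.card_fin]; push_cast
      exact hΛs.trans (mul_le_mul_of_nonneg_left (by linarith) (by linarith))) h.τ_pos.le
    (by rw [hκ]; linarith) (by rw [hκ, Nat.card_fin]; push_cast at hcond ⊢; linarith)
  choose us hus husa husD husy using fun j => Walk.double (hρ j).1 (hρ j).2
  have hW := hw.append (Walk.chain D us hus)
  have hDl : D (Fin.last (s + 1)) = S := by
    rw [← Fin.succ_last, hD₁, Fin.snoc_last]
  rw [hDl, hs] at hW
  refine ⟨S, _, hW, fun v => ?_⟩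
  have hmem : ∀ j, v ∈ us j → v ∈ vs ++ (List.ofFn us).flatten := fun j hj =>
    List.mem_append_right _ (List.mem_flatten.mpr ⟨us j, List.mem_ofFn.mpr ⟨j, rfl⟩, hj⟩)
  by_cases hvx : v ∈ xs
  · rw [hxs, List.mem_append] at hvx
    rcases hvx with hv | hv
    · exact List.mem_append_left _ hv
    · obtain ⟨i, rfl⟩ := List.mem_ofFn.mp hv
      exact hmem 0 (husD 0 i)
  by_cases hvA : v ∈ A₂
  · obtain ⟨⟨⟩, i, hi⟩ := hαs' v (mem_sdiff.mpr ⟨hvA, by simpa using hvx⟩)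
    refine hmem (ρ.symm i) ?_
    have := husa (ρ.symm i)
    rw [Equiv.apply_symm_apply] at this
    exact hi ▸ this
  by_cases hvU : v ∈ U
  · obtain ⟨⟨j, i⟩, -, rfl⟩ := mem_image.mp hvU
    refine hmem j.succ ?_
    have := husD j.succ i
    rwa [hD₀, Fin.cons_succ] at this
  · obtain ⟨k, i, rfl⟩ := hβs v (by simp [X, hvx, hvA, hvU])
    refine hmem ((σ k).symm i) ?_
    have := husy ((σ k).symm i) k
    rwa [Equiv.apply_symm_apply] at this

end Ctx

end Setup

section Kernel

variable {V : Type*} [DecidableEq V]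

/-- `K` extends to an edge with at most `i` further vertices in any prescribed set of
at most `N` vertices. -/
def IsKernel (E : Finset (Finset V)) (i N : ℕ) (K : Finset V) : Prop :=
  ∀ F : Finset V, F.card ≤ N → ∃ e ∈ E, K ⊆ e ∧ ((e ∩ F) \ K).card ≤ i

lemma IsKernel.step {E : Finset (Finset V)} {i N : ℕ} {K : Finset V}
    (h : IsKernel E (i + 1) (N + N * N) K) :
    IsKernel E i N K ∨ ∃ z ∉ K, IsKernel E i N (insert z K) := by
  by_contra! hcon
  obtain ⟨h0, h1⟩ := hcon
  simp only [IsKernel, not_forall, not_exists, not_and, not_le] at h0 h1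
  obtain ⟨F₀, hF₀, h0⟩ := h0
  choose! F hF hFe using h1
  obtain ⟨e, he, hKe, hcard⟩ := h (F₀ ∪ (F₀ \ K).biUnion F) (by
    refine (card_union_le _ _).trans (Nat.add_le_add hF₀ ?_)
    refine (card_biUnion_le_card_mul _ _ N fun z hz => hF z (mem_sdiff.mp hz).2).trans ?_
    exact Nat.mul_le_mul_right _ ((card_le_card sdiff_subset).trans hF₀))
  obtain ⟨z, hz⟩ : ((e ∩ F₀) \ K).Nonempty := by
    rw [← card_pos]; exact (Nat.zero_le i).trans_lt (h0 e he hKe)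
  simp only [mem_sdiff, mem_inter] at hz
  have h2 := hFe z hz.2 e he (insert_subset hz.1.1 hKe)
  have h3 : insert z ((e ∩ F z) \ insert z K) ⊆ (e ∩ (F₀ ∪ (F₀ \ K).biUnion F)) \ K := by
    intro v hv
    simp only [mem_insert, mem_sdiff, mem_inter, mem_union, mem_biUnion, not_or] at hv ⊢
    rcases hv with rfl | ⟨⟨hve, hvF⟩, -, hvK⟩
    · exact ⟨⟨hz.1.1, Or.inl hz.1.2⟩, hz.2⟩
    · exact ⟨⟨hve, Or.inr ⟨z, ⟨hz.1.2, hz.2⟩, hvF⟩⟩, hvK⟩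
  have h4 := card_le_card h3
  rw [card_insert_of_notMem (by simp)] at h4
  omega

lemma IsKernel.exists_zero {E : Finset (Finset V)} {N : ℕ} {K : Finset V}
    (h : IsKernel E 2 ((N + N * N) + (N + N * N) * (N + N * N)) K) :
    ∃ X : Finset V, Disjoint X K ∧ X.card ≤ 2 ∧ IsKernel E 0 N (K ∪ X) := by
  rcases h.step with h | ⟨z, hz, h⟩
  · rcases h.step with h | ⟨y, hy, h⟩
    · exact ⟨∅, by simp, by simp, by simpa using h⟩
    · exact ⟨{y}, by simpa using hy, by simp, by rwa [union_comm, ← insert_eq]⟩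
  · rcases h.step with h | ⟨y, hy, h⟩
    · exact ⟨{z}, by simpa using hz, by simp, by rwa [union_comm, ← insert_eq]⟩
    · refine ⟨{y, z}, ?_, card_le_two, ?_⟩
      · simp only [mem_insert, not_or] at hy
        simp [hy.2, hz]
      · convert h using 1
        ext; simp

lemma IsKernel.exists_inter {E : Finset (Finset V)} {N : ℕ} {K : Finset V} (h : IsKernel E 0 N K)
    (F : Finset V) (hF : F.card ≤ N) : ∃ e ∈ E, K ⊆ e ∧ e ∩ F = K ∩ F := by
  obtain ⟨e, he, hK, hc⟩ := h F hF
  refine ⟨e, he, hK, ?_⟩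
  rw [Nat.le_zero, card_eq_zero, sdiff_eq_empty_iff_subset] at hc
  exact Subset.antisymm (subset_inter hc inter_subset_right) (inter_subset_inter_right hK)

/-- If every `(k - 2)`-subset of a large set extends to an edge, then two edges are disjoint or
meet in exactly `s` vertices. -/
lemma exists_inter_card_eq {k s : ℕ} (hs : 1 ≤ s) (hk : 2 * s < k) {E : Finset (Finset V)}
    (hunif : ∀ e ∈ E, e.card = k) {U : Finset V} (hEU : ∀ e ∈ E, e ⊆ U)
    {N : ℕ} (hN : 4 * k ≤ N)
    (hU : (N + N * N) + (N + N * N) * (N + N * N) + k ≤ U.card)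
    (hdeg : ∀ S ⊆ U, S.card = k - 2 → ∃ e ∈ E, S ⊆ e)
    (hdeg' : s = 1 → ∀ S ⊆ U, S.card = k - 2 → 2 ≤ (E.filter (S ⊆ ·)).card) :
    ∃ e ∈ E, ∃ f ∈ E, (e ∩ f).card = 0 ∨ (e ∩ f).card = s := by
  by_contra! hcon
  have hext : ∀ (I F : Finset V) (j : ℕ), I.card ≤ j → j ≤ k → I ⊆ U →
      F.card ≤ (N + N * N) + (N + N * N) * (N + N * N) →
      ∃ S, I ⊆ S ∧ S ⊆ U ∧ S.card = j ∧ Disjoint (S \ I) F := by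
    intro I F j hI hj hIU hF
    have h1 : I ⊆ I ∪ (U \ F) := subset_union_left
    have h2 : j ≤ (I ∪ (U \ F)).card := by
      refine le_trans ?_ (card_le_card subset_union_right)
      have := le_card_sdiff F U
      omega
    obtain ⟨S, hIS, hSU, hS⟩ := exists_subsuperset_card_eq h1 hI h2
    refine ⟨S, hIS, hSU.trans (union_subset hIU sdiff_subset), hS, ?_⟩
    rw [Finset.disjoint_left]
    intro v hv hvF
    simp only [mem_sdiff] at hv
    have := hSU hv.1
    simp only [mem_union, mem_sdiff] at this
    tauto
  have hker : ∀ I : Finset V, I ⊆ U → I.card ≤ k - 2 → ∃ X : Finset V, Disjoint X I ∧ X.card ≤ 2 ∧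
      IsKernel E 0 N (I ∪ X) := by
    intro I hIU hI
    refine IsKernel.exists_zero fun F hF => ?_
    obtain ⟨S, hIS, hSU, hS, hSF⟩ := hext I F (k - 2) hI (by omega) hIU hF
    obtain ⟨e, he, hSe⟩ := hdeg S hSU hS
    refine ⟨e, he, hIS.trans hSe, ?_⟩
    have h1 : (e ∩ F) \ I ⊆ e \ S := by
      intro v hv
      simp only [mem_sdiff, mem_inter] at hv ⊢
      exact ⟨hv.1.1, fun hvS => Finset.disjoint_left.mp hSF (mem_sdiff.mpr ⟨hvS, hv.2⟩) hv.1.2⟩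
    have h2 := card_le_card h1
    rw [card_sdiff_of_subset hSe, hunif e he, hS] at h2
    omega
  have hedge : ∀ K, IsKernel E 0 N K → K.card ≤ k ∧ K ⊆ U := by
    intro K hK
    obtain ⟨e, he, hKe, -⟩ := hK ∅ (by simp)
    exact ⟨(card_le_card hKe).trans (hunif e he).le, hKe.trans (hEU e he)⟩
  have hmeet : ∀ K, IsKernel E 0 N K → ∀ f ∈ E, (K ∩ f).card ≠ 0 ∧ (K ∩ f).card ≠ s := by
    intro K hK f hf
    obtain ⟨e, he, -, hef⟩ := hK.exists_inter f (by rw [hunif f hf]; omega)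
    rw [← hef]
    exact hcon e he f hf
  have hmeet' : ∀ K K', IsKernel E 0 N K → IsKernel E 0 N K' →
      (K ∩ K').card ≠ 0 ∧ (K ∩ K').card ≠ s := by
    intro K K' hK hK'
    obtain ⟨e, he, -, hef⟩ := hK'.exists_inter K (by have := (hedge K hK).1; omega)
    rw [inter_comm, ← hef, inter_comm]
    exact hmeet K hK e he
  have hself : ∀ K, IsKernel E 0 N K → K.card ≠ 0 ∧ K.card ≠ s := by
    intro K hK
    have := hmeet' K K hK hK
    rwa [inter_self] at this
  rcases hs.lt_or_eq with hs2 | rfl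
  · have hx : ∃ x ∈ U, ∀ f ∈ E, x ∈ f := by
      have hker' : ∀ F : Finset V, F.card ≤ N → ∃ I X : Finset V, I.card = s - 2 ∧ Disjoint I F ∧
          X.card ≤ 1 ∧ IsKernel E 0 N (I ∪ X) := by
        intro F hF
        obtain ⟨I, -, hIU, hI, hIF⟩ := hext ∅ F (s - 2) (by simp) (by omega) (by simp)
          (by nlinarith)
        obtain ⟨X, hXI, hX, hK⟩ := hker I hIU (by omega)
        refine ⟨I, X, hI, by simpa using hIF, ?_, hK⟩
        have := (hself _ hK).2
        rw [card_union_of_disjoint hXI.symm] at this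
        omega
      obtain ⟨I₀, X₀, hI₀, -, hX₀, hK₀⟩ := hker' ∅ (by simp)
      have hc₀ := (hedge _ hK₀).1
      obtain ⟨I₁, X₁, hI₁, hd₁, hX₁, hK₁⟩ := hker' (I₀ ∪ X₀) (by omega)
      have hc₁ := (hedge _ hK₁).1
      have hsub : (I₀ ∪ X₀) ∩ (I₁ ∪ X₁) ⊆ X₁ := by
        intro v hv
        simp only [mem_inter] at hv
        rcases mem_union.mp hv.2 with h | h
        · exact absurd hv.1 (Finset.disjoint_left.mp hd₁ h)
        · exact h
      obtain ⟨x, hx⟩ : ((I₀ ∪ X₀) ∩ (I₁ ∪ X₁)).Nonempty := by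
        rw [← card_pos]; exact Nat.pos_of_ne_zero (hmeet' _ _ hK₀ hK₁).1
      have hX₁' : X₁ = {x} := by
        refine (eq_of_subset_of_card_le (singleton_subset_iff.mpr (hsub hx)) ?_).symm
        simpa using hX₁
      refine ⟨x, (hedge _ hK₀).2 (mem_inter.mp hx).1, fun f hf => ?_⟩
      obtain ⟨I, X, hI, hd, hX, hK⟩ := hker' ((I₀ ∪ X₀) ∪ (I₁ ∪ X₁) ∪ f) (by
        refine (card_union_le _ _).trans ?_
        have h1 := card_union_le (I₀ ∪ X₀) (I₁ ∪ X₁)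
        have h2 := hunif f hf
        omega)
      rw [disjoint_union_right, disjoint_union_right] at hd
      have key : ∀ G : Finset V, Disjoint I G → ((I ∪ X) ∩ G).card ≠ 0 → ∃ y ∈ X, y ∈ G := by
        intro G hG hne
        obtain ⟨y, hy⟩ := card_pos.mp (Nat.pos_of_ne_zero hne)
        simp only [mem_inter, mem_union] at hy
        rcases hy.1 with h | h
        · exact absurd hy.2 (Finset.disjoint_left.mp hG h)
        · exact ⟨y, h, hy.2⟩
      obtain ⟨y₀, hy₀X, hy₀⟩ := key _ hd.1.1 (hmeet' _ _ hK hK₀).1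
      obtain ⟨y₁, hy₁X, hy₁⟩ := key _ hd.1.2 (hmeet' _ _ hK hK₁).1
      obtain ⟨y, hyX, hy⟩ := key _ hd.2 (hmeet _ hK f hf).1
      have h01 := card_le_one.mp hX _ hy₀X _ hy₁X
      have h02 := card_le_one.mp hX _ hy₀X _ hyX
      have := hsub (mem_inter.mpr ⟨hy₀, h01 ▸ hy₁⟩)
      rw [hX₁', mem_singleton] at this
      rwa [← this, h02]
    obtain ⟨x, hxU, hx⟩ := hx
    have hxK : ∀ K, IsKernel E 0 N K → x ∈ K := by
      intro K hK
      by_contra hxK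
      obtain ⟨e, he, -, hef⟩ := hK.exists_inter {x} (by simp; omega)
      have h1 : x ∈ e ∩ {x} := by simpa using hx e he
      rw [hef] at h1
      exact hxK (mem_inter.mp h1).1
    have hpair : ∀ I ⊆ U, I.card = s - 1 → x ∉ I →
        ∃ K, IsKernel E 0 N K ∧ I ⊆ K ∧ K.card = s + 1 ∧ ∀ f ∈ E, I ⊆ f → K ⊆ f := by
      intro I hIU hI hxI
      obtain ⟨X, hXI, hX, hK⟩ := hker I hIU (by omega)
      have hcard : (I ∪ X).card = s - 1 + X.card := by
        rw [card_union_of_disjoint hXI.symm, hI]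
      have hxX : x ∈ X := by
        have := hxK _ hK
        rw [mem_union] at this
        tauto
      have hX1 : 1 ≤ X.card := card_pos.mpr ⟨x, hxX⟩
      have hne := (hself _ hK).2
      have hcard' : (I ∪ X).card = s + 1 := by omega
      refine ⟨I ∪ X, hK, subset_union_left, hcard', fun f hf hIf => ?_⟩
      have h1 : insert x I ⊆ (I ∪ X) ∩ f := by
        intro v hv
        rw [mem_insert] at hv
        rcases hv with rfl | hv
        · exact mem_inter.mpr ⟨mem_union_right _ hxX, hx f hf⟩
        · exact mem_inter.mpr ⟨mem_union_left _ hv, hIf hv⟩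
      have h2 := card_le_card h1
      rw [card_insert_of_notMem hxI, hI] at h2
      have h3 := (hmeet _ hK f hf).2
      have h4 : (I ∪ X) ∩ f = I ∪ X := eq_of_subset_of_card_le inter_subset_left (by omega)
      exact inter_eq_left.mp h4
    obtain ⟨I, -, hIU, hI, hIx⟩ := hext ∅ {x} (s - 1) (by simp) (by omega) (by simp)
      (by simp; nlinarith)
    simp only [sdiff_empty, disjoint_singleton_right] at hIx
    obtain ⟨K, hK, hIK, hKc, hKf⟩ := hpair I hIU hI hIx
    obtain ⟨a, ha⟩ : I.Nonempty := card_pos.mp (by omega)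
    have hKU := (hedge K hK).2
    obtain ⟨J, hJI, hJU, hJ, hJF⟩ := hext (I.erase a) K (s - 1)
      (by rw [card_erase_of_mem ha]; omega) (by omega) ((erase_subset _ _).trans hIU)
      (by nlinarith)
    have hxJ : x ∉ J := fun hxJ => by
      refine Finset.disjoint_left.mp hJF (mem_sdiff.mpr ⟨hxJ, fun h => hIx (mem_of_mem_erase h)⟩)
        (hxK _ hK)
    obtain ⟨K', hK', hJK', hKc', hKf'⟩ := hpair J hJU hJ hxJ
    have hJd : (J \ I.erase a).card = 1 := by
      rw [card_sdiff_of_subset hJI, hJ, card_erase_of_mem ha, hI]; omega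
    obtain ⟨b, hb⟩ := card_eq_one.mp hJd
    have hbJ : b ∈ J \ I.erase a := by rw [hb]; simp
    have hbK : b ∉ K := Finset.disjoint_left.mp hJF hbJ
    have hsmall : (K ∩ K').card ≤ s - 1 := by
      have h1 : K ∩ K' ⊆ K'.erase b := by
        intro v hv
        simp only [mem_inter] at hv
        exact mem_erase.mpr ⟨fun h => hbK (h ▸ hv.1), hv.2⟩
      have h2 := card_le_card h1
      rw [card_erase_of_mem (hJK' (mem_sdiff.mp hbJ).1), hKc'] at h2
      have := (hmeet' _ _ hK hK').2
      omega
    have hIJ : (insert b I).card ≤ k - 2 := by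
      have := card_insert_le b I
      omega
    obtain ⟨S, hIS, hSU, hS, hSF⟩ := hext (insert b I) (K ∪ K') (k - 2) hIJ (by omega)
      (insert_subset (hJU (mem_sdiff.mp hbJ).1) hIU) (by
        have := card_union_le K K'
        nlinarith)
    obtain ⟨e, he, hSe⟩ := hdeg S hSU hS
    have hIe : I ⊆ e := (subset_insert _ _).trans (hIS.trans hSe)
    have hJe : J ⊆ e := by
      intro v hv
      by_cases hvI : v ∈ I.erase a
      · exact hIe (mem_of_mem_erase hvI)
      · have : v ∈ J \ I.erase a := mem_sdiff.mpr ⟨hv, hvI⟩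
        rw [hb, mem_singleton] at this
        rw [this]
        exact hSe (hIS (mem_insert_self _ _))
    have h1 : (K ∪ K') \ insert b I ⊆ e \ S := by
      intro v hv
      simp only [mem_sdiff] at hv ⊢
      refine ⟨union_subset (hKf e he hIe) (hKf' e he hJe) hv.1, fun hvS => ?_⟩
      exact Finset.disjoint_left.mp hSF (mem_sdiff.mpr ⟨hvS, hv.2⟩) hv.1
    have h2 := card_le_card h1
    have h3 := le_card_sdiff (insert b I) (K ∪ K')
    have h4 := card_union_add_card_inter K K'
    have h5 := card_insert_le b I
    rw [card_sdiff_of_subset hSe, hunif e he, hS] at h2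
    omega
  · obtain ⟨X, -, hX, hK⟩ := hker ∅ (by simp) (by simp)
    rw [empty_union] at hK
    have h1 := hself _ hK
    have hX2 : X.card = 2 := by omega
    have hsub : ∀ f ∈ E, X ⊆ f := by
      intro f hf
      have h2 := hmeet _ hK f hf
      have h3 := card_le_card (inter_subset_left : X ∩ f ⊆ X)
      exact inter_eq_left.mp (eq_of_subset_of_card_le inter_subset_left (by omega))
    obtain ⟨S, -, hSU, hS, hSX⟩ := hext ∅ X (k - 2) (by simp) (by omega) (by simp) (by nlinarith)
    rw [sdiff_empty] at hSX
    have h4 : E.filter (S ⊆ ·) ⊆ {S ∪ X} := by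
      intro e he
      rw [mem_filter] at he
      rw [mem_singleton]
      refine (eq_of_subset_of_card_le (union_subset he.2 (hsub e he.1)) ?_).symm
      rw [card_union_of_disjoint hSX, hunif e he.1]
      omega
    have h5 := card_le_card h4
    have h6 := hdeg' rfl S hSU hS
    simp at h5
    omega

end Kernel

section PairCounting

variable {V : Type*} [Fintype V] [DecidableEq V]

lemma frac_union_of_disjoint {Ω : Type*} [Finite Ω] {s t : Set Ω} (h : Disjoint s t) :
    frac (s ∪ t) = frac s + frac t := by
  unfold frac
  rw [Set.ncard_union_eq h, Nat.cast_add, add_div]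

lemma two_mul_card_le_ncard_pairs {E : Finset (Finset V)} {S : Finset V}
    (hunif : ∀ e ∈ E, e.card = S.card + 2) :
    2 * (E.filter (S ⊆ ·)).card ≤ {x : V × V | insert x.1 (insert x.2 S) ∈ E}.ncard := by
  classical
  have h0 : {x : V × V | insert x.1 (insert x.2 S) ∈ E} =
      ((univ.filter fun x : V × V => insert x.1 (insert x.2 S) ∈ E : Finset (V × V)) :
        Set (V × V)) := by
    ext; simp
  rw [h0, Set.ncard_coe_finset]
  rw [card_eq_sum_card_fiberwise (f := fun x : V × V => insert x.1 (insert x.2 S))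
    (t := E.filter (S ⊆ ·))]
  · rw [mul_comm, ← smul_eq_mul]
    refine card_nsmul_le_sum _ _ _ fun e he => ?_
    rw [mem_filter] at he
    have h1 : (e \ S).card = 2 := by
      rw [card_sdiff_of_subset he.2, hunif e he.1]; omega
    obtain ⟨a, b, hab, heS⟩ := card_eq_two.mp h1
    have h2 : e = insert a (insert b S) := by
      rw [← sdiff_union_of_subset he.2, heS]
      ext; simp
    have h3 : ({(a, b), (b, a)} : Finset (V × V)).card = 2 := by
      rw [card_pair]; simp [hab]
    rw [← h3]
    refine card_le_card fun x hx => ?_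
    rw [mem_insert, mem_singleton] at hx
    rw [mem_filter, mem_filter]
    rcases hx with rfl | rfl
    · exact ⟨⟨mem_univ _, h2 ▸ he.1⟩, h2.symm⟩
    · have h4 : insert b (insert a S) = e := by rw [h2, insert_comm]
      exact ⟨⟨mem_univ _, h4.symm ▸ he.1⟩, h4⟩
  · intro x hx
    simp only [coe_filter, Set.mem_ofPred_eq, mem_univ, true_and] at hx ⊢
    exact ⟨hx, (subset_insert _ _).trans (subset_insert _ _)⟩

/-- Edges through `S` are abundant as soon as few pairs outside `S` are missing. -/
lemma frac_pairs_ge {E : Finset (Finset V)} {A S : Finset V} {j : ℕ} (hS : S.card = j)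
    (hunif : ∀ e ∈ E, e.card = j + 2)
    (hdeg : (Fintype.card V - j).choose 2 ≤
      (E.filter (S ⊆ ·)).card + (Aᶜ.card - j).choose 2) [Nonempty V] :
    1 - frac ((A : Set V)ᶜ) ^ 2 - (2 * j + 1) / Nat.card V ≤
      frac {x : V × V | insert x.1 (insert x.2 S) ∈ E} := by
  have h1 := two_mul_card_le_ncard_pairs (E := E) (S := S) (by rwa [hS])
  set n := Fintype.card V with hn
  set b := Aᶜ.card with hb
  have hjn : j ≤ n := by rw [← hS]; exact card_le_univ S
  have h2 : (n : ℝ) ^ 2 - b ^ 2 - (2 * j + 1) * n ≤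
      {x : V × V | insert x.1 (insert x.2 S) ∈ E}.ncard := by
    have h3 : ((n - j).choose 2 : ℝ) ≤ (E.filter (S ⊆ ·)).card + ((b - j).choose 2 : ℕ) := by
      exact_mod_cast hdeg
    have h4 : (2 : ℝ) * (E.filter (S ⊆ ·)).card ≤
      {x : V × V | insert x.1 (insert x.2 S) ∈ E}.ncard := by exact_mod_cast h1
    rw [Nat.cast_choose_two, Nat.cast_choose_two, Nat.cast_sub hjn] at h3
    have h5 : ((b - j : ℕ) : ℝ) * (((b - j : ℕ) : ℝ) - 1) ≤ (b : ℝ) ^ 2 := by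
      have h6 : ((b - j : ℕ) : ℝ) ≤ b := by exact_mod_cast Nat.sub_le _ _
      have h7 : (0 : ℝ) ≤ ((b - j : ℕ) : ℝ) := Nat.cast_nonneg _
      nlinarith
    have h8 : (0 : ℝ) ≤ j := Nat.cast_nonneg _
    nlinarith
  have hn0 : (0 : ℝ) < n := by exact_mod_cast Fintype.card_pos
  unfold frac
  rw [Nat.card_prod, Nat.card_eq_fintype_card, ← hn, ← coe_compl, Set.ncard_coe_finset, ← hb]
  push_cast
  rw [le_div_iff₀ (by positivity)]
  refine le_trans (le_of_eq ?_) h2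
  field_simp

lemma neA_fin_one (E : Finset (Finset V)) (A S : Finset V) :
    neA E A S (Fin 1) =
      frac {x : V × V | x.1 ∈ A ∧ x.2 ∉ A ∧ insert x.1 (insert x.2 S) ∉ E} := by
  unfold neA
  rw [← frac_preimage_equiv ((Equiv.refl V).prodCongr (Equiv.funUnique (Fin 1) V))]
  congr 1
  ext ⟨a, y⟩
  have h : S ∪ im y = insert (y 0) S := by
    ext v; simp [mem_im, or_comm, eq_comm]
  simp [h]

lemma edB_fin_two (E : Finset (Finset V)) (A S : Finset V) :
    edB E A S (Fin 2) =
      frac {x : V × V | x.1 ∉ A ∧ x.2 ∉ A ∧ insert x.1 (insert x.2 S) ∈ E} := by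
  unfold edB
  rw [← frac_preimage_equiv (finTwoArrowEquiv V)]
  congr 1
  ext y
  have h : S ∪ im y = insert (y 0) (insert (y 1) S) := by
    ext v; simp [mem_im, or_comm, or_left_comm, eq_comm]
  simp [h, and_assoc]

lemma neA_fin_one_le {E : Finset (Finset V)} {A S : Finset V} {j : ℕ} (hS : S.card = j)
    (hunif : ∀ e ∈ E, e.card = j + 2)
    (hdeg : (Fintype.card V - j).choose 2 ≤
      (E.filter (S ⊆ ·)).card + (Aᶜ.card - j).choose 2) [Nonempty V] :
    neA E A S (Fin 1) ≤ edB E A S (Fin 2) / 2 + (j + 1) / Nat.card V := by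
  have h1 := frac_pairs_ge hS hunif hdeg
  rw [neA_fin_one, edB_fin_two]
  set P := {x : V × V | insert x.1 (insert x.2 S) ∈ E} with hP
  set X := {x : V × V | x.1 ∈ A ∧ x.2 ∉ A ∧ insert x.1 (insert x.2 S) ∉ E} with hX
  set X' := {x : V × V | x.2 ∈ A ∧ x.1 ∉ A ∧ insert x.1 (insert x.2 S) ∉ E} with hX'
  set Y := {x : V × V | x.1 ∉ A ∧ x.2 ∉ A ∧ insert x.1 (insert x.2 S) ∈ E} with hY
  set Y' := {x : V × V | x.1 ∉ A ∧ x.2 ∉ A ∧ insert x.1 (insert x.2 S) ∉ E} with hY'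
  have h2 : frac X' = frac X := by
    rw [← frac_preimage_equiv (Equiv.prodComm V V)]
    congr 1
    ext ⟨a, b⟩
    simp [hX, hX', insert_comm]
  have h3 : frac Y + frac Y' = frac ((A : Set V)ᶜ) ^ 2 := by
    rw [← frac_union_of_disjoint, sq, ← frac_prod]
    · congr 1
      ext ⟨a, b⟩
      simp only [hY, hY', Set.mem_union, Set.mem_ofPred_eq, Set.mem_prod, Set.mem_compl_iff,
        mem_coe]
      tauto
    · rw [Set.disjoint_left]
      intro x hx hx'
      exact hx'.2.2 hx.2.2
  have h4 : frac X + frac X' + frac Y' ≤ frac Pᶜ := by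
    rw [← frac_union_of_disjoint, ← frac_union_of_disjoint]
    · refine frac_mono ?_
      rintro x ((hx | hx) | hx) <;> exact hx.2.2
    · rw [Set.disjoint_left]
      rintro x (hx | hx) hx'
      · exact hx'.1 hx.1
      · exact hx'.2.1 hx.1
    · rw [Set.disjoint_left]
      intro x hx hx'
      exact hx'.2.1 hx.1
  rw [frac_compl] at h4
  rw [add_div]
  rw [add_div] at h1
  have h5 : (2 * (j : ℝ)) / Nat.card V = 2 * (j / Nat.card V) := by ring
  have h6 : (0 : ℝ) ≤ 1 / Nat.card V := by positivity
  linarith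

lemma neA_sum_eq {κ ι : Type*} [Fintype κ] [Fintype ι] (E : Finset (Finset V)) (A T : Finset V) :
    neA E A T (κ ⊕ ι) = frac {q : (κ → V) × (V × (ι → V)) | (∀ i, q.1 i ∉ A) ∧ q.2.1 ∈ A ∧
      (∀ i, q.2.2 i ∉ A) ∧ insert q.2.1 (T ∪ im q.1 ∪ im q.2.2) ∉ E} := by
  let f : V × (κ ⊕ ι → V) ≃ (κ → V) × (V × (ι → V)) :=
    { toFun := fun q => (q.2 ∘ Sum.inl, (q.1, q.2 ∘ Sum.inr))
      invFun := fun q => (q.2.1, Sum.elim q.1 q.2.2)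
      left_inv := fun q => by simp
      right_inv := fun q => by simp }
  rw [← frac_preimage_equiv f]
  unfold neA
  congr 1
  ext ⟨a, y⟩
  simp only [Set.mem_ofPred_eq, Set.mem_preimage, f, Equiv.coe_fn_mk, im_sum y, union_assoc,
    Sum.forall, Function.comp_apply]
  tauto

lemma edB_sum_eq {κ ι : Type*} [Fintype κ] [Fintype ι] (E : Finset (Finset V)) (A T : Finset V) :
    edB E A T (κ ⊕ ι) = frac {q : (κ → V) × (ι → V) | (∀ i, q.1 i ∉ A) ∧
      (∀ i, q.2 i ∉ A) ∧ T ∪ im q.1 ∪ im q.2 ∈ E} := by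
  rw [← frac_preimage_equiv (Equiv.sumArrowEquivProdArrow κ ι V)]
  unfold edB
  congr 1
  ext y
  have h1 : ((Equiv.sumArrowEquivProdArrow κ ι V) y).1 = y ∘ Sum.inl := rfl
  have h2 : ((Equiv.sumArrowEquivProdArrow κ ι V) y).2 = y ∘ Sum.inr := rfl
  simp only [Set.mem_ofPred_eq, Set.mem_preimage, h1, h2, im_sum y, union_assoc,
    Sum.forall, Function.comp_apply]
  tauto

lemma frac_card_union_im_ne_le {κ : Type*} [Fintype κ] [Nonempty V] (T : Finset V) :
    frac {y : κ → V | (T ∪ im y).card ≠ T.card + Fintype.card κ} ≤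
      (Fintype.card κ * T.card + (Fintype.card κ : ℝ) ^ 2) / Nat.card V := by
  have h1 : {y : κ → V | (T ∪ im y).card ≠ T.card + Fintype.card κ} ⊆
      {y | ∃ i, y i ∈ (T : Set V)} ∪ {y | ¬ Function.Injective y} := by
    intro y hy
    by_contra hcon
    simp only [Set.mem_union, Set.mem_ofPred_eq, not_or, not_exists, not_not] at hcon
    refine hy ?_
    rw [card_union_of_disjoint, card_im hcon.2]
    rw [Finset.disjoint_right]
    intro v hv
    obtain ⟨i, rfl⟩ := mem_im.mp hv
    exact hcon.1 i
  refine (frac_le_add h1).trans ?_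
  rw [add_div]
  refine add_le_add ((frac_hit_le _).trans (le_of_eq ?_)) frac_not_injective_le
  unfold frac
  rw [Set.ncard_coe_finset, mul_div_assoc]

/-- Few mixed tuples are missing edges, relative to the number of edges outside `A`. -/
lemma neA_le_edB {κ ι : Type*} [Fintype κ] [Fintype ι] [Nonempty V] {E : Finset (Finset V)}
    {A T : Finset V} {j : ℕ}
    (hunif : ∀ e ∈ E, e.card = j + 2)
    (hdeg : ∀ S : Finset V, S.card = j → (Fintype.card V - j).choose 2 ≤
      (E.filter (S ⊆ ·)).card + (Aᶜ.card - j).choose 2)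
    (hT : T.card + Fintype.card κ = j) (hι : Fintype.card ι = Fintype.card κ + 1) :
    neA E A T ι ≤ edB E A T (κ ⊕ Fin 2) / 2 + (j + 1 + 2 * j ^ 2) / Nat.card V := by
  rw [neA_congr (Fintype.equivOfCardEq (by simp [hι]) : ι ≃ κ ⊕ Fin 1), neA_sum_eq, edB_sum_eq]
  have h1 := frac_le_of_fiber (C := 1 / 2) (D := (j + 1) / Nat.card V)
    (s := {q : (κ → V) × (V × (Fin 1 → V)) | (∀ i, q.1 i ∉ A) ∧ q.2.1 ∈ A ∧
      (∀ i, q.2.2 i ∉ A) ∧ insert q.2.1 (T ∪ im q.1 ∪ im q.2.2) ∉ E})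
    (t := {q : (κ → V) × (Fin 2 → V) | (∀ i, q.1 i ∉ A) ∧
      (∀ i, q.2 i ∉ A) ∧ T ∪ im q.1 ∪ im q.2 ∈ E})
    (z := {y : κ → V | (T ∪ im y).card ≠ T.card + Fintype.card κ}) (by norm_num) (by positivity)
    (by
      intro y hy
      simp only [Set.mem_ofPred_eq, not_not] at hy
      by_cases hyA : ∀ i, y i ∉ A
      · have h2 := neA_fin_one_le (A := A) (hy.trans hT) hunif (hdeg _ (hy.trans hT))
        unfold neA edB at h2
        simp only [Set.mem_ofPred_eq, hyA, not_false_eq_true, implies_true, true_and]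
        linarith
      · simp only [Set.mem_ofPred_eq, hyA, false_and]
        rw [show {y : V × (Fin 1 → V) | False} = ∅ from rfl, frac_empty]
        have := frac_nonneg {y : Fin 2 → V | False}
        positivity)
  have h2 := frac_card_union_im_ne_le (κ := κ) T
  have h3 : (Fintype.card κ * T.card + (Fintype.card κ : ℝ) ^ 2) / Nat.card V ≤
      2 * j ^ 2 / Nat.card V := by
    have h4 : Fintype.card κ * T.card + Fintype.card κ ^ 2 ≤ 2 * j ^ 2 := by
      have h5 : T.card ≤ j := by omega
      have h6 : Fintype.card κ ≤ j := by omega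
      nlinarith
    have h7 : (Fintype.card κ * T.card + (Fintype.card κ : ℝ) ^ 2) ≤ 2 * j ^ 2 := by
      exact_mod_cast h4
    gcongr
  rw [add_div (j + 1 : ℝ)]
  linarith

end PairCounting

section Degrees

variable {V : Type*} [Fintype V] [DecidableEq V]

lemma choose_two_add_mul_le (x q : ℕ) : x.choose 2 + q * x ≤ (x + q).choose 2 := by
  induction q with
  | zero => simp
  | succ q ih =>
    rw [← add_assoc, Nat.choose_succ_succ' (x + q) 1, Nat.choose_one_right]
    linarith

lemma card_powersetCard_two_sdiff {B S : Finset V} (hS : S ⊆ B) :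
    (powersetCard 2 Sᶜ \ powersetCard 2 (B \ S)).card + (B.card - S.card).choose 2 =
      (Fintype.card V - S.card).choose 2 := by
  have h : B \ S ⊆ Sᶜ := fun v hv => mem_compl.mpr (mem_sdiff.mp hv).2
  rw [← card_sdiff_of_subset hS, ← card_powersetCard, ← card_compl, ← card_powersetCard 2 Sᶜ,
    card_sdiff_add_card_eq_card (powersetCard_mono h)]

/-- A lower bound for the number of edges through `S` inside a set `B`. -/
lemma card_edges_within_ge {E : Finset (Finset V)} {S B : Finset V} {x b : ℕ} (hS : S ⊆ B)
    (hunif : ∀ e ∈ E, e.card = S.card + 2)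
    (hdeg : (Fintype.card V - S.card).choose 2 + x ≤ (E.filter (S ⊆ ·)).card + b) :
    (B.card - S.card).choose 2 + x ≤ ((E.filter (· ⊆ B)).filter (S ⊆ ·)).card + b := by
  have h1 := card_filter_add_card_filter_not (s := E.filter (S ⊆ ·)) (· ⊆ B)
  have h2 : ((E.filter (S ⊆ ·)).filter fun e => ¬ e ⊆ B).card ≤
      (powersetCard 2 Sᶜ \ powersetCard 2 (B \ S)).card := by
    refine card_le_card_of_injOn (· \ S) ?_ ?_
    · intro e he
      simp only [coe_filter, mem_filter, Set.mem_ofPred_eq] at he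
      simp only [coe_sdiff, Set.mem_sdiff, mem_coe, mem_powersetCard, not_and]
      have hc : (e \ S).card = 2 := by rw [card_sdiff_of_subset he.1.2, hunif e he.1.1]; omega
      refine ⟨⟨fun v hv => mem_compl.mpr (mem_sdiff.mp hv).2, hc⟩, fun h => (he.2 ?_).elim⟩
      intro v hv
      by_cases hvS : v ∈ S
      · exact hS hvS
      · exact (mem_sdiff.mp (h (mem_sdiff.mpr ⟨hv, hvS⟩))).1
    · intro e he f hf hef
      simp only [coe_filter, mem_filter, Set.mem_ofPred_eq] at he hf
      simp only at hef
      rw [← sdiff_union_of_subset he.1.2, hef, sdiff_union_of_subset hf.1.2]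
  have h3 := card_powersetCard_two_sdiff hS
  rw [filter_comm]
  omega

lemma card_le_card_filter_superset {E Q : Finset (Finset V)} {S : Finset V}
    (hQ : ∀ p ∈ Q, Disjoint p S ∧ p ∪ S ∈ E) : Q.card ≤ (E.filter (S ⊆ ·)).card := by
  refine card_le_card_of_injOn (· ∪ S) ?_ ?_
  · intro p hp
    simp only [coe_filter, Set.mem_ofPred_eq]
    exact ⟨(hQ p hp).2, subset_union_right⟩
  · intro p hp p' hp' h
    simp only at h
    rw [← union_sdiff_cancel_right (hQ p hp).1, h, union_sdiff_cancel_right (hQ p' hp').1]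

end Degrees

section ExtremalExample

lemma mem_Xedges_of_lt {m l r : ℕ} {e : Finset (Fin (m * (l + r + 2)))}
    (he : e.card = 2 * l + r + 3) (h : ∃ v ∈ e, (v : ℕ) < (m - 1) / 2) :
    e ∈ Xedges (m * (l + r + 2)) (2 * l + r + 3) (l + 1) := by
  have hd : 2 * l + r + 3 - (l + 1) = l + r + 2 := by omega
  have h1 : m * (l + r + 2) / (l + r + 2) = m := Nat.mul_div_cancel _ (by omega)
  have h2 : m * (l + r + 2) / (2 * (l + r + 2)) = m / 2 := Nat.mul_div_mul_right _ _ (by omega)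
  obtain ⟨v, hv, hvm⟩ := h
  unfold Xedges
  rw [hd, h1, h2]
  split_ifs with hm
  · rw [mem_filter, mem_powersetCard]
    exact ⟨⟨subset_univ _, he⟩, v, hv, by omega⟩
  · obtain ⟨a, rfl⟩ := Nat.not_odd_iff_even.mp hm
    rw [mem_filter, mem_powersetCard]
    exact ⟨⟨subset_univ _, he⟩, Or.inl ⟨v, hv, by omega⟩⟩

lemma mem_Xedges_of_even {m l r : ℕ} (hm : Even m) {e : Finset (Fin (m * (l + r + 2)))}
    (he : e.card = 2 * l + r + 3) (h : ∀ v ∈ e, (m - 1) / 2 ≤ (v : ℕ))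
    (hw : ∀ w : Fin (m * (l + r + 2)), (m - 1) / 2 ≤ (w : ℕ) → (w : ℕ) < m / 2 + l + 1 → w ∈ e) :
    e ∈ Xedges (m * (l + r + 2)) (2 * l + r + 3) (l + 1) := by
  have hd : 2 * l + r + 3 - (l + 1) = l + r + 2 := by omega
  have h1 : m * (l + r + 2) / (l + r + 2) = m := Nat.mul_div_cancel _ (by omega)
  have h2 : m * (l + r + 2) / (2 * (l + r + 2)) = m / 2 := Nat.mul_div_mul_right _ _ (by omega)
  unfold Xedges
  rw [hd, h1, h2, if_neg (by simpa using hm)]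
  obtain ⟨a, rfl⟩ := hm
  have h3 : (a + a) / 2 - 1 = (a + a - 1) / 2 := by omega
  rw [mem_filter, mem_powersetCard, h3]
  exact ⟨⟨subset_univ _, he⟩, Or.inr ⟨h, fun w h4 h5 => hw w h4 (by omega)⟩⟩

/-- The minimum degree of the extremal example. -/
lemma deg_Xedges_ge {m l r : ℕ} (hm : 2 * l + r + 10 ≤ m) {S : Finset (Fin (m * (l + r + 2)))}
    (hS : S.card = 2 * l + r + 1) :
    (m * (l + r + 2) - (2 * l + r + 1)).choose 2 + (if l = 0 ∧ Even m then 1 else 0) ≤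
      deg (Xedges (m * (l + r + 2)) (2 * l + r + 3) (l + 1)) S +
        (m * (l + r + 2) - (m - 1) / 2 - (2 * l + r + 1)).choose 2 := by
  have hn : 2 * m ≤ m * (l + r + 2) := by nlinarith
  have hdisj : ∀ p ∈ powersetCard 2 Sᶜ, Disjoint p S ∧ (p ∪ S).card = 2 * l + r + 3 := by
    intro p hp
    rw [mem_powersetCard] at hp
    have h1 : Disjoint p S := by
      rw [Finset.disjoint_left]
      exact fun v hv => mem_compl.mp (hp.1 hv)
    exact ⟨h1, by rw [card_union_of_disjoint h1, hp.2, hS]; omega⟩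
  by_cases hSB : ∀ v ∈ S, (m - 1) / 2 ≤ (v : ℕ)
  · set B : Finset (Fin (m * (l + r + 2))) := univ.filter fun v => (m - 1) / 2 ≤ (v : ℕ) with hB
    have hBc : B.card = m * (l + r + 2) - (m - 1) / 2 := by
      have h1 : B = Finset.Ici (⟨(m - 1) / 2, by omega⟩ : Fin (m * (l + r + 2))) := by
        ext v; simp [hB, Fin.le_def]
      rw [h1, Fin.card_Ici]
    have hSB' : S ⊆ B := fun v hv => by simpa [hB] using hSB v hv
    have hpair := card_powersetCard_two_sdiff hSB'
    rw [hBc, hS, Fintype.card_fin] at hpair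
    have hQ : ∀ p ∈ powersetCard 2 Sᶜ \ powersetCard 2 (B \ S), Disjoint p S ∧
        p ∪ S ∈ Xedges (m * (l + r + 2)) (2 * l + r + 3) (l + 1) := by
      intro p hp
      rw [mem_sdiff] at hp
      refine ⟨(hdisj p hp.1).1, mem_Xedges_of_lt (hdisj p hp.1).2 ?_⟩
      rw [mem_powersetCard, mem_powersetCard] at hp
      have h1 : ¬ p ⊆ B \ S := fun h => hp.2 ⟨h, hp.1.2⟩
      rw [not_subset] at h1
      obtain ⟨v, hv, hvB⟩ := h1
      refine ⟨v, mem_union_left _ hv, ?_⟩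
      have := mem_compl.mp (hp.1.1 hv)
      simp only [hB, mem_sdiff, mem_filter, mem_univ, true_and] at hvB
      by_contra hcon
      exact hvB ⟨by omega, this⟩
    unfold deg
    split_ifs with hc
    · obtain ⟨rfl, heven⟩ := hc
      have hW : ∃ p, univ.filter (fun w : Fin (m * (0 + r + 2)) => (m - 1) / 2 ≤ (w : ℕ) ∧
          (w : ℕ) < m / 2 + 0 + 1) \ S ⊆ p ∧ p ⊆ B \ S ∧ p.card = 2 := by
        refine exists_subsuperset_card_eq ?_ ?_ ?_
        · intro v hv
          simp only [hB, mem_sdiff, mem_filter, mem_univ, true_and] at hv ⊢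
          exact ⟨hv.1.1, hv.2⟩
        · refine (card_le_card sdiff_subset).trans ?_
          rw [← card_map Fin.valEmbedding]
          refine (card_le_card (t := Finset.Ico ((m - 1) / 2) (m / 2 + 0 + 1)) ?_).trans ?_
          · intro w hw
            rw [mem_map] at hw
            obtain ⟨v, hv, rfl⟩ := hw
            simpa using hv
          · obtain ⟨a, rfl⟩ := heven
            rw [Nat.card_Ico]
            omega
        · rw [card_sdiff_of_subset hSB', hBc, hS]
          omega
      obtain ⟨p, hWp, hpB, hp⟩ := hW
      have hpn : p ∉ powersetCard 2 Sᶜ \ powersetCard 2 (B \ S) := by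
        simp [mem_powersetCard, hpB, hp]
      have hpS : p ∈ powersetCard 2 Sᶜ := by
        rw [mem_powersetCard]
        exact ⟨fun v hv => mem_compl.mpr (mem_sdiff.mp (hpB hv)).2, hp⟩
      have h1 := card_le_card_filter_superset
        (Q := insert p (powersetCard 2 Sᶜ \ powersetCard 2 (B \ S))) (S := S)
        (E := Xedges (m * (0 + r + 2)) (2 * 0 + r + 3) (0 + 1)) (by
          intro p' hp'
          rw [mem_insert] at hp'
          rcases hp' with rfl | hp'
          · refine ⟨(hdisj _ hpS).1, mem_Xedges_of_even heven (hdisj _ hpS).2 ?_ ?_⟩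
            · intro v hv
              rcases mem_union.mp hv with hv | hv
              · simpa [hB] using (mem_sdiff.mp (hpB hv)).1
              · exact hSB v hv
            · intro w hw1 hw2
              by_cases hwS : w ∈ S
              · exact mem_union_right _ hwS
              · refine mem_union_left _ (hWp ?_)
                simp only [mem_sdiff, mem_filter, mem_univ, true_and]
                exact ⟨⟨hw1, hw2⟩, hwS⟩
          · exact hQ p' hp')
      rw [card_insert_of_notMem hpn] at h1
      omega
    · have h1 := card_le_card_filter_superset hQ
      omega
  · push Not at hSB
    obtain ⟨v, hvS, hv⟩ := hSB
    have h1 := card_le_card_filter_superset (Q := powersetCard 2 Sᶜ) (S := S)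
      (E := Xedges (m * (l + r + 2)) (2 * l + r + 3) (l + 1)) (fun p hp =>
        ⟨(hdisj p hp).1, mem_Xedges_of_lt (hdisj p hp).2 ⟨v, mem_union_right _ hvS, hv⟩⟩)
    rw [card_powersetCard, card_compl, Fintype.card_fin, hS] at h1
    have h2 : 0 < (m * (l + r + 2) - (m - 1) / 2 - (2 * l + r + 1)).choose 2 :=
      Nat.choose_pos (by omega)
    unfold deg
    split_ifs <;> omega

lemma minDeg_le {n s : ℕ} (E : Finset (Finset (Fin n))) {S : Finset (Fin n)} (hS : S.card = s) :
    minDeg n E s ≤ deg E S := Nat.sInf_le ⟨S, hS, rfl⟩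

lemma exists_deg_eq_minDeg {n s : ℕ} (hs : s ≤ n) (E : Finset (Finset (Fin n))) :
    ∃ S : Finset (Fin n), S.card = s ∧ deg E S = minDeg n E s := by
  refine Nat.sInf_mem (s := {d | ∃ S : Finset (Fin n), S.card = s ∧ deg E S = d}) ?_
  obtain ⟨S, -, hS⟩ := exists_subset_card_eq (s := (univ : Finset (Fin n))) (n := s) (by simpa)
  exact ⟨_, S, hS, rfl⟩

lemma deg_ge_of_minDeg_lt {m l r : ℕ} (hm : 2 * l + r + 10 ≤ m)
    {E : Finset (Finset (Fin (m * (l + r + 2))))}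
    (h : minDeg _ (Xedges (m * (l + r + 2)) (2 * l + r + 3) (l + 1)) (2 * l + r + 1) <
      minDeg _ E (2 * l + r + 1)) {S : Finset (Fin (m * (l + r + 2)))}
    (hS : S.card = 2 * l + r + 1) :
    (m * (l + r + 2) - (2 * l + r + 1)).choose 2 + (if l = 0 ∧ Even m then 2 else 1) ≤
      (E.filter (S ⊆ ·)).card +
        (m * (l + r + 2) - (m - 1) / 2 - (2 * l + r + 1)).choose 2 := by
  obtain ⟨S₀, hS₀, h0⟩ := exists_deg_eq_minDeg (n := m * (l + r + 2)) (s := 2 * l + r + 1)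
    (by nlinarith) (Xedges (m * (l + r + 2)) (2 * l + r + 3) (l + 1))
  have h1 := deg_Xedges_ge hm hS₀
  have h2 := minDeg_le E hS
  unfold deg at h2
  split_ifs at h1 ⊢ <;> omega

end ExtremalExample

section SpecialEdges

variable {V : Type*} [DecidableEq V]

lemma exists_im_eq {s : Finset V} {a : ℕ} (hs : s.card = a) :
    ∃ y : Fin a → V, im y = s ∧ (List.ofFn y).Nodup := by
  refine ⟨fun i => (s.equivFinOfCardEq hs).symm i, ?_, ?_⟩
  · ext v
    rw [mem_im]
    refine ⟨?_, fun hv => ⟨s.equivFinOfCardEq hs ⟨v, hv⟩, by simp⟩⟩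
    rintro ⟨i, rfl⟩
    exact ((s.equivFinOfCardEq hs).symm i).2
  · rw [List.nodup_ofFn]
    exact Subtype.val_injective.comp (Equiv.injective _)

lemma mem_ofFn_iff_mem_im {a : ℕ} {y : Fin a → V} {v : V} : v ∈ List.ofFn y ↔ v ∈ im y := by
  rw [im_eq_toFinset, List.mem_toFinset]

lemma exists_split {s : Finset V} {a b : ℕ} (hs : s.card = a + b) :
    ∃ (y : Fin a → V) (z : Fin b → V), im y ∪ im z = s ∧ Disjoint (im y) (im z) ∧
      (List.ofFn y).Nodup ∧ (List.ofFn z).Nodup := by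
  obtain ⟨t, hts, ht⟩ := exists_subset_card_eq (s := s) (n := a) (by omega)
  obtain ⟨y, hy, hyn⟩ := exists_im_eq ht
  obtain ⟨z, hz, hzn⟩ := exists_im_eq (s := s \ t) (a := b) (by
    rw [card_sdiff_of_subset hts]; omega)
  refine ⟨y, z, ?_, ?_, hyn, hzn⟩
  · rw [hy, hz, union_sdiff_of_subset hts]
  · rw [hy, hz]; exact disjoint_sdiff

lemma exists_raw_of_edge {l r : ℕ} {E : Finset (Finset V)} {A₂ e : Finset V} (he : e ∈ E)
    (hcard : e.card = 2 * l + r + 3) (hA : Disjoint e A₂) :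
    ∃ xs, Raw l r E A₂ 1 xs ∧ ∀ x ∈ xs, x ∈ e := by
  obtain ⟨SM, T, h1, h2, -, hTn⟩ := exists_split (a := l + r + 2) (b := l + 1)
    (hcard.trans (by omega))
  have hSM : (im SM).card = (l + 1) + (r + 1) := by
    have h3 := card_union_of_disjoint h2
    rw [h1, hcard] at h3
    have h4 := card_im_le SM
    have h5 := card_im_le T
    rw [Fintype.card_fin] at h4 h5
    omega
  obtain ⟨S, M, h3, h4, hSn, hMn⟩ := exists_split hSM
  have hmem : ∀ x ∈ List.ofFn S ++ List.ofFn M ++ List.ofFn T, x ∈ e := by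
    intro x hx
    rw [List.mem_append, List.mem_append, mem_ofFn_iff_mem_im, mem_ofFn_iff_mem_im,
      mem_ofFn_iff_mem_im] at hx
    rw [← h1, ← h3, mem_union, mem_union]
    exact hx
  refine ⟨_, ⟨S, T, _, Walk.single (M := M) (by rwa [h3, h1]), rfl, ?_,
    fun x hx => Finset.disjoint_left.mp hA (hmem x hx)⟩, hmem⟩
  rw [← h3] at h2
  refine List.nodup_append.mpr ⟨List.nodup_append.mpr ⟨hSn, hMn, ?_⟩, hTn, ?_⟩
  · rintro a ha b hb rfl
    rw [mem_ofFn_iff_mem_im] at ha hb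
    exact Finset.disjoint_left.mp h4 ha hb
  · rintro a ha b hb rfl
    rw [List.mem_append, mem_ofFn_iff_mem_im, mem_ofFn_iff_mem_im, ← mem_union] at ha
    rw [mem_ofFn_iff_mem_im] at hb
    exact Finset.disjoint_left.mp h2 ha hb

lemma exists_raw_of_edge_pair {l r : ℕ} {E : Finset (Finset V)} {A₂ e f : Finset V} (he : e ∈ E)
    (hf : f ∈ E) (hec : e.card = 2 * l + r + 3) (hfc : f.card = 2 * l + r + 3)
    (hef : (e ∩ f).card = l + 1) (heA : Disjoint e A₂) (hfA : Disjoint f A₂) :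
    ∃ xs, Raw l r E A₂ 2 xs := by
  obtain ⟨L, hL, hLn⟩ := exists_im_eq hef
  obtain ⟨S, M, h1, h2, hSn, hMn⟩ := exists_split (s := e \ f) (a := l + 1) (b := r + 1) (by
    have := card_sdiff_add_card_inter e f; omega)
  obtain ⟨M', T, h3, h4, hMn', hTn⟩ := exists_split (s := f \ e) (a := r + 1) (b := l + 1) (by
    have := card_sdiff_add_card_inter f e; rw [inter_comm] at this; omega)
  have he' : im S ∪ im M ∪ im L = e := by rw [h1, hL, sdiff_union_inter]
  have hf' : im L ∪ im M' ∪ im T = f := by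
    rw [union_assoc, h3, hL, union_comm, inter_comm, sdiff_union_inter]
  have hw := (Walk.single (r := r) (he'.symm ▸ he)).append (Walk.single (hf'.symm ▸ hf))
  have hd1 : Disjoint (im S ∪ im M) (im L) := by
    rw [h1, hL]; exact disjoint_sdiff_inter e f
  have hd2 : Disjoint (im S ∪ im M ∪ im L) (im M' ∪ im T) := by
    rw [he', h3]; exact disjoint_sdiff
  refine ⟨_, S, T, _, hw, rfl, ?_, ?_⟩
  · simp only [List.nodup_append, hSn, hMn, hLn, hMn', hTn, List.mem_append, mem_ofFn_iff_mem_im]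
    simp only [Finset.disjoint_left, mem_union] at h2 hd1 hd2 h4
    refine ⟨⟨⟨trivial, trivial, ?_⟩, ⟨trivial, trivial, ?_⟩, ?_⟩, trivial, ?_⟩
    · rintro a ha b hb rfl; exact h2 ha hb
    · rintro a ha b hb rfl; exact hd2 (Or.inr ha) (Or.inl hb)
    · rintro a ha b (hb | hb) rfl
      · exact hd1 ha hb
      · exact hd2 (Or.inl ha) (Or.inl hb)
    · rintro a (ha | ha | ha) b hb rfl
      · exact hd2 (Or.inl ha) (Or.inr hb)
      · exact hd2 (Or.inr ha) (Or.inr hb)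
      · exact h4 ha hb
  · intro x hx
    simp only [List.mem_append, mem_ofFn_iff_mem_im] at hx
    have : x ∈ e ∨ x ∈ f := by
      rw [← he', ← hf']
      simp only [mem_union]
      tauto
    rcases this with h | h
    · exact Finset.disjoint_left.mp heA h
    · exact Finset.disjoint_left.mp hfA h

lemma exists_raws_of_forall {l r N : ℕ} {E : Finset (Finset V)} {A₂ : Finset V}
    (hunif : ∀ e ∈ E, e.card = 2 * l + r + 3)
    (h : ∀ F : Finset V, F.card ≤ N * (2 * l + r + 3) → ∃ e ∈ E, Disjoint e A₂ ∧ Disjoint e F) :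
    ∃ raws : List (ℕ × List V), (∀ q ∈ raws, 1 ≤ q.1 ∧ Raw l r E A₂ q.1 q.2) ∧
      (raws.Pairwise fun q q' => ∀ x ∈ q.2, x ∉ q'.2) ∧ (raws.map Prod.fst).sum = N := by
  suffices H : ∃ (raws : List (ℕ × List V)) (F : Finset V),
      (∀ q ∈ raws, 1 ≤ q.1 ∧ Raw l r E A₂ q.1 q.2) ∧
      (raws.Pairwise fun q q' => ∀ x ∈ q.2, x ∉ q'.2) ∧ (raws.map Prod.fst).sum = N ∧
      F.card ≤ N * (2 * l + r + 3) ∧ ∀ q ∈ raws, ∀ x ∈ q.2, x ∈ F by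
    obtain ⟨raws, F, h1, h2, h3, -⟩ := H
    exact ⟨raws, h1, h2, h3⟩
  induction N with
  | zero => exact ⟨[], ∅, by simp⟩
  | succ N ih =>
    have hN : N * (2 * l + r + 3) ≤ (N + 1) * (2 * l + r + 3) :=
      Nat.mul_le_mul_right _ (Nat.le_succ N)
    obtain ⟨raws, F, h1, h2, h3, h4, h5⟩ := ih fun F hF => h F (hF.trans hN)
    obtain ⟨e, he, heA, heF⟩ := h F (h4.trans hN)
    obtain ⟨xs, hxs, hxe⟩ := exists_raw_of_edge he (hunif e he) heA
    refine ⟨(1, xs) :: raws, e ∪ F, ?_, ?_, ?_, ?_, ?_⟩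
    · intro q hq
      rcases List.mem_cons.mp hq with rfl | hq
      · exact ⟨le_rfl, hxs⟩
      · exact h1 q hq
    · rw [List.pairwise_cons]
      refine ⟨fun q hq x hx hx' => ?_, h2⟩
      exact Finset.disjoint_left.mp heF (hxe x hx) (h5 q hq x hx')
    · simp [h3, add_comm]
    · refine (card_union_le _ _).trans ?_
      rw [hunif e he]
      linarith
    · intro q hq x hx
      rcases List.mem_cons.mp hq with rfl | hq
      · exact mem_union_left _ (hxe x hx)
      · exact mem_union_right _ (h5 q hq x hx)

end SpecialEdges

section Matching

variable {V : Type*} [Fintype V] [DecidableEq V]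

lemma mul_frac_le_of_fiber {Ω Ω' : Type*} [Finite Ω] [Finite Ω'] {s : Set (Ω × Ω')} {z : Set Ω}
    {D : ℝ} (h : ∀ ω ∈ z, D ≤ frac {y | (ω, y) ∈ s}) : D * frac z ≤ frac s := by
  classical
  have := Fintype.ofFinite Ω
  rw [frac_eq_avg, frac_eq_sum_indicator, mul_div_assoc', Finset.mul_sum]
  gcongr with ω
  by_cases hω : ω ∈ z
  · rw [Set.indicator_of_mem hω, mul_one]
    exact h ω hω
  · rw [Set.indicator_of_notMem hω, mul_zero]
    exact frac_nonneg _

lemma im_insertNth {s : ℕ} (i : Fin (s + 1)) (v : V) (y : Fin s → V) :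
    im (i.insertNth (α := fun _ => V) v y) = insert v (im y) := by
  ext w
  simp only [mem_im, mem_insert]
  rw [Fin.exists_iff_succAbove i]
  simp [eq_comm]

lemma frac_edges_hit_le [Nonempty V] {E : Finset (Finset V)} {A F : Finset V} {s : ℕ} {D : ℝ}
    (hD0 : 0 ≤ D) (hD : ∀ v ∉ A, edB E A {v} (Fin s) ≤ D) :
    frac {y : Fin (s + 1) → V | (∃ i, y i ∈ F) ∧ (∀ i, y i ∉ A) ∧ im y ∈ E} ≤
      (s + 1) * (frac (F : Set V) * D) := by
  have h1 : ∀ i : Fin (s + 1),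
      frac {y : Fin (s + 1) → V | y i ∈ F ∧ (∀ i, y i ∉ A) ∧ im y ∈ E} ≤
        frac (F : Set V) * D := by
    intro i
    rw [← frac_preimage_equiv (Fin.insertNthEquiv (fun _ => V) i), mul_comm]
    rw [← frac_fst (Ω' := Fin s → V) (F : Set V)]
    have h2 := frac_le_of_fiber (C := D) (D := 0) (z := ∅)
      (s := (Fin.insertNthEquiv (fun _ => V) i) ⁻¹'
        {y : Fin (s + 1) → V | y i ∈ F ∧ (∀ i, y i ∉ A) ∧ im y ∈ E})
      (t := {q : V × (Fin s → V) | q.1 ∈ (F : Set V)}) hD0 le_rfl (by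
        intro v _
        rw [add_zero]
        by_cases hv : v ∈ F ∧ v ∉ A
        · have h3 := hD v hv.2
          have h4 : frac {y : Fin s → V | (v, y) ∈ {q : V × (Fin s → V) | q.1 ∈ (F : Set V)}}
              = 1 := by
            rw [← frac_univ (Ω := Fin s → V)]
            congr 1
            ext y
            simpa using hv.1
          rw [h4, mul_one]
          refine le_trans (frac_mono ?_) h3
          intro y hy
          simp only [Set.mem_preimage, Fin.insertNthEquiv_apply, Set.mem_ofPred_eq] at hy
          refine ⟨fun j => ?_, by rw [← insert_eq, ← im_insertNth i v y]; exact hy.2.2⟩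
          have := hy.2.1 (i.succAbove j)
          simpa using this
        · refine le_trans (le_of_eq ?_) (mul_nonneg hD0 (frac_nonneg _))
          rw [← frac_empty (Ω := Fin s → V)]
          congr 1
          ext y
          simp only [Set.mem_preimage, Fin.insertNthEquiv_apply, Set.mem_ofPred_eq,
            Set.mem_empty_iff_false, iff_false]
          rintro ⟨h5, h6, -⟩
          have := h6 i
          simp only [Fin.insertNth_apply_same] at h5 this
          exact hv ⟨h5, this⟩)
    rw [frac_empty] at h2
    linarith
  have h2 := frac_biUnion_le univ
    (fun i => {y : Fin (s + 1) → V | y i ∈ F ∧ (∀ i, y i ∉ A) ∧ im y ∈ E}) fun i _ => h1 i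
  refine le_trans (frac_mono ?_) (h2.trans (by simp))
  rintro y ⟨⟨i, hi⟩, h3⟩
  exact ⟨i, mem_univ _, hi, h3⟩

end Matching

section Matching

variable {V : Type*} [Fintype V] [DecidableEq V]

lemma edB_fin_two_ge [Nonempty V] {E : Finset (Finset V)} {A S : Finset V} {c : ℕ}
    (hunif : ∀ e ∈ E, e.card = S.card + 2)
    (hc : c ≤ ((E.filter (· ⊆ Aᶜ)).filter (S ⊆ ·)).card) :
    2 * (c : ℝ) / (Nat.card V : ℝ) ^ 2 ≤ edB E A S (Fin 2) := by
  have h1 := two_mul_card_le_ncard_pairs (E := E.filter (· ⊆ Aᶜ)) (S := S)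
    fun e he => hunif e (mem_filter.mp he).1
  rw [edB_fin_two]
  refine le_trans ?_ (frac_mono (s := {x : V × V | insert x.1 (insert x.2 S) ∈
    E.filter (· ⊆ Aᶜ)}) ?_)
  · unfold frac
    rw [Nat.card_prod, Nat.cast_mul, ← sq]
    gcongr
    exact_mod_cast (Nat.mul_le_mul_left 2 hc).trans h1
  · rintro ⟨a, b⟩ hx
    simp only [Set.mem_ofPred_eq, mem_filter, insert_subset_iff, mem_compl] at hx
    exact ⟨hx.2.1, hx.2.2.1, hx.1⟩

lemma exists_edge_avoiding [Nonempty V] {E : Finset (Finset V)} {A F : Finset V} {j q b : ℕ}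
    {D : ℝ} (hunif : ∀ e ∈ E, e.card = j + 2) (hq : 1 ≤ q)
    (hdeg : ∀ S ⊆ Aᶜ, S.card = j → q * b ≤ ((E.filter (· ⊆ Aᶜ)).filter (S ⊆ ·)).card)
    (hb : Fintype.card V ≤ 4 * b) (hA : Fintype.card V ≤ 2 * Aᶜ.card)
    (hn : 2 ^ (j + 1) * j ^ 2 ≤ Fintype.card V)
    (hD0 : 0 ≤ D) (hD : ∀ v ∉ A, edB E A {v} (Fin (j + 1)) ≤ D)
    (hD1 : 4 * ((j : ℝ) + 2) ^ 2 * D < (1 / 2) ^ (j + 2)) (hF : F.card ≤ 4 * q * (j + 2)) :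
    ∃ e ∈ E, Disjoint e A ∧ Disjoint e F := by
  have hn0 : (0 : ℝ) < Nat.card V := by exact_mod_cast Nat.card_pos
  have hq0 : (0 : ℝ) < q := by exact_mod_cast hq
  have hnn : Nat.card V = Fintype.card V := Nat.card_eq_fintype_card
  have hA' : (1 / 2 : ℝ) ≤ frac ((A : Set V)ᶜ) := by
    unfold frac
    rw [← coe_compl, Set.ncard_coe_finset, le_div_iff₀ hn0, hnn]
    have : (Fintype.card V : ℝ) ≤ 2 * Aᶜ.card := by exact_mod_cast hA
    linarith
  let z : Set (Fin j → V) := {y | (∀ i, y i ∉ A) ∧ Function.Injective y}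
  have hz : (1 / 2 : ℝ) ^ (j + 1) ≤ frac z := by
    have h1 : {y : Fin j → V | ∀ i, y i ∉ A} ⊆ z ∪ {y | ¬ Function.Injective y} := by
      intro y hy
      by_cases h : Function.Injective y
      · exact Or.inl ⟨hy, h⟩
      · exact Or.inr h
    have h2 := frac_le_add h1
    rw [frac_outside_pow, Fintype.card_fin] at h2
    have h3 := frac_not_injective_le (V := V) (ι := Fin j)
    rw [Fintype.card_fin] at h3
    have h4 : (1 / 2 : ℝ) ^ j ≤ frac ((A : Set V)ᶜ) ^ j := by gcongr
    have h5 : (j : ℝ) ^ 2 / Nat.card V ≤ (1 / 2) ^ (j + 1) := by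
      rw [div_le_iff₀ hn0, hnn, one_div, inv_pow, inv_mul_eq_div, le_div_iff₀ (by positivity),
        mul_comm]
      exact_mod_cast hn
    have h6 : (1 / 2 : ℝ) ^ (j + 1) = (1 / 2) ^ j / 2 := by ring
    linarith
  have hlow : q / (2 * Nat.card V) * (1 / 2 : ℝ) ^ (j + 1) ≤ edB E A ∅ (Fin (j + 2)) := by
    rw [edB_congr (Fintype.equivOfCardEq (by simp) : Fin (j + 2) ≃ Fin j ⊕ Fin 2), edB_sum_eq]
    refine le_trans ?_ (mul_frac_le_of_fiber (D := (q : ℝ) / (2 * Nat.card V)) (z := z) ?_)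
    · gcongr
    · rintro y ⟨hyA, hy⟩
      have hc : (im y).card = j := by rw [card_im hy, Fintype.card_fin]
      have h1 := edB_fin_two_ge (A := A) (S := im y) (c := q * b) (by rwa [hc]) (hdeg _ (by
        intro v hv
        obtain ⟨i, rfl⟩ := mem_im.mp hv
        exact mem_compl.mpr (hyA i)) hc)
      unfold edB at h1
      simp only [Set.mem_ofPred_eq, hyA, not_false_eq_true, implies_true, true_and, empty_union]
      refine le_trans ?_ h1
      rw [div_le_div_iff₀ (by positivity) (by positivity)]
      have h2 : (Nat.card V : ℝ) ≤ 4 * b := by rw [hnn]; exact_mod_cast hb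
      push_cast
      nlinarith [mul_le_mul_of_nonneg_left h2 (mul_nonneg hq0.le hn0.le)]
  have hup := frac_edges_hit_le (F := F) hD0 hD
  have hlt : frac {y : Fin (j + 1 + 1) → V | (∃ i, y i ∈ F) ∧ (∀ i, y i ∉ A) ∧ im y ∈ E} <
      frac {y : Fin (j + 2) → V | (∀ i, y i ∉ A) ∧ ∅ ∪ im y ∈ E} := by
    refine lt_of_le_of_lt hup (lt_of_lt_of_le ?_ hlow)
    have h1 : frac (F : Set V) ≤ 4 * q * (j + 2) / Nat.card V := by
      unfold frac
      rw [Set.ncard_coe_finset]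
      gcongr
      exact_mod_cast hF
    have h2 : ((j + 1 : ℕ) + 1 : ℝ) * (frac (F : Set V) * D) ≤
        (q / Nat.card V) * (4 * ((j : ℝ) + 2) ^ 2 * D) := by
      have h3 : (q / Nat.card V : ℝ) * (4 * ((j : ℝ) + 2) ^ 2 * D) =
        ((j + 1 : ℕ) + 1 : ℝ) * ((4 * q * (j + 2) / Nat.card V) * D) := by
        push_cast; ring
      rw [h3]
      gcongr
    refine lt_of_le_of_lt h2 ?_
    have h3 : (q / (2 * Nat.card V) * (1 / 2) ^ (j + 1) : ℝ) =
        (q / Nat.card V) * (1 / 2) ^ (j + 2) := by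
      rw [pow_succ (1 / 2 : ℝ) (j + 1)]
      field_simp
    rw [h3]
    gcongr
  obtain ⟨y, ⟨hyA, hyE⟩, hyF⟩ := exists_mem_notMem_of_frac_lt hlt
  rw [empty_union] at hyE
  refine ⟨im y, hyE, ?_, ?_⟩
  · rw [Finset.disjoint_left]
    intro v hv
    obtain ⟨i, rfl⟩ := mem_im.mp hv
    exact hyA i
  · rw [Finset.disjoint_left]
    intro v hv hvF
    obtain ⟨i, rfl⟩ := mem_im.mp hv
    exact hyF ⟨⟨i, hvF⟩, hyA, hyE⟩

/-- Enough short paths avoiding `A₂` to correct a deficiency of `A₂`. -/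
lemma exists_raws [Nonempty V] {l r m α b : ℕ} {E : Finset (Finset V)} {A₂ : Finset V} {D : ℝ}
    (hunif : ∀ e ∈ E, e.card = 2 * l + r + 3) (hα : α = (m - 1) / 2) (hm : 1 ≤ m)
    (hV : Fintype.card V = α + b)
    (hdeg : ∀ S : Finset V, S.card = 2 * l + r + 1 →
      (Fintype.card V - (2 * l + r + 1)).choose 2 + (if l = 0 ∧ Even m then 2 else 1) ≤
        (E.filter (S ⊆ ·)).card + (b - (2 * l + r + 1)).choose 2)
    (hαb : α ≤ b) (hj : 4 * (2 * l + r + 1) ≤ Fintype.card V)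
    (hn : 2 ^ (2 * l + r + 2) * (2 * l + r + 1) ^ 2 ≤ Fintype.card V)
    (hn' : ∀ N, N = 4 * (2 * l + r + 3) →
      2 * ((N + N * N) + (N + N * N) * (N + N * N) + (2 * l + r + 3)) ≤ Fintype.card V)
    (hD0 : 0 ≤ D) (hD : ∀ v ∉ A₂, edB E A₂ {v} (Fin (2 * l + r + 2)) ≤ D)
    (hD1 : 4 * ((2 * l + r + 1 : ℕ) + 2 : ℝ) ^ 2 * D < (1 / 2) ^ (2 * l + r + 3)) :
    ∃ raws : List (ℕ × List V), (∀ q ∈ raws, 1 ≤ q.1 ∧ Raw l r E A₂ q.1 q.2) ∧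
      (raws.Pairwise fun q q' => ∀ x ∈ q.2, x ∉ q'.2) ∧
      (m : ℤ) - 2 * A₂.card ≤ (raws.map Prod.fst).sum ∧
      (raws.map Prod.fst).sum ≤ 2 * (α - A₂.card) + 2 := by
  rcases le_or_gt m (2 * A₂.card) with hle | hlt
  · exact ⟨[], by simp, by simp, by simp; exact_mod_cast hle, by simp⟩
  obtain ⟨q, hq⟩ : ∃ q, α = A₂.card + q := Nat.exists_eq_add_of_le (by omega)
  have hBc : A₂ᶜ.card = b + q := by rw [card_compl, hV]; omega
  set j := 2 * l + r + 1 with hjdef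
  have hjb : j ≤ b := by omega
  have hB : ∀ S ⊆ A₂ᶜ, S.card = j → q * (b - j) + (if l = 0 ∧ Even m then 2 else 1) ≤
      ((E.filter (· ⊆ A₂ᶜ)).filter (S ⊆ ·)).card := by
    intro S hS hSj
    have h1 := card_edges_within_ge hS (x := if l = 0 ∧ Even m then 2 else 1)
      (b := (b - j).choose 2) (by rw [hSj]; exact hunif) (by rw [hSj]; exact hdeg S hSj)
    have h2 := choose_two_add_mul_le (b - j) q
    rw [hBc, hSj, show b + q - j = b - j + q by omega] at h1
    omega
  have hone : ∀ S ⊆ A₂ᶜ, S.card = j → ∃ e ∈ E.filter (· ⊆ A₂ᶜ), S ⊆ e := by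
    intro S hS hSj
    have h1 := hB S hS hSj
    have h2 : 0 < ((E.filter (· ⊆ A₂ᶜ)).filter (S ⊆ ·)).card := by
      refine lt_of_lt_of_le ?_ h1
      split_ifs <;> omega
    obtain ⟨e, he⟩ := card_pos.mp h2
    exact ⟨e, (mem_filter.mp he).1, (mem_filter.mp he).2⟩
  rcases Nat.eq_zero_or_pos q with rfl | hq0
  · rcases Nat.even_or_odd m with hev | hodd
    · have h1 := exists_inter_card_eq (s := l + 1) (k := 2 * l + r + 3)
        (E := E.filter (· ⊆ A₂ᶜ)) (U := A₂ᶜ) (N := 4 * (2 * l + r + 3)) (by omega) (by omega)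
        (fun e he => hunif e (mem_filter.mp he).1) (fun e he => (mem_filter.mp he).2) le_rfl
        (by have := hn' _ rfl; omega) (by
          rw [show 2 * l + r + 3 - 2 = j by omega]; exact hone)
        (by
          intro hl S hS hSj
          have h2 := hB S hS (by omega)
          rw [if_pos ⟨by omega, hev⟩] at h2
          omega)
      obtain ⟨e, he, f, hf, hef⟩ := h1
      rw [mem_filter] at he hf
      have heA : Disjoint e A₂ := by
        rw [Finset.disjoint_left]; exact fun v hv => mem_compl.mp (he.2 hv)
      have hfA : Disjoint f A₂ := by
        rw [Finset.disjoint_left]; exact fun v hv => mem_compl.mp (hf.2 hv)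
      have hm2 : m ≤ 2 * A₂.card + 2 := by omega
      rcases hef with hef | hef
      · obtain ⟨xs, hxs, hxe⟩ := exists_raw_of_edge he.1 (hunif e he.1) heA
        obtain ⟨ys, hys, hyf⟩ := exists_raw_of_edge hf.1 (hunif f hf.1) hfA
        refine ⟨[(1, xs), (1, ys)], by simp [hxs, hys], ?_, ?_, by simp⟩
        · simp only [List.pairwise_cons, List.mem_singleton, forall_eq, List.not_mem_nil,
            false_imp_iff, implies_true, List.Pairwise.nil, and_true]
          intro x hx hx'
          rw [card_eq_zero] at hef
          have : x ∈ e ∩ f := mem_inter.mpr ⟨hxe x hx, hyf x hx'⟩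
          rw [hef] at this
          exact absurd this (notMem_empty _)
        · simp
          omega
      · obtain ⟨xs, hxs⟩ := exists_raw_of_edge_pair he.1 hf.1 (hunif e he.1) (hunif f hf.1) hef
          heA hfA
        exact ⟨[(2, xs)], by simp [hxs], by simp, by simp; omega, by simp⟩
    · obtain ⟨S, hS, hSj⟩ := exists_subset_card_eq (s := A₂ᶜ) (n := j) (by omega)
      obtain ⟨e, he, -⟩ := hone S hS hSj
      rw [mem_filter] at he
      obtain ⟨xs, hxs, -⟩ := exists_raw_of_edge (A₂ := A₂) he.1 (hunif e he.1) (by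
        rw [Finset.disjoint_left]; exact fun v hv => mem_compl.mp (he.2 hv))
      obtain ⟨a, rfl⟩ := hodd
      exact ⟨[(1, xs)], by simp [hxs], by simp, by simp; omega, by simp⟩
  · obtain ⟨raws, h1, h2, h3⟩ := exists_raws_of_forall (l := l) (r := r) (N := 2 * q + 2)
      (A₂ := A₂) hunif fun F hF => exists_edge_avoiding (j := j) (q := q) (b := b - j) (D := D)
        (F := F) hunif hq0 (fun S hS hSj => (Nat.le_add_right _ _).trans (hB S hS hSj))
        (by omega) (by omega) hn hD0 hD hD1
        (hF.trans (Nat.mul_le_mul_right _ (by omega)))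
    exact ⟨raws, h1, h2, by rw [h3]; push_cast; omega, by rw [h3]; omega⟩

end Matching

section BuildCtx

variable {V : Type*} [Fintype V] [DecidableEq V] {E : Finset (Finset V)} {A T : Finset V}
  {ι κ : Type*} [Fintype ι] [Fintype κ]

lemma edA_add_neA [Nonempty V] :
    edA E A T ι + neA E A T ι = frac (A : Set V) * frac ((A : Set V)ᶜ) ^ Fintype.card ι := by
  rw [← frac_pair_outside]
  unfold edA neA
  rw [← frac_union_of_disjoint]
  · congr 1
    ext q
    simp only [Set.mem_union, Set.mem_ofPred_eq]
    tauto
  · rw [Set.disjoint_left]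
    rintro q ⟨-, -, h⟩ ⟨-, -, h'⟩
    exact h' h

lemma edB_add_neB [Nonempty V] :
    edB E A T ι + neB E A T ι = frac ((A : Set V)ᶜ) ^ Fintype.card ι := by
  rw [← frac_outside_pow]
  unfold edB neB
  rw [← frac_union_of_disjoint]
  · congr 1
    ext q
    simp only [Set.mem_union, Set.mem_ofPred_eq]
    tauto
  · rw [Set.disjoint_left]
    rintro q ⟨-, h⟩ ⟨-, h'⟩
    exact h' h

lemma frac_heavy_edB_vertex_le [Nonempty V] {s : ℕ} {t : ℝ} (ht : 0 < t) :
    frac {v | v ∉ A ∧ t < edB E A {v} (Fin s)} ≤ edB E A ∅ (Fin (s + 1)) / t := by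
  let S : Set (V × (Fin s → V)) := {q | q.1 ∉ A ∧ (∀ i, q.2 i ∉ A) ∧ insert q.1 (im q.2) ∈ E}
  have h1 : frac S = edB E A ∅ (Fin (s + 1)) := by
    unfold edB
    rw [← frac_preimage_equiv (Fin.consEquiv fun _ : Fin (s + 1) => V)]
    congr 1
    ext ⟨v, y⟩
    have h : im (Fin.consEquiv (fun _ : Fin (s + 1) => V) (v, y)) = insert v (im y) := im_cons v y
    simp [S, h, Fin.forall_fin_succ, and_assoc]
  rw [← h1]
  refine le_trans (frac_mono ?_) (frac_heavy_le ht)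
  rintro v ⟨hv, h⟩
  refine lt_of_lt_of_le h (frac_mono ?_)
  rintro y ⟨hy, hy'⟩
  exact ⟨hv, hy, by rwa [insert_eq]⟩

lemma frac_heavy_neB_vertex_le {t : ℝ} (ht : 0 < t) :
    frac {v | v ∈ A ∧ t < neB E A {v} ι} ≤ neA E A ∅ ι / t := by
  let S : Set (V × (ι → V)) :=
    {q | q.1 ∈ A ∧ (∀ i, q.2 i ∉ A) ∧ insert q.1 (∅ ∪ im q.2) ∉ E}
  have h1 : frac S = neA E A ∅ ι := rfl
  rw [← h1]
  refine le_trans (frac_mono ?_) (frac_heavy_le ht)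
  rintro v ⟨hv, h⟩
  refine lt_of_lt_of_le h (frac_mono ?_)
  rintro y ⟨hy, hy'⟩
  exact ⟨hv, hy, by rwa [empty_union, insert_eq]⟩

lemma edB_nonneg : 0 ≤ edB E A T ι := frac_nonneg _

lemma exists_ctx [Nonempty V] {l r : ℕ} (hunif : ∀ e ∈ E, e.card = 2 * l + r + 3)
    (hdeg : ∀ S : Finset V, S.card = 2 * l + r + 1 → (Fintype.card V - (2 * l + r + 1)).choose 2 ≤
      (E.filter (S ⊆ ·)).card + (Aᶜ.card - (2 * l + r + 1)).choose 2)
    {p γ τ ε η ξ β : ℝ} (hp : 0 < p) (hp1 : p ≤ 1) (hγ : 0 < γ) (hτ : 0 < τ) (hτp : τ ≤ p / 8)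
    (hεp : ε ≤ p ^ 2 / 16) (hγε : γ ≤ ε / 2)
    (hprod : ∀ j ≤ 2 * (2 * l + r + 3), 2 * p ≤ frac (A : Set V) * frac ((A : Set V)ᶜ) ^ j)
    (hη : ((2 * l + r + 1 : ℕ) + 1 + 2 * ((2 * l + r + 1 : ℕ) : ℝ) ^ 2) / Nat.card V ≤ η)
    (hξ : edB E A ∅ (Fin (2 * l + r + 3)) ≤ ξ)
    (hδ : ξ / 2 + η ≤ τ * γ / 8) (hβ : 3 * (ξ / 2 + η) ≤ β * ε) :
    ∃ Bad A₂ : Finset V, Ctx l r E A Bad A₂ p γ τ ε ∧ frac (Bad : Set V) ≤ β ∧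
      ∀ v ∉ A₂, edB E A {v} (Fin (2 * l + r + 2)) ≤ ε := by
  classical
  have hξ0 : 0 ≤ ξ := edB_nonneg.trans hξ
  have hη0 : 0 ≤ η := le_trans (by positivity) hη
  have hε : 0 < ε := by linarith
  have hpp : p ^ 2 ≤ p := by nlinarith
  have hτγ : τ * γ / 8 ≤ γ := by nlinarith
  have hηγ : η ≤ γ := by linarith
  have key (T : Finset V) (κ ι : Type) [Fintype κ] [Fintype ι]
      (hT : T.card + Fintype.card κ = 2 * l + r + 1)
      (hι : Fintype.card ι = Fintype.card κ + 1) :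
      neA E A T ι ≤ edB E A T (κ ⊕ Fin 2) / 2 + η :=
    (neA_le_edB (κ := κ) (j := 2 * l + r + 1) hunif hdeg hT hι).trans (by gcongr)
  have hfrac (j : ℕ) (hj : j ≤ 2 * (2 * l + r + 3)) : 2 * p ≤ frac ((A : Set V)ᶜ) ^ j := by
    refine (hprod j hj).trans (mul_le_of_le_one_left ?_ (frac_le_one _))
    exact pow_nonneg (frac_nonneg _) _
  have hempty (ι : Type) [Fintype ι] (hι : Fintype.card ι = 2 * l + r + 2) :
      neA E A ∅ ι ≤ ξ / 2 + η := by
    refine (key ∅ (Fin (2 * l + r + 1)) ι (by simp) (by simp [hι])).trans ?_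
    rw [edB_congr (Fintype.equivOfCardEq (by simp) :
      Fin (2 * l + r + 1) ⊕ Fin 2 ≃ Fin (2 * l + r + 3))]
    linarith
  let A₂ : Finset V := univ.filter fun v => ε < edB E A {v} (Fin (2 * l + r + 2))
  let Bad₁ : Finset V := univ.filter fun v => v ∈ A ∧ ε < neB E A {v} (Fin (2 * l + r + 2))
  let Bad₂ : Finset V := univ.filter fun v => v ∉ A ∧ ε < edB E A {v} (Fin (2 * l + r + 2))
  have hA₂ (v : V) (hv : v ∉ A₂) : edB E A {v} (Fin (2 * l + r + 2)) ≤ ε := by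
    simpa [A₂] using hv
  have hgood (a : V) (ha : a ∈ A) (hb : a ∉ Bad₁ ∪ Bad₂) (ι : Type) [Fintype ι]
      (hι : Fintype.card ι = 2 * l + r + 2) : neB E A {a} ι ≤ ε := by
    rw [neB_congr (Fintype.equivOfCardEq (by simp [hι]) : ι ≃ Fin (2 * l + r + 2))]
    simpa [Bad₁, Bad₂, ha] using hb
  refine ⟨Bad₁ ∪ Bad₂, A₂, ?_, ?_, hA₂⟩
  · refine ⟨hp, hγ, by linarith, hτ, hτp, hε, by linarith, hunif, fun j hj => ?_, ?_, ?_, ?_, ?_,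
      hgood, fun ι _ hι => (hempty ι hι).trans (by linarith), ?_, ?_, ?_⟩
    · linarith [hprod j hj]
    · have h1 := frac_heavy_neA_le (κ := Fin (l + 1)) hτ
        (hempty (Fin (l + 1) ⊕ (Fin (r + 1) ⊕ Fin l)) (by simp; omega))
      have h2 : (ξ / 2 + η) / τ ≤ γ / 8 := by
        rw [div_le_iff₀ hτ]; linarith
      refine le_trans (frac_mono ?_) (h1.trans h2)
      rintro x ⟨hx, hx'⟩
      refine ⟨hx, ?_⟩
      rw [empty_union]
      exact not_le.1 hx'
    · intro a ha hb
      have h1 := frac_heavy_neB_le (κ := Fin l) hp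
        (hgood a ha hb (Fin l ⊕ (Fin (r + 1) ⊕ Fin (l + 1))) (by simp; omega))
      have h2 : ε / p ≤ p / 8 := by
        rw [div_le_iff₀ hp]; nlinarith
      refine le_trans (frac_mono ?_) (h1.trans h2)
      rintro R ⟨hR, hR'⟩
      refine ⟨hR, ?_⟩
      unfold Rich at hR'
      rw [not_le, insert_eq] at hR'
      have h3 := edB_add_neB (E := E) (A := A) (T := {a} ∪ im R)
        (ι := Fin (r + 1) ⊕ Fin (l + 1))
      have h4 := hfrac (Fintype.card (Fin (r + 1) ⊕ Fin (l + 1))) (by simp; omega)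
      linarith
    · intro v hv
      have hv : ε < edB E A {v} (Fin (2 * l + r + 2)) := by simpa [A₂] using hv
      rw [edB_congr (Fintype.equivOfCardEq (by simp; omega) :
        Fin (2 * l + r + 2) ≃ Fin l ⊕ (Fin (r + 1) ⊕ Fin (l + 1))), edB_sum_eq] at hv
      have h1 := hv.le.trans (frac_le_rich_add hγ.le)
      have h2 : γ ≤ frac {R : Fin l → V | γ ≤ frac {y | (R, y) ∈
          {q : (Fin l → V) × (Fin (r + 1) ⊕ Fin (l + 1) → V) | (∀ i, q.1 i ∉ A) ∧
            (∀ i, q.2 i ∉ A) ∧ {v} ∪ im q.1 ∪ im q.2 ∈ E}}} := by linarith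
      refine h2.trans (frac_mono ?_)
      intro R hR
      have hR : γ ≤ frac {y | (R, y) ∈
          {q : (Fin l → V) × (Fin (r + 1) ⊕ Fin (l + 1) → V) | (∀ i, q.1 i ∉ A) ∧
            (∀ i, q.2 i ∉ A) ∧ {v} ∪ im q.1 ∪ im q.2 ∈ E}} := hR
      refine ⟨?_, hR.trans (frac_mono ?_)⟩
      · by_contra hc
        have : {y | (R, y) ∈
          {q : (Fin l → V) × (Fin (r + 1) ⊕ Fin (l + 1) → V) | (∀ i, q.1 i ∉ A) ∧
            (∀ i, q.2 i ∉ A) ∧ {v} ∪ im q.1 ∪ im q.2 ∈ E}} = ∅ := by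
          ext y
          simp only [Set.mem_ofPred_eq, Set.mem_empty_iff_false, iff_false]
          exact fun h => hc h.1
        rw [this, frac_empty] at hR
        linarith
      · rintro y ⟨-, hy, hy'⟩
        exact ⟨hy, by rwa [insert_eq]⟩
    · intro v hv ι _ hι
      refine (key {v} (Fin (2 * l + r)) ι (by simp; omega) (by simp [hι])).trans ?_
      rw [edB_congr (Fintype.equivOfCardEq (by simp) :
        Fin (2 * l + r) ⊕ Fin 2 ≃ Fin (2 * l + r + 2))]
      linarith [hA₂ v hv]
    · intro L hL
      by_contra! hc
      have h1 := key L (Fin (l + r)) (Fin (r + 1) ⊕ Fin l) (by simp; omega) (by simp; omega)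
      rw [edB_congr (Fintype.equivOfCardEq (by simp; omega) :
        Fin (l + r) ⊕ Fin 2 ≃ Fin (r + 1) ⊕ Fin (l + 1))] at h1
      have h2 := edA_add_neA (E := E) (A := A) (T := L) (ι := Fin (r + 1) ⊕ Fin l)
      have h3 := hprod (Fintype.card (Fin (r + 1) ⊕ Fin l)) (by simp; omega)
      linarith [hc.1, hc.2]
    · intro a ha hb
      have h1 := hgood a ha hb (Fin (2 * l + r + 2)) (by simp)
      have h2 := edB_add_neB (E := E) (A := A) (T := {a}) (ι := Fin (2 * l + r + 2))
      have h3 := hfrac (Fintype.card (Fin (2 * l + r + 2))) (by simp; omega)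
      simp only [A₂, mem_filter, mem_univ, true_and]
      linarith
    · intro v hv hb hv'
      refine hb (mem_union_right _ ?_)
      simp only [A₂, Bad₂, mem_filter, mem_univ, true_and] at hv' ⊢
      exact ⟨hv, hv'⟩
  · rw [coe_union]
    have h1 : frac (Bad₁ : Set V) ≤ (ξ / 2 + η) / ε := by
      have h := frac_heavy_neB_vertex_le (E := E) (A := A) (ι := Fin (2 * l + r + 2)) hε
      have h' : (Bad₁ : Set V) = {v | v ∈ A ∧ ε < neB E A {v} (Fin (2 * l + r + 2))} := by
        ext; simp [Bad₁]
      rw [h']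
      exact h.trans (by gcongr; exact hempty _ (by simp))
    have h2 : frac (Bad₂ : Set V) ≤ ξ / ε := by
      have h := frac_heavy_edB_vertex_le (E := E) (A := A) (s := 2 * l + r + 2) hε
      have h' : (Bad₂ : Set V) = {v | v ∉ A ∧ ε < edB E A {v} (Fin (2 * l + r + 2))} := by
        ext; simp [Bad₂]
      rw [h']
      exact h.trans (by gcongr)
    refine (frac_union_le _ _).trans ((add_le_add h1 h2).trans ?_)
    rw [← add_div, div_le_iff₀ hε]
    linarith

end BuildCtx

section Assembly

variable {V : Type*} [Fintype V] [DecidableEq V]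

lemma edB_le_of_sdiff_subset [Nonempty V] {E : Finset (Finset V)} {A A₂ Bad T : Finset V}
    {ι : Type*} [Fintype ι] (h : A \ A₂ ⊆ Bad) :
    edB E A₂ T ι ≤ edB E A T ι + Fintype.card ι * frac (Bad : Set V) := by
  unfold edB
  refine (frac_le_add ?_).trans (add_le_add_right (frac_hit_le (Bad : Set V)) _)
  rintro y ⟨hy, hy'⟩
  by_cases hc : ∃ i, y i ∈ A
  · obtain ⟨i, hi⟩ := hc
    exact Or.inr ⟨i, h (mem_sdiff.2 ⟨hi, hy i⟩)⟩
  · exact Or.inl ⟨fun i hi => hc ⟨i, hi⟩, hy'⟩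

lemma hasHamCycle_of_seg {l r m n t : ℕ} {E : Finset (Finset (Fin n))}
    {A Bad A₂ : Finset (Fin n)} {xs : List (Fin n)} {p γ τ ε q θ : ℝ}
    (h : Ctx l r E A Bad A₂ p γ τ ε) (hn : n = m * (l + r + 2)) (hm : 400 ≤ m)
    (hseg : Seg l r E A A₂ τ (m - 2 * A₂.card) t xs) (hbadxs : ∀ v ∈ Bad, v ∈ xs)
    (htR : (t : ℝ) ≤ m / 2)
    (hq : 0 < q) (hqΛ : 3 * q * (8 * (l + r + 2 : ℕ) : ℝ) ^ (l + 1) ≤ 1) (hγq : γ / 8 ≤ q)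
    (hnq : ((l + 1 : ℕ) : ℝ) ^ 2 / n ≤ q) (hθ₀ : 0 ≤ θ) (hθ : ε / τ / q ≤ θ)
    (hlog : Real.log n ≤ θ * (n / (8 * (l + r + 2 : ℕ))))
    (hcond : ((l + 2 * r + 2 : ℕ) + 2) * ((8 * (l + r + 2 : ℕ) : ℝ) ^ (l + 2 * r + 3) * (2 * τ) +
      8 * θ + 2 * (8 * (l + r + 2 : ℕ)) / n) +
      ((l + 2 * r + 2 : ℕ) + 2 : ℝ) ^ 2 * (8 * (l + r + 2 : ℕ)) / n < 1) :
    HasHamCycle n (2 * l + r + 3) (l + 1) E := by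
  have hd : (0 : ℝ) < (l + r + 2 : ℕ) := by positivity
  have hm0 : (400 : ℝ) ≤ m := by exact_mod_cast hm
  have hnm : (n : ℝ) = m * (l + r + 2 : ℕ) := by exact_mod_cast hn
  have hn0 : (0 : ℝ) < n := by rw [hnm]; positivity
  have hcard : Nat.card (Fin n) = n := Nat.card_fin n
  have htm : 2 * t ≤ m := by
    have : (2 : ℝ) * t ≤ m := by linarith
    exact_mod_cast this
  obtain ⟨s, hs⟩ : ∃ s, t + 2 * (s + 1) = m := by
    obtain ⟨-, -, -, -, -, -, -, -, hz⟩ := hseg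
    exact ⟨(m - t) / 2 - 1, by omega⟩
  have hsm : m ≤ 8 * s := by omega
  have hsR : (m : ℝ) ≤ 8 * s := by exact_mod_cast hsm
  have hns : (n : ℝ) ≤ 8 * (l + r + 2 : ℕ) * s := by
    rw [hnm]; nlinarith
  have hns' : (n : ℝ) / (8 * (l + r + 2 : ℕ)) ≤ s := by
    rw [div_le_iff₀ (by positivity)]; linarith
  have hs1 : (1 : ℝ) / (s + 1) ≤ 8 * (l + r + 2 : ℕ) / n := by
    rw [div_le_div_iff₀ (by positivity) hn0]
    nlinarith
  have e1 : (2 : ℝ) / (s + 1) ≤ 2 * (8 * (l + r + 2 : ℕ)) / n := by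
    calc (2 : ℝ) / (s + 1) = 2 * (1 / (s + 1)) := by ring
      _ ≤ 2 * (8 * (l + r + 2 : ℕ) / n) := by gcongr
      _ = _ := by ring
  have e2 : ((l + 2 * r + 2 : ℕ) + 2 : ℝ) ^ 2 / (s + 1) ≤
      ((l + 2 * r + 2 : ℕ) + 2 : ℝ) ^ 2 * (8 * (l + r + 2 : ℕ)) / n := by
    calc ((l + 2 * r + 2 : ℕ) + 2 : ℝ) ^ 2 / (s + 1)
        = ((l + 2 * r + 2 : ℕ) + 2 : ℝ) ^ 2 * (1 / (s + 1)) := by ring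
      _ ≤ ((l + 2 * r + 2 : ℕ) + 2 : ℝ) ^ 2 * (8 * (l + r + 2 : ℕ) / n) := by gcongr
      _ = _ := by ring
  have hlog' : Real.log n ≤ θ * s := hlog.trans (by gcongr)
  have hd1 : (1 : ℝ) ≤ (l + r + 2 : ℕ) := by exact_mod_cast (by omega : 1 ≤ l + r + 2)
  obtain ⟨L, vs, hwalk, hcover⟩ := h.exists_closed_walk hseg hbadxs (by rw [hcard, hn]) hs
    (Λ := 8 * (l + r + 2 : ℕ)) (q := q) (θ := θ) (by linarith) (by rw [hcard]; exact hns) hq hqΛ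
    hγq (by rw [hcard]; exact hnq) hθ (by rw [hcard]; exact hlog') (by
      refine lt_of_le_of_lt ?_ hcond
      gcongr)
  exact hwalk.hasHamCycle hn (by omega) hcover

lemma hasHamCycle_of_ctx {l r m n : ℕ} {E : Finset (Finset (Fin n))} {A Bad A₂ : Finset (Fin n)}
    {p γ τ ε β q θ : ℝ} (h : Ctx l r E A Bad A₂ p γ τ ε) (hn : n = m * (l + r + 2))
    (hm : 400 ≤ m) (hA : A.card = (m - 1) / 2)
    (hdeg : ∀ S : Finset (Fin n), S.card = 2 * l + r + 1 →
      (n - (2 * l + r + 1)).choose 2 + (if l = 0 ∧ Even m then 2 else 1) ≤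
        (E.filter (S ⊆ ·)).card + (Aᶜ.card - (2 * l + r + 1)).choose 2)
    (hBad : frac (Bad : Set (Fin n)) ≤ β)
    (hedB : ∀ v ∉ A₂, edB E A {v} (Fin (2 * l + r + 2)) ≤ ε)
    (hn₁ : 4 * (2 * l + r + 1) ≤ n)
    (hn₂ : 2 ^ (2 * l + r + 2) * (2 * l + r + 1) ^ 2 ≤ n)
    (hn₃ : ∀ N, N = 4 * (2 * l + r + 3) →
      2 * ((N + N * N) + (N + N * N) * (N + N * N) + (2 * l + r + 3)) ≤ n)
    (hD : 4 * ((2 * l + r + 1 : ℕ) + 2 : ℝ) ^ 2 * (ε + (2 * l + r + 2 : ℕ) * β) <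
      (1 / 2) ^ (2 * l + r + 3))
    (hβ : 100 * β * (l + r + 2 : ℕ) ≤ 1 / 4)
    (hw : (2 * (2 * l + r + 3 : ℕ) + 1 : ℝ) * (100 * (2 * l + r + 3 : ℕ) * (2 * β + 3 / n)) +
      (2 * (2 * l + r + 3 : ℕ) + 1 : ℝ) ^ 2 / n ≤ γ / 16)
    (hq : 0 < q) (hqΛ : 3 * q * (8 * (l + r + 2 : ℕ) : ℝ) ^ (l + 1) ≤ 1) (hγq : γ / 8 ≤ q)
    (hnq : ((l + 1 : ℕ) : ℝ) ^ 2 / n ≤ q) (hθ₀ : 0 ≤ θ) (hθ : ε / τ / q ≤ θ)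
    (hlog : Real.log n ≤ θ * (n / (8 * (l + r + 2 : ℕ))))
    (hcond : ((l + 2 * r + 2 : ℕ) + 2) * ((8 * (l + r + 2 : ℕ) : ℝ) ^ (l + 2 * r + 3) * (2 * τ) +
      8 * θ + 2 * (8 * (l + r + 2 : ℕ)) / n) +
      ((l + 2 * r + 2 : ℕ) + 2 : ℝ) ^ 2 * (8 * (l + r + 2 : ℕ)) / n < 1) :
    HasHamCycle n (2 * l + r + 3) (l + 1) E := by
  have hd : (0 : ℝ) < (l + r + 2 : ℕ) := by positivity
  have hm0 : (400 : ℝ) ≤ m := by exact_mod_cast hm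
  have hnm : (n : ℝ) = m * (l + r + 2 : ℕ) := by exact_mod_cast hn
  have hn0 : (0 : ℝ) < n := by rw [hnm]; positivity
  have hnpos : 0 < n := by exact_mod_cast hn0
  have : Nonempty (Fin n) := ⟨⟨0, hnpos⟩⟩
  have hcard : Nat.card (Fin n) = n := Nat.card_fin n
  have hβ0 : 0 ≤ β := (frac_nonneg _).trans hBad
  have hBadc : (Bad.card : ℝ) ≤ β * n := by
    rw [frac, Set.ncard_coe_finset, hcard, div_le_iff₀ hn0] at hBad
    exact hBad
  have hsub : A \ A₂ ⊆ Bad := fun a ha => by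
    by_contra hc
    exact (mem_sdiff.1 ha).2 (h.mem_A₂ a (mem_sdiff.1 ha).1 hc)
  have hsub' : A₂ ⊆ A ∪ Bad := fun a ha => by
    by_contra hc
    rw [mem_union, not_or] at hc
    exact h.notMem_A₂ a hc.1 hc.2 ha
  have hc1 : A.card - A₂.card ≤ Bad.card := (le_card_sdiff A₂ A).trans (card_le_card hsub)
  have hc2 : A₂.card ≤ A.card + Bad.card := (card_le_card hsub').trans (card_union_le _ _)
  have hAc : A.card + Aᶜ.card = n := by rw [card_add_card_compl, Fintype.card_fin]
  have hmn : m * 2 ≤ n := by rw [hn]; exact Nat.mul_le_mul_left m (by omega)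
  obtain ⟨raws, hraw, hdisj, hsum, hsum'⟩ := exists_raws (l := l) (r := r) (m := m) (α := A.card)
    (b := Aᶜ.card) (E := E) (A₂ := A₂) h.uniform hA (by omega) (by rw [Fintype.card_fin, hAc])
    (by simpa using hdeg) (by omega) (by simpa using hn₁) (by simpa using hn₂) (by simpa using hn₃)
    (D := ε + (2 * l + r + 2 : ℕ) * β) (by have := h.ε_pos; positivity)
    (fun v hv => (edB_le_of_sdiff_subset hsub).trans (by
      rw [Fintype.card_fin]
      exact add_le_add (hedB v hv) (by gcongr))) hD
  set b := 2 * Bad.card + 2 with hb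
  have hbR : (b : ℝ) ≤ 2 * β * n + 2 := by rw [hb]; push_cast; linarith
  obtain ⟨t, xs, hseg, hbadxs, ht⟩ := h.exists_absorbing
    (N := 100 * (b + 1) * (2 * l + r + 3)) (D := (m : ℤ) - 2 * A₂.card) (b := b) (fun F hF => by
      refine le_trans ?_ hw
      unfold weight
      rw [hcard, frac, Set.ncard_coe_finset, hcard]
      gcongr
      rw [div_le_iff₀ hn0]
      calc (F.card : ℝ) ≤ (100 * (b + 1) * (2 * l + r + 3) : ℕ) := by exact_mod_cast hF
        _ = 100 * (2 * l + r + 3 : ℕ) * (b + 1) := by push_cast; ring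
        _ ≤ 100 * (2 * l + r + 3 : ℕ) * (2 * β * n + 3) :=
          mul_le_mul_of_nonneg_left (by linarith) (by positivity)
        _ = 100 * (2 * l + r + 3 : ℕ) * (2 * β + 3 / n) * n := by field_simp)
    raws hraw hdisj hsum (by omega) (by omega) (by omega) le_rfl
  have htR : (t : ℝ) ≤ m / 2 := by
    have h1 : (t : ℝ) ≤ 50 * b := by exact_mod_cast ht
    have h2 : 100 * β * n ≤ m / 4 := by rw [hnm]; nlinarith
    linarith
  exact hasHamCycle_of_seg h hn hm hseg hbadxs htR hq hqΛ hγq hnq hθ₀ hθ hlog hcond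

end Assembly

section Parameters

open Filter

lemma eventually_div_le (c : ℝ) {x : ℝ} (hx : 0 < x) : ∀ᶠ n : ℕ in atTop, c / n ≤ x :=
  (tendsto_const_div_atTop_nhds_zero_nat c).eventually_le_const hx

lemma eventually_log_le {c : ℝ} (hc : 0 < c) : ∀ᶠ n : ℕ in atTop, Real.log n ≤ c * n := by
  have h := (Real.isLittleO_log_id_atTop.bound hc).filter_mono le_rfl
  filter_upwards [tendsto_natCast_atTop_atTop.eventually h] with n hn
  have h1 := (le_abs_self _).trans hn
  simpa using h1

lemma exists_parameters {p : ℝ} (hp : 0 < p) (l r : ℕ) :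
    ∃ γ τ ε β q θ δ : ℝ, 0 < γ ∧ 0 < τ ∧ 0 < β ∧ 0 < q ∧ 0 < θ ∧ 0 < δ ∧ τ ≤ p / 8 ∧
      ε ≤ p ^ 2 / 16 ∧ γ ≤ ε / 2 ∧ δ ≤ τ * γ / 8 ∧ 3 * δ ≤ β * ε ∧
      4 * ((2 * l + r + 1 : ℕ) + 2 : ℝ) ^ 2 * (ε + (2 * l + r + 2 : ℕ) * β) <
        (1 / 2) ^ (2 * l + r + 3) ∧
      100 * β * (l + r + 2 : ℕ) ≤ 1 / 4 ∧
      3 * q * (8 * (l + r + 2 : ℕ) : ℝ) ^ (l + 1) ≤ 1 ∧ γ / 8 ≤ q ∧ ε / τ / q ≤ θ ∧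
      ∀ᶠ n : ℕ in atTop,
        ((2 * l + r + 1 : ℕ) + 1 + 2 * ((2 * l + r + 1 : ℕ) : ℝ) ^ 2) / n ≤ δ / 2 ∧
        (2 * (2 * l + r + 3 : ℕ) + 1 : ℝ) * (100 * (2 * l + r + 3 : ℕ) * (2 * β + 3 / n)) +
          (2 * (2 * l + r + 3 : ℕ) + 1 : ℝ) ^ 2 / n ≤ γ / 16 ∧
        ((l + 1 : ℕ) : ℝ) ^ 2 / n ≤ q ∧
        Real.log n ≤ θ * (n / (8 * (l + r + 2 : ℕ))) ∧
        ((l + 2 * r + 2 : ℕ) + 2) * ((8 * (l + r + 2 : ℕ) : ℝ) ^ (l + 2 * r + 3) * (2 * τ) +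
          8 * θ + 2 * (8 * (l + r + 2 : ℕ)) / n) +
          ((l + 2 * r + 2 : ℕ) + 2 : ℝ) ^ 2 * (8 * (l + r + 2 : ℕ)) / n < 1 := by
  have hΛ : (0 : ℝ) < 8 * (l + r + 2 : ℕ) := by positivity
  have hC : (0 : ℝ) < (l + 2 * r + 2 : ℕ) + 2 := by positivity
  have hK : (0 : ℝ) < (2 * l + r + 3 : ℕ) := by positivity
  have hj : (0 : ℝ) < (2 * l + r + 1 : ℕ) + 2 := by positivity
  have hk : (0 : ℝ) < (2 * l + r + 2 : ℕ) := by positivity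
  have hd : (0 : ℝ) < (l + r + 2 : ℕ) := by positivity
  generalize ((l + r + 2 : ℕ) : ℝ) = d at *
  generalize ((l + 2 * r + 2 : ℕ) + 2 : ℝ) = C at *
  generalize ((2 * l + r + 3 : ℕ) : ℝ) = K at *
  generalize ((2 * l + r + 1 : ℕ) : ℝ) = j at *
  generalize ((2 * l + r + 2 : ℕ) : ℝ) = k at *
  generalize 8 * d = Λ at *
  obtain ⟨θ, hθ, hθC⟩ : ∃ θ : ℝ, 0 < θ ∧ C * (8 * θ) = 1 / 4 :=
    ⟨1 / (32 * C), by positivity, by field_simp; norm_num⟩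
  obtain ⟨τ, hτ, hτp, hτC⟩ : ∃ τ : ℝ, 0 < τ ∧ τ ≤ p / 8 ∧
      C * (Λ ^ (l + 2 * r + 3) * (2 * τ)) ≤ 1 / 4 := by
    refine ⟨min (p / 8) (1 / (8 * C * Λ ^ (l + 2 * r + 3))), by positivity, min_le_left _ _, ?_⟩
    calc C * (Λ ^ (l + 2 * r + 3) * (2 * _))
        ≤ C * (Λ ^ (l + 2 * r + 3) * (2 * (1 / (8 * C * Λ ^ (l + 2 * r + 3))))) := by
          gcongr; exact min_le_right _ _
      _ = 1 / 4 := by field_simp; norm_num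
  obtain ⟨q, hq, hqΛ⟩ : ∃ q : ℝ, 0 < q ∧ 3 * q * Λ ^ (l + 1) ≤ 1 :=
    ⟨1 / (3 * Λ ^ (l + 1)), by positivity, le_of_eq (by field_simp)⟩
  obtain ⟨x, hx, hxj⟩ : ∃ x : ℝ, 0 < x ∧ 4 * (j + 2) ^ 2 * (x + x) <
      (1 / 2) ^ (2 * l + r + 3) := by
    refine ⟨(1 / 2) ^ (2 * l + r + 3) / (16 * (j + 2) ^ 2), by positivity, ?_⟩
    have h0 : (0 : ℝ) < (1 / 2) ^ (2 * l + r + 3) := by positivity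
    calc _ = (1 / 2 : ℝ) ^ (2 * l + r + 3) / 2 := by field_simp; norm_num
      _ < _ := by linarith
  obtain ⟨ε, hε, hε1, hε2, hε3⟩ : ∃ ε : ℝ, 0 < ε ∧ ε ≤ θ * q * τ ∧ ε ≤ p ^ 2 / 16 ∧ ε ≤ x :=
    ⟨min (θ * q * τ) (min (p ^ 2 / 16) x), by positivity, min_le_left _ _,
      (min_le_right _ _).trans (min_le_left _ _), (min_le_right _ _).trans (min_le_right _ _)⟩
  obtain ⟨γ, hγ, hγ1, hγ2⟩ : ∃ γ : ℝ, 0 < γ ∧ γ ≤ ε / 2 ∧ γ ≤ 8 * q :=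
    ⟨min (ε / 2) (8 * q), by positivity, min_le_left _ _, min_le_right _ _⟩
  obtain ⟨β, hβ, hβ1, hβ2, hβ3⟩ : ∃ β : ℝ, 0 < β ∧ k * β ≤ x ∧
      (2 * K + 1) * (100 * K * (2 * β)) ≤ γ / 32 ∧ 100 * β * d ≤ 1 / 4 := by
    refine ⟨min (x / k) (min (γ / (32 * (200 * K * (2 * K + 1)))) (1 / (400 * d))),
      by positivity, ?_, ?_, ?_⟩
    · calc k * _ ≤ k * (x / k) := by gcongr; exact min_le_left _ _
        _ = x := by field_simp
    · calc (2 * K + 1) * (100 * K * (2 * _))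
          ≤ (2 * K + 1) * (100 * K * (2 * (γ / (32 * (200 * K * (2 * K + 1)))))) := by
            gcongr; exact (min_le_right _ _).trans (min_le_left _ _)
        _ = γ / 32 := by field_simp; norm_num
    · calc 100 * _ * d ≤ 100 * (1 / (400 * d)) * d := by
            gcongr; exact (min_le_right _ _).trans (min_le_right _ _)
        _ = 1 / 4 := by field_simp; norm_num
  obtain ⟨δ, hδ, hδ1, hδ2⟩ : ∃ δ : ℝ, 0 < δ ∧ δ ≤ τ * γ / 8 ∧ δ ≤ β * ε / 3 :=
    ⟨min (τ * γ / 8) (β * ε / 3), by positivity, min_le_left _ _, min_le_right _ _⟩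
  refine ⟨γ, τ, ε, β, q, θ, δ, hγ, hτ, hβ, hq, hθ, hδ, hτp, hε2, hγ1, hδ1, by linarith, ?_, hβ3,
    hqΛ, by linarith, ?_, ?_⟩
  · refine lt_of_le_of_lt ?_ hxj
    gcongr
  · rw [div_div, div_le_iff₀ (by positivity)]
    linarith
  filter_upwards [eventually_div_le (j + 1 + 2 * j ^ 2) (half_pos hδ),
    eventually_div_le ((2 * K + 1) * (100 * K * 3) + (2 * K + 1) ^ 2) (x := γ / 32) (by positivity),
    eventually_div_le (((l + 1 : ℕ) : ℝ) ^ 2) hq,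
    eventually_log_le (c := θ / Λ) (by positivity),
    eventually_div_le (C * (2 * Λ) + C ^ 2 * Λ) (x := 1 / 4) (by norm_num)] with n h1 h2 h3 h4 h5
  refine ⟨h1, ?_, h3, ?_, ?_⟩
  · calc _ = (2 * K + 1) * (100 * K * (2 * β)) +
          ((2 * K + 1) * (100 * K * 3) + (2 * K + 1) ^ 2) / n := by ring
      _ ≤ γ / 16 := by linarith
  · calc _ ≤ θ / Λ * n := h4
      _ = _ := by ring
  · calc _ = C * (Λ ^ (l + 2 * r + 3) * (2 * τ)) + C * (8 * θ) +
          (C * (2 * Λ) + C ^ 2 * Λ) / n := by ring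
      _ < 1 := by linarith

end Parameters

section Extremal

lemma edB_empty_le {n k : ℕ} (hn : 0 < n) {E : Finset (Finset (Fin n))} {A B : Finset (Fin n)}
    (hunif : Uniform n k E) (hun : A ∪ B = univ) {ξ : ℝ} (hξ : 0 ≤ ξ)
    (hE : (edgesIn E B : ℝ) ≤ ξ * (n.choose k : ℝ)) :
    edB E A ∅ (Fin k) ≤ ξ * (k : ℝ) ^ k := by
  let U : Finset (Fin k → Fin n) := (E.filter (· ⊆ B)).biUnion fun e => Fintype.piFinset fun _ => e
  have hU : U.card ≤ edgesIn E B * k ^ k := by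
    refine card_biUnion_le_card_mul _ _ _ fun e he => ?_
    rw [Fintype.card_piFinset_const, hunif e (mem_filter.1 he).1]
  have hsub : {y : Fin k → Fin n | (∀ i, y i ∉ A) ∧ ∅ ∪ im y ∈ E} ⊆ (U : Set (Fin k → Fin n)) := by
    rintro y ⟨hy, hy'⟩
    rw [empty_union] at hy'
    simp only [U, coe_biUnion, Set.mem_iUnion, mem_coe, mem_filter, Fintype.mem_piFinset]
    refine ⟨im y, ⟨hy', fun v hv => ?_⟩, fun i => mem_im.2 ⟨i, rfl⟩⟩
    obtain ⟨i, rfl⟩ := mem_im.1 hv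
    have : y i ∈ A ∪ B := by rw [hun]; exact mem_univ _
    exact (mem_union.1 this).resolve_left (hy i)
  have hn0 : (0 : ℝ) < n := by exact_mod_cast hn
  refine (frac_mono hsub).trans ?_
  rw [frac, Set.ncard_coe_finset, Nat.card_eq_fintype_card, Fintype.card_fun, Fintype.card_fin,
    Fintype.card_fin, div_le_iff₀ (by positivity)]
  calc (U.card : ℝ) ≤ edgesIn E B * (k : ℝ) ^ k := by exact_mod_cast hU
    _ ≤ ξ * (n.choose k : ℝ) * (k : ℝ) ^ k := by gcongr
    _ ≤ ξ * (n : ℝ) ^ k * (k : ℝ) ^ k := by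
        gcongr
        exact_mod_cast Nat.choose_le_pow n k
    _ = ξ * (k : ℝ) ^ k * (n ^ k : ℕ) := by push_cast; ring

lemma ceil_half_sub_one {m d : ℕ} (hm : 1 ≤ m) (hd : 0 < d) :
    ⌈((m * d : ℕ) : ℝ) / (2 * (d : ℝ))⌉₊ - 1 = (m - 1) / 2 := by
  have hd0 : (0 : ℝ) < d := by exact_mod_cast hd
  have h1 : ((m * d : ℕ) : ℝ) / (2 * (d : ℝ)) = (m : ℝ) / 2 := by
    push_cast
    field_simp
  have h2 : ⌈(m : ℝ) / 2⌉₊ = (m + 1) / 2 := by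
    rw [Nat.ceil_eq_iff (by omega)]
    constructor
    · rw [lt_div_iff₀ two_pos]
      exact_mod_cast (by omega : ((m + 1) / 2 - 1) * 2 < m)
    · rw [div_le_iff₀ two_pos]
      exact_mod_cast (by omega : m ≤ (m + 1) / 2 * 2)
  rw [h1, h2]
  omega

lemma le_frac_mul_frac_compl_pow {m d n : ℕ} (hd : 1 ≤ d) (hm : 4 ≤ m) (hn : n = m * d)
    {A : Finset (Fin n)} (hA : A.card = (m - 1) / 2) {j N : ℕ} (hj : j ≤ N) :
    1 / (4 * (d : ℝ)) * (1 / 2) ^ N ≤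
      frac (A : Set (Fin n)) * frac ((A : Set (Fin n))ᶜ) ^ j := by
  have hd0 : (1 : ℝ) ≤ d := by exact_mod_cast hd
  have hm0 : (0 : ℝ) < m := by exact_mod_cast (by omega : 0 < m)
  have hnm : (n : ℝ) = m * d := by exact_mod_cast hn
  have hn0 : (0 : ℝ) < n := by rw [hnm]; positivity
  have : Nonempty (Fin n) := ⟨⟨0, by exact_mod_cast hn0⟩⟩
  have h1 : frac (A : Set (Fin n)) = A.card / n := by
    rw [frac, Set.ncard_coe_finset, Nat.card_fin]
  have h2 : 1 / (4 * (d : ℝ)) ≤ frac (A : Set (Fin n)) := by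
    have : (m : ℝ) ≤ 4 * A.card := by exact_mod_cast (by omega : m ≤ 4 * A.card)
    rw [h1, div_le_div_iff₀ (by positivity) hn0, hnm]
    nlinarith
  have h3 : 1 / 2 ≤ frac ((A : Set (Fin n))ᶜ) := by
    have : 2 * (A.card : ℝ) ≤ m := by exact_mod_cast (by omega : 2 * A.card ≤ m)
    have : (A.card : ℝ) / n ≤ 1 / 2 := by
      rw [div_le_div_iff₀ hn0 two_pos, hnm]
      nlinarith
    rw [frac_compl, h1]
    linarith
  have h4 := frac_nonneg (A : Set (Fin n))
  calc 1 / (4 * (d : ℝ)) * (1 / 2) ^ N ≤ 1 / (4 * (d : ℝ)) * (1 / 2) ^ j := by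
        gcongr 1 / (4 * (d : ℝ)) * ?_
        exact pow_le_pow_of_le_one (by norm_num) (by norm_num) hj
    _ ≤ _ := by gcongr

theorem exists_hasHamCycle (l r : ℕ) : ∃ ξ : ℝ, 0 < ξ ∧ ∃ n₀ : ℕ, ∀ m : ℕ, n₀ ≤ m * (l + r + 2) →
    ∀ E : Finset (Finset (Fin (m * (l + r + 2)))), Uniform _ (2 * l + r + 3) E →
      IsExtremal _ (2 * l + r + 3) (l + 1) E ξ →
      minDeg _ (Xedges (m * (l + r + 2)) (2 * l + r + 3) (l + 1)) (2 * l + r + 1) <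
        minDeg _ E (2 * l + r + 1) →
      HasHamCycle (m * (l + r + 2)) (2 * l + r + 3) (l + 1) E := by
  have hd1 : (1 : ℝ) ≤ (l + r + 2 : ℕ) := by exact_mod_cast (by omega : 1 ≤ l + r + 2)
  obtain ⟨p, hp⟩ : ∃ p : ℝ, p = 1 / (8 * (l + r + 2 : ℕ)) * (1 / 2) ^ (2 * (2 * l + r + 3)) :=
    ⟨_, rfl⟩
  have hp0 : 0 < p := by rw [hp]; positivity
  have hp1 : p ≤ 1 := by
    rw [hp]
    refine mul_le_one₀ ?_ (by positivity) (pow_le_one₀ (by norm_num) (by norm_num))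
    rw [div_le_one (by positivity)]
    linarith
  obtain ⟨γ, τ, ε, β, q, θ, δ, hγ, hτ, hβ, hq, hθ, hδ, hτp, hεp, hγε, hδγ, hδβ, hD, hβd, hqΛ, hγq,
    hεθ, hev⟩ := exists_parameters hp0 l r
  obtain ⟨n₁, hn₁⟩ := Filter.eventually_atTop.1 hev
  have hk0 : (0 : ℝ) < ((2 * l + r + 3 : ℕ) : ℝ) ^ (2 * l + r + 3) := by positivity
  obtain ⟨N, hN⟩ : ∃ N, N = 4 * (2 * l + r + 3) := ⟨_, rfl⟩
  refine ⟨δ / ((2 * l + r + 3 : ℕ) : ℝ) ^ (2 * l + r + 3), by positivity,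
    n₁ + 400 * (2 * l + r + 10) * (l + r + 2) + 4 * (2 * l + r + 1) +
      2 ^ (2 * l + r + 2) * (2 * l + r + 1) ^ 2 +
      2 * ((N + N * N) + (N + N * N) * (N + N * N) + (2 * l + r + 3)), ?_⟩
  rintro m hm E hunif ⟨A, B, -, hun, hA, -, hE⟩ hdeg
  obtain ⟨hη, hw, hnq, hlog, hcond⟩ := hn₁ (m * (l + r + 2)) (by omega)
  have hm' : 400 * (2 * l + r + 10) ≤ m :=
    Nat.le_of_mul_le_mul_right (by omega : _ * (l + r + 2) ≤ m * (l + r + 2)) (by omega)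
  rw [show 2 * l + r + 3 - (l + 1) = l + r + 2 by omega,
    ceil_half_sub_one (by omega) (by omega)] at hA
  have hnpos : 0 < m * (l + r + 2) := Nat.mul_pos (by omega) (by omega)
  have : Nonempty (Fin (m * (l + r + 2))) := ⟨⟨0, hnpos⟩⟩
  have hAc : Aᶜ.card = m * (l + r + 2) - (m - 1) / 2 := by rw [card_compl, Fintype.card_fin, hA]
  have hdeg' := fun S hS => deg_ge_of_minDeg_lt (by omega) hdeg (S := S) hS
  simp only [← hAc] at hdeg'
  obtain ⟨Bad, A₂, hctx, hBad, hedB⟩ := exists_ctx (A := A) (p := p) (γ := γ) (τ := τ) (ε := ε)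
    (η := δ / 2) (ξ := δ) (β := β) hunif
    (fun S hS => by
      rw [Fintype.card_fin]
      exact (Nat.le_add_right _ _).trans (hdeg' S hS))
    hp0 hp1 hγ hτ hτp hεp hγε
    (fun j hj => by
      refine le_trans (le_of_eq ?_)
        (le_frac_mul_frac_compl_pow (d := l + r + 2) (by omega) (by omega) rfl hA hj)
      rw [hp]
      field_simp
      norm_num)
    (by rw [Nat.card_fin]; exact hη)
    (by
      have h := edB_empty_le hnpos hunif hun (by positivity) hE
      rwa [div_mul_cancel₀ _ hk0.ne'] at h)
    (by linarith) (by linarith)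
  exact hasHamCycle_of_ctx hctx rfl (by omega) hA hdeg' hBad hedB (by omega) (by omega)
    (fun M hM => by obtain rfl : M = N := hM.trans hN.symm; omega) hD hβd hw hq hqΛ hγq
    hnq hθ.le hεθ hlog hcond

end Extremal

end LooseCycle

/-- Extremal case. For any integers `k ≥ 3` and `1 ≤ ℓ < k/2` there
exists `ξ > 0` such that for sufficiently large `n` divisible by `k-ℓ`: if `H` is an
`(ℓ,ξ)`-extremal `k`-uniform hypergraph on `n` vertices with
`δ_{k-2}(H) > δ_{k-2}(X_{k,ℓ}(n))`, then `H` contains a Hamiltonian ℓ-cycle. -/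
theorem statement4 (k ℓ : ℕ) (hk : 3 ≤ k) (hl : 1 ≤ ℓ) (hlk : 2 * ℓ < k) :
    ∃ ξ : ℝ, 0 < ξ ∧ ∃ n₀ : ℕ, ∀ n : ℕ, n₀ ≤ n → (k - ℓ) ∣ n →
      ∀ E : Finset (Finset (Fin n)), Uniform n k E →
        IsExtremal n k ℓ E ξ →
        minDeg n (Xedges n k ℓ) (k - 2) < minDeg n E (k - 2) →
        HasHamCycle n k ℓ E := by
  obtain ⟨l, rfl⟩ : ∃ l, ℓ = l + 1 := ⟨ℓ - 1, by omega⟩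
  obtain ⟨r, rfl⟩ : ∃ r, k = 2 * l + r + 3 := ⟨k - (2 * l + 3), by omega⟩
  obtain ⟨ξ, hξ, n₀, h⟩ := LooseCycle.exists_hasHamCycle l r
  refine ⟨ξ, hξ, n₀, fun n hn ⟨m, hm⟩ E hunif hext hdeg => ?_⟩
  obtain rfl : n = m * (l + r + 2) := by
    rw [hm, mul_comm, show 2 * l + r + 3 - (l + 1) = l + r + 2 by omega]
  exact h m hn E hunif hext hdeg
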